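/- arXiv:0704.0608 — 4 statements merged into one kernel-verified Lean document; each statement's English description precedes it below -/
import Mathlib

section
/- Let (R,m) be a Cohen–Macaulay Noetherian local ring of dimension 2 and let I be an m-primary ideal admitting a minimal reduction J. If the Rees algebra R[It] is Cohen–Macaulay, then I^2 = J·I, i.e. the reduction number of I with respect to J is at most 1. -/
/-- A Noetherian local ring is Cohen–Macaulay if it admits a regular sequence contained in
the maximal ideal whose length equals its Krull dimension (i.e. depth R = dim R). -/
def IsCohenMacaulayLocalRing (R : Type*) [CommRing R] [IsLocalRing R] : Prop :=
  ∃ rs : List R, (∀ x ∈ rs, x ∈ IsLocalRing.maximalIdeal R) ∧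
    RingTheory.Sequence.IsRegular R rs ∧ (rs.length : WithBot ℕ∞) = ringKrullDim R

/-- A commutative ring is Cohen–Macaulay if its localization at every maximal ideal is a
Cohen–Macaulay local ring. -/
def IsCohenMacaulayRing (A : Type*) [CommRing A] : Prop :=
  ∀ (P : Ideal A) (hP : P.IsMaximal),
    letI := hP.isPrime
    IsCohenMacaulayLocalRing (Localization.AtPrime P)

/-- `J` is a reduction of `I` : `J ⊆ I` and `I^(r+1) = J·I^r` for some `r ≥ 0`. -/
def Ideal.IsReductionOf {R : Type*} [CommRing R] (J I : Ideal R) : Prop :=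
  J ≤ I ∧ ∃ r : ℕ, I ^ (r + 1) = J * I ^ r

/-- A reduction `J` of `I` is minimal if it contains no strictly smaller reduction of `I`. -/
def Ideal.IsMinimalReductionOf {R : Type*} [CommRing R] (J I : Ideal R) : Prop :=
  J.IsReductionOf I ∧ ∀ J' : Ideal R, J' ≤ J → J'.IsReductionOf I → J' = J


universe u

section Depth

open IsLocalRing RingTheory.Sequence CategoryTheory Abelian Limits Pointwise

/-- `M` has a regular sequence of length `n` in the maximal ideal. -/
def DepthGE (S : Type u) [CommRing S] [IsLocalRing S] (n : ℕ) (M : Type u) [AddCommGroup M]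
    [Module S M] : Prop :=
  ∃ rs : List S, rs.length = n ∧ (∀ x ∈ rs, x ∈ maximalIdeal S) ∧ IsRegular M rs

variable {S : Type u} [CommRing S] [IsLocalRing S]

lemma maximalIdeal_smul_top_lt [IsNoetherianRing S] (M : Type u) [AddCommGroup M] [Module S M]
    [Module.Finite S M]
    [Nontrivial M] : maximalIdeal S • (⊤ : Submodule S M) < ⊤ := by
  refine lt_top_iff_ne_top.mpr fun h ↦ ?_
  have := Submodule.eq_bot_of_le_smul_of_le_jacobson_bot (maximalIdeal S) (⊤ : Submodule S M)
    (Module.Finite.fg_top) h.ge (IsLocalRing.maximalIdeal_le_jacobson _)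
  exact top_ne_bot this

lemma DepthGE.quotSMulTop [IsNoetherianRing S] {M : Type u} [AddCommGroup M] [Module S M]
    [Module.Finite S M] {n : ℕ}
    (h : DepthGE S (n + 1) M) {x : S} (hx : x ∈ maximalIdeal S) (hreg : IsSMulRegular M x) :
    DepthGE S n (QuotSMulTop x M) := by
  obtain ⟨rs, hlen, hmem, hrs⟩ := h
  have : Nontrivial M := hrs.nontrivial
  have : Nontrivial (QuotSMulTop x M) := nontrivial_quotSMulTop_of_mem_maximalIdeal M hx
  let N := ModuleCat.of S (S ⧸ maximalIdeal S)
  have hsupp : Module.support S N = PrimeSpectrum.zeroLocus (maximalIdeal S) := by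
    rw [Module.support_eq_zeroLocus, Ideal.annihilator_quotient]
  have key := ModuleCat.subsingleton_ext_of_exists_isRegular (maximalIdeal S) N
    hsupp.subset (ModuleCat.of S M) (maximalIdeal_smul_top_lt M) rs hmem hrs
  refine ModuleCat.exists_isRegular_of_exists_subsingleton_ext (maximalIdeal S) n
    (ModuleCat.of S (QuotSMulTop x M)) (maximalIdeal_smul_top_lt _) N hsupp fun i hi ↦ ?_
  have zero1 := AddCommGrpCat.isZero_of_iff_subsingleton.mpr (key i (by omega))
  have zero2 := AddCommGrpCat.isZero_of_iff_subsingleton.mpr (key (i + 1) (by omega))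
  exact AddCommGrpCat.subsingleton_of_isZero <| ShortComplex.Exact.isZero_of_both_zeros
    ((Ext.covariant_sequence_exact₃' N
      (IsSMulRegular.smulShortComplex_shortExact (M := ModuleCat.of S M) hreg)) i (i + 1) rfl)
    (zero1.eq_zero_of_src _) (zero2.eq_zero_of_tgt _)

/-- Associated primes of a module `M` have dimension at least the depth of `M`. -/
lemma DepthGE.le_ringKrullDim_quotient [IsNoetherianRing S] {n : ℕ} {M : Type u} [AddCommGroup M]
    [Module S M]
    [Module.Finite S M] (h : DepthGE S n M) {p : Ideal S} (hp : IsAssociatedPrime p M) :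
    (n : WithBot ℕ∞) ≤ ringKrullDim (S ⧸ p) := by
  have := hp.isPrime
  induction n generalizing M p with
  | zero => simpa using ringKrullDim_nonneg_of_nontrivial
  | succ n ih =>
    obtain ⟨rs, hlen, hmem, hrs⟩ := id h
    obtain ⟨x, rs, rfl⟩ := List.exists_cons_of_length_eq_add_one hlen
    have hx : x ∈ maximalIdeal S := hmem x (by simp)
    have hreg : IsSMulRegular M x := ((isRegular_cons_iff _ _ _).mp hrs).1
    have h' := h.quotSMulTop hx hreg
    obtain ⟨-, y, hy⟩ := isAssociatedPrime_iff.mp hp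
    have hpy : ∀ r, r ∈ p ↔ r • y = 0 := fun r ↦ by
      rw [hy, Submodule.mem_colon_singleton]; simp
    -- the submodule killed by `p`
    let T : Submodule S M := Submodule.torsionBySet S M p
    have hT : ¬ T ≤ x • (⊤ : Submodule S M) := by
      intro hle
      have hyT : y ∈ T := by
        rw [Submodule.mem_torsionBySet_iff]
        exact fun a ↦ (hpy _).mp a.2
      have h1 : T ≤ maximalIdeal S • T := by
        intro z hz
        obtain ⟨w, -, rfl⟩ := hle hz
        refine Submodule.smul_mem_smul hx ?_
        rw [Submodule.mem_torsionBySet_iff] at hz ⊢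
        intro a
        apply hreg
        have h0 : (a : S) • x • w = 0 := hz a
        simpa only [smul_zero, smul_comm x] using h0
      have h2 := Submodule.eq_bot_of_le_smul_of_le_jacobson_bot (maximalIdeal S) T
        (IsNoetherian.noetherian T) h1 (IsLocalRing.maximalIdeal_le_jacobson _)
      have : y = 0 := by rw [h2] at hyT; simpa using hyT
      apply hp.isPrime.ne_top
      rw [Ideal.eq_top_iff_one, hpy, this, smul_zero]
    obtain ⟨z, hzT, hz⟩ := SetLike.not_le_iff_exists.mp hT
    obtain ⟨q, hq, hle⟩ := exists_le_isAssociatedPrime_of_isNoetherianRing S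
      (Submodule.Quotient.mk z : QuotSMulTop x M)
      (by simpa [Submodule.Quotient.mk_eq_zero] using hz)
    have := hq.isPrime
    have hpq : p ≤ q := by
      intro r hr
      apply hle
      rw [Submodule.mem_colon_singleton, ← Submodule.Quotient.mk_smul]
      rw [Submodule.mem_torsionBySet_iff] at hzT
      simp [show r • z = 0 from hzT ⟨r, hr⟩]
    have hxq : x ∈ q := by
      apply hle
      rw [Submodule.mem_colon_singleton, ← Submodule.Quotient.mk_smul, Submodule.mem_bot,
        Submodule.Quotient.mk_eq_zero]
      exact Submodule.smul_mem_pointwise_smul _ _ _ trivial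
    have hxp : x ∉ p := by
      intro hxp
      have : y = 0 := hreg (by simpa using (hpy x).mp hxp)
      apply hp.isPrime.ne_top
      rw [Ideal.eq_top_iff_one, hpy, this, smul_zero]
    have hq' := ih h' hq inferInstance
    have h1 := ringKrullDim_succ_le_of_surjective (Ideal.Quotient.factor hpq)
      (Ideal.Quotient.factor_surjective hpq) (r := Ideal.Quotient.mk p x)
      (mem_nonZeroDivisors_of_ne_zero (by simpa [Ideal.Quotient.eq_zero_iff_mem] using hxp))
      (by simpa [Ideal.Quotient.eq_zero_iff_mem] using hxq)
    push_cast
    refine le_trans ?_ h1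
    gcongr

/-- A system of parameters of a module whose depth is at least its length is regular. -/
lemma DepthGE.isRegular_of_radical [IsNoetherianRing S] (xs : List S)
    {M : Type u} [AddCommGroup M] [Module S M] [Module.Finite S M]
    (h : DepthGE S xs.length M) (hxs : ∀ x ∈ xs, x ∈ maximalIdeal S)
    (hrad : ∀ Q : Ideal S, Q.IsPrime → Module.annihilator S M ≤ Q → (∀ x ∈ xs, x ∈ Q) →
      Q = maximalIdeal S) : IsRegular M xs := by
  induction xs generalizing M with
  | nil =>
    obtain ⟨rs, -, -, hrs⟩ := h
    have := hrs.nontrivial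
    exact IsRegular.nil S M
  | cons x xs ih =>
    have hx : x ∈ maximalIdeal S := hxs x (by simp)
    have hreg : IsSMulRegular M x := by
      by_contra hcon
      have hmem : x ∈ ⋃ p ∈ associatedPrimes S M, (p : Set S) := by
        rw [biUnion_associatedPrimes_eq_zero_divisors]
        rw [isSMulRegular_iff_right_eq_zero_of_smul] at hcon
        push Not at hcon
        obtain ⟨m, h1, h2⟩ := hcon
        exact ⟨m, h2, h1⟩
      simp only [Set.mem_iUnion] at hmem
      obtain ⟨p, hp, hxp⟩ := hmem
      have hp' : IsAssociatedPrime p M := hp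
      have := hp'.isPrime
      have h1 := h.le_ringKrullDim_quotient hp'
      have hann : Module.annihilator S M ≤ p := by
        rw [← Submodule.annihilator_top]; exact hp'.annihilator_le
      have hlocal : IsLocalRing (S ⧸ p) := .of_surjective' _ Ideal.Quotient.mk_surjective
      classical
      let s : Finset (S ⧸ p) := (xs.map (Ideal.Quotient.mk p)).toFinset
      have hmin : maximalIdeal (S ⧸ p) ∈ (Ideal.span (s : Set (S ⧸ p))).minimalPrimes := by
        refine ⟨⟨inferInstance, ?_⟩, ?_⟩
        · rw [Ideal.span_le]
          intro a ha
          simp only [s, List.coe_toFinset, List.mem_map, Set.mem_ofPred_eq] at ha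
          obtain ⟨b, hb, rfl⟩ := ha
          have hb' := hxs b (by simp [hb])
          have := IsLocalHom.of_surjective (Ideal.Quotient.mk p) Ideal.Quotient.mk_surjective
          exact (mem_maximalIdeal _).mpr fun hu ↦ hb' (hu.of_map (Ideal.Quotient.mk p) b)
        · rintro Q ⟨hQ, hQs⟩ -
          have hQ2 := hrad (Q.comap (Ideal.Quotient.mk p)) inferInstance
            (hann.trans (by
              intro a ha
              rw [Ideal.mem_comap, Ideal.Quotient.eq_zero_iff_mem.mpr ha]
              exact Q.zero_mem)) ?_
          · intro y hy
            obtain ⟨b, rfl⟩ := Ideal.Quotient.mk_surjective y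
            change b ∈ Q.comap (Ideal.Quotient.mk p)
            rw [hQ2]
            exact fun hb ↦ hy (hb.map _)
          · intro a ha
            rcases List.mem_cons.mp ha with rfl | ha
            · rw [Ideal.mem_comap, Ideal.Quotient.eq_zero_iff_mem.mpr hxp]
              exact Q.zero_mem
            · apply hQs
              apply Ideal.subset_span
              simp only [s, List.coe_toFinset, List.mem_map, Set.mem_ofPred_eq]
              exact ⟨a, ha, rfl⟩
      have h2 := Ideal.height_le_card_of_mem_minimalPrimes_span_finset hmin
      rw [← IsLocalRing.maximalIdeal_height_eq_ringKrullDim] at h1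
      have h3 : ((x :: xs).length : ℕ∞) ≤ (maximalIdeal (S ⧸ p)).height := by exact_mod_cast h1
      have h4 : s.card ≤ xs.length := (List.toFinset_card_le _).trans (by simp)
      have h5 : (x :: xs).length ≤ s.card := by exact_mod_cast h3.trans h2
      simp at h5
      omega
    refine (isRegular_cons_iff _ _ _).mpr ⟨hreg, ih (h.quotSMulTop hx hreg)
      (fun y hy ↦ hxs y (by simp [hy])) fun Q hQ hann hQs ↦ ?_⟩
    have hxann : x ∈ Module.annihilator S (QuotSMulTop x M) := by
      rw [Module.mem_annihilator]
      intro m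
      induction m using Submodule.Quotient.induction_on with
      | H z =>
        rw [← Submodule.Quotient.mk_smul, Submodule.Quotient.mk_eq_zero]
        exact Submodule.smul_mem_pointwise_smul _ _ _ trivial
    refine hrad Q hQ (le_trans ?_ hann) ?_
    · exact LinearMap.annihilator_le_of_surjective (Submodule.mkQ _) (Submodule.mkQ_surjective _)
    · intro y hy
      rcases List.mem_cons.mp hy with rfl | hy
      · exact hann hxann
      · exact hQs y hy

end Depth

open Polynomial

lemma Ideal.height_map_C_of_isPrime {N : Type*} [CommRing N] [IsNoetherianRing N] (p : Ideal N)
    [p.IsPrime] : (p.map (C : N →+* N[X])).height = p.height := by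
  have hp : (p.map (C : N →+* N[X])).IsPrime := Ideal.isPrime_map_C_of_isPrime
  have : (p.map (C : N →+* N[X])).LiesOver p := ⟨by
    ext x
    simp [Ideal.mem_map_C_iff, Ideal.under, coeff_C, apply_ite]
    ⟩
  rw [Ideal.height_eq_height_add_of_liesOver_of_hasGoingDown p]
  have : IsDomain (N[X] ⧸ p.map (algebraMap N N[X])) := (Ideal.Quotient.isDomain_iff_prime _).mpr hp
  simp [algebraMap_eq]

/-- The polynomial with prescribed coefficients, a generic linear combination of the `c i`. -/
noncomputable def genericElt {N : Type*} [CommRing N] {k : ℕ} (c : Fin k → N) : N[X] :=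
  ∑ i, C (c i) * X ^ (i : ℕ)

section
variable {N : Type*} [CommRing N] {k : ℕ} (c : Fin k → N)

lemma coeff_genericElt (i : Fin k) : (genericElt c).coeff i = c i := by
  simp [genericElt, coeff_X_pow, Fin.val_inj]

lemma mem_of_genericElt_mem_map_C {p : Ideal N} (h : genericElt c ∈ p.map C) (i : Fin k) :
    c i ∈ p := by
  rw [← coeff_genericElt c i]
  exact Ideal.mem_map_C_iff.mp h _

lemma genericElt_mem {I : Ideal N[X]} (h : ∀ i, C (c i) ∈ I) : genericElt c ∈ I :=
  I.sum_mem fun i _ ↦ I.mul_mem_right _ (h i)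

lemma height_comap_add_two_le [IsNoetherianRing N] (Q : Ideal N[X][X]) [Q.IsPrime]
    (ha : C (genericElt c) ∈ Q) (hb : genericElt (fun i ↦ C (c i)) ∈ Q)
    {i : Fin k} (hi : C (C (c i)) ∉ Q) :
    ((Q.comap C).comap C).height + 2 ≤ Q.height := by
  have h1 : ((Q.comap C).comap C).map C < Q.comap C := by
    refine lt_of_le_of_ne Ideal.map_comap_le fun h ↦ hi ?_
    exact mem_of_genericElt_mem_map_C c (by rw [h]; exact ha) i
  have h2 : (Q.comap C).map C < Q := by
    refine lt_of_le_of_ne Ideal.map_comap_le fun h ↦ hi ?_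
    exact mem_of_genericElt_mem_map_C (fun i ↦ C (c i))
      (h.symm ▸ hb : genericElt (fun i ↦ C (c i)) ∈ (Q.comap C).map C) i
  have := Ideal.isPrime_map_C_of_isPrime (P := (Q.comap C).comap C)
  have := Ideal.isPrime_map_C_of_isPrime (P := Q.comap C)
  have e1 := Ideal.height_add_one_le_of_lt_of_isPrime h1
  have e2 := Ideal.height_add_one_le_of_lt_of_isPrime h2
  rw [Ideal.height_map_C_of_isPrime] at e1 e2
  rw [← one_add_one_eq_two, ← add_assoc]
  exact (add_le_add_left e1 1).trans e2

lemma height_comap_add_three_le [IsNoetherianRing N] (m : Ideal N) [m.IsPrime] (Q : Ideal N[X][X])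
    [Q.IsPrime] (hQ : Q < (m.map C).map C)
    (ha : C (genericElt c) ∈ Q) (hb : genericElt (fun i ↦ C (c i)) ∈ Q)
    {i : Fin k} (hi : C (C (c i)) ∉ Q) :
    ((Q.comap C).comap C).height + 3 ≤ m.height := by
  have := Ideal.isPrime_map_C_of_isPrime (P := m)
  have := Ideal.isPrime_map_C_of_isPrime (P := m.map C)
  have e1 := height_comap_add_two_le c Q ha hb hi
  have e2 := Ideal.height_add_one_le_of_lt_of_isPrime hQ
  rw [Ideal.height_map_C_of_isPrime, Ideal.height_map_C_of_isPrime] at e2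
  rw [← two_add_one_eq_three, ← add_assoc]
  exact (add_le_add_left e1 1).trans e2
end

lemma C_mul_X_sub_C_mem_nonZeroDivisors {B : Type*} [CommRing B] {b c : B}
    (hc : c ∈ nonZeroDivisors B) : C c * X - C b ∈ nonZeroDivisors B[X] := by
  nontriviality B
  have hc0 : c ≠ 0 := nonZeroDivisors.ne_zero hc
  refine mem_nonZeroDivisors_of_leadingCoeff ?_
  rwa [sub_eq_add_neg, ← C_neg, leadingCoeff_linear hc0]

/-- Adjoining a fraction with a regular denominator does not raise the Krull dimension. -/
lemma ringKrullDim_le_of_surjective_polynomial {B A : Type*} [CommRing B] [IsNoetherianRing B]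
    [CommRing A] (f : B[X] →+* A) (hf : Function.Surjective f) {b c : B}
    (hc : c ∈ nonZeroDivisors B) (h : f (C c * X) = f (C b)) {n : ℕ}
    (hn : ringKrullDim B ≤ n) : ringKrullDim A ≤ n := by
  have h1 := ringKrullDim_succ_le_of_surjective f hf
    (C_mul_X_sub_C_mem_nonZeroDivisors (b := b) hc) (by rw [map_sub, h, sub_self])
  rw [ringKrullDim_of_isNoetherianRing] at h1
  have h2 : ringKrullDim A + 1 ≤ ((n + 1 : ℕ) : WithBot ℕ∞) := by
    refine h1.trans ?_
    push_cast
    gcongr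
  generalize ringKrullDim A = d at h2
  cases d with
  | bot => exact bot_le
  | coe d =>
    have h3 : d + 1 ≤ ((n + 1 : ℕ) : ℕ∞) := by exact_mod_cast h2
    have h4 : d ≤ (n : ℕ∞) := by
      push_cast at h3
      exact (ENat.add_le_add_iff_right ENat.one_ne_top).mp h3
    exact_mod_cast h4

open scoped nonZeroDivisors in
lemma ringKrullDim_adjoin_le {R : Type*} [CommRing R] [IsNoetherianRing R] {n : ℕ}
    (hn : ringKrullDim R ≤ n) {c : R} (hc : c ∈ R⁰) (s : Finset R) :
    ringKrullDim (Algebra.adjoin R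
      (insert (monomial 1 c) ((fun r ↦ monomial 1 r) '' (s : Set R)) : Set R[X])) ≤
        (n + 1 : ℕ) := by
  classical
  induction s using Finset.induction_on with
  | empty =>
    let f : R[X] →ₐ[R] Algebra.adjoin R ({monomial 1 c} : Set R[X]) :=
      aeval ⟨monomial 1 c, Algebra.subset_adjoin rfl⟩
    have hf : Function.Surjective f := by
      rintro ⟨x, hx⟩
      have hx' := hx
      rw [Algebra.adjoin_singleton_eq_range_aeval] at hx'
      obtain ⟨p, hp⟩ := hx'
      refine ⟨p, Subtype.ext (Eq.trans ?_ hp)⟩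
      exact (aeval_algHom_apply (Subalgebra.val _) _ p).symm
    have h0 : (insert (monomial 1 c)
        ((fun r ↦ monomial 1 r) '' ((∅ : Finset R) : Set R)) : Set R[X])
      = {monomial 1 c} := by simp
    rw [h0]
    refine (ringKrullDim_le_of_surjective f.toRingHom hf).trans ?_
    rw [ringKrullDim_of_isNoetherianRing]
    push_cast
    gcongr
  | insert a s ha ih =>
    let T : Set R[X] := insert (monomial 1 c) ((fun r ↦ monomial 1 r) '' (s : Set R))
    let B := Algebra.adjoin R T
    let T' : Set R[X] := insert (monomial 1 c) ((fun r ↦ monomial 1 r) '' (insert a s : Finset R))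
    have hTT : T ⊆ T' := by
      apply Set.insert_subset_insert
      apply Set.image_mono
      simp
    have hT'eq : T' = insert (monomial 1 a) T := by
      simp only [T', T, Finset.coe_insert, Set.image_insert_eq]
      rw [Set.insert_comm]
    have hTfin : T.Finite := (s.finite_toSet.image _).insert _
    have : IsNoetherianRing B := isNoetherianRing_of_fg
      (Subalgebra.fg_def.mpr ⟨T, hTfin, rfl⟩)
    have haT : (monomial 1 a : R[X]) ∈ Algebra.adjoin R T' :=
      Algebra.subset_adjoin (by rw [hT'eq]; exact Set.mem_insert _ _)
    let f : B[X] →+* Algebra.adjoin R T' :=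
      eval₂RingHom (Subalgebra.inclusion (Algebra.adjoin_mono hTT)).toRingHom ⟨monomial 1 a, haT⟩
    have hf : Function.Surjective f := by
      rintro ⟨x, hx⟩
      refine Algebra.adjoin_induction
        (p := fun x hx ↦ ∃ q, f q = (⟨x, hx⟩ : Algebra.adjoin R T')) ?_ ?_ ?_ ?_ hx
      · intro x hx
        rw [hT'eq] at hx
        rcases hx with rfl | hx
        · exact ⟨X, by simp [f]⟩
        · exact ⟨C ⟨x, Algebra.subset_adjoin hx⟩, by simp [f]⟩
      · intro r
        exact ⟨C (algebraMap R B r), by simp [f]; rfl⟩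
      · rintro x y hx hy ⟨q₁, h1⟩ ⟨q₂, h2⟩
        exact ⟨q₁ + q₂, by rw [map_add, h1, h2]; rfl⟩
      · rintro x y hx hy ⟨q₁, h1⟩ ⟨q₂, h2⟩
        exact ⟨q₁ * q₂, by rw [map_mul, h1, h2]; rfl⟩
    have hcB : algebraMap R B c ∈ B⁰ := by
      rw [mem_nonZeroDivisors_iff_right]
      rintro ⟨x, hx⟩ h
      have h1 : x * C c = 0 := congrArg Subtype.val h
      ext n
      have h2 := congrArg (coeff · n) h1
      simp only [coeff_mul_C, coeff_zero] at h2
      exact (mem_nonZeroDivisors_iff_right.mp hc) _ h2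
    refine ringKrullDim_le_of_surjective_polynomial f hf hcB
      (b := algebraMap R B a * ⟨monomial 1 c, Algebra.subset_adjoin (Set.mem_insert _ _)⟩) ?_ ih
    apply Subtype.ext
    rw [map_mul, map_mul, map_mul]
    simp [f]
    rw [mul_comm]

section
open IsLocalRing RingTheory.Sequence

lemma DepthGE.of_isRegular_of_le {S : Type u} [CommRing S] [IsLocalRing S] {rs : List S}
    (hmem : ∀ x ∈ rs, x ∈ maximalIdeal S) (hrs : IsRegular S rs) {n : ℕ} (hn : n ≤ rs.length) :
    DepthGE S n S := by
  have hmem' : ∀ x ∈ rs.take n, x ∈ maximalIdeal S := fun x hx ↦ hmem x (List.mem_of_mem_take hx)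
  refine ⟨rs.take n, by simpa using hn, hmem', ?_⟩
  rw [isRegular_iff_isWeaklyRegular_of_subset_maximalIdeal hmem']
  have h := hrs.toIsWeaklyRegular
  rw [← List.take_append_drop n rs, isWeaklyRegular_append_iff] at h
  exact h.1

/-- Depth does not drop under flat local homomorphisms. -/
lemma DepthGE.of_flat {S S' : Type u} [CommRing S] [IsLocalRing S] [CommRing S'] [IsLocalRing S']
    (f : S →+* S') [IsLocalHom f] (hf : f.Flat) {n : ℕ} (h : DepthGE S n S) : DepthGE S' n S' := by
  obtain ⟨rs, hlen, hmem, hrs⟩ := h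
  algebraize [f]
  have : IsLocalHom (algebraMap S S') := ‹_›
  have : Module.FaithfullyFlat S S' := Module.FaithfullyFlat.of_flat_of_isLocalHom
  refine ⟨rs.map f, by simpa using hlen, fun x hx ↦ ?_, hrs.of_faithfullyFlat⟩
  obtain ⟨y, hy, rfl⟩ := List.mem_map.mp hx
  exact (map_mem_nonunits_iff f y).mpr (hmem y hy)

lemma DepthGE.localization_map_C {N : Type u} [CommRing N] (p : Ideal N) [p.IsPrime]
    [(p.map (C : N →+* N[X])).IsPrime] {n : ℕ}
    (h : DepthGE (Localization.AtPrime p) n (Localization.AtPrime p)) :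
    DepthGE (Localization.AtPrime (p.map (C : N →+* N[X]))) n
      (Localization.AtPrime (p.map (C : N →+* N[X]))) := by
  have hp : p = (p.map (C : N →+* N[X])).comap C := by
    ext x
    simp [Ideal.mem_map_C_iff, coeff_C, apply_ite]
  have hC : (C : N →+* N[X]).Flat := by
    rw [← algebraMap_eq, RingHom.flat_algebraMap_iff]
    infer_instance
  exact h.of_flat (Localization.localRingHom _ _ C hp) (hC.localRingHom _ _ hp)

/-- The colon property of a regular sequence, descended from a localization. -/
lemma exists_mul_mem_ofList_of_depthGE {B : Type u} [CommRing B] [IsNoetherianRing B] (P : Ideal B)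
    [P.IsPrime] (xs : List B) (x : B)
    (h : DepthGE (Localization.AtPrime P) (xs.length + 1) (Localization.AtPrime P))
    (hxs : ∀ y ∈ xs, y ∈ P) (hx : x ∈ P)
    (hrad : ∀ Q : Ideal B, Q.IsPrime → Q ≤ P → (∀ y ∈ xs, y ∈ Q) → x ∈ Q → Q = P)
    {z : B} (hz : x * z ∈ Ideal.ofList xs) : ∃ u ∉ P, u * z ∈ Ideal.ofList xs := by
  let S := Localization.AtPrime P
  let f := algebraMap B S
  have hreg : IsRegular S ((xs ++ [x]).map f) := by
    refine DepthGE.isRegular_of_radical (M := S) ((xs ++ [x]).map f) (by simpa using h) ?_ ?_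
    · intro y hy
      obtain ⟨w, hw, rfl⟩ := List.mem_map.mp hy
      rw [IsLocalization.AtPrime.to_map_mem_maximal_iff S P]
      rcases List.mem_append.mp hw with hw | hw
      · exact hxs w hw
      · rwa [List.mem_singleton.mp hw]
    · intro Q hQ _ hQs
      have hle : Q.comap f ≤ P := by
        exact (Ideal.comap_mono (le_maximalIdeal hQ.ne_top)).trans
          (IsLocalization.AtPrime.under_maximalIdeal S P).le
      have h1 := hrad (Q.comap f) inferInstance hle (fun y hy ↦ hQs _ (by simp; grind))
        (hQs _ (by simp))
      have h2 : (Q.comap f).map f = Q := IsLocalization.map_under P.primeCompl S Q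
      rw [← h2, h1]
      exact Localization.AtPrime.map_eq_maximalIdeal
  have h1 := hreg.toIsWeaklyRegular
  rw [List.map_append, isWeaklyRegular_append_iff, List.map_singleton,
    isWeaklyRegular_singleton_iff] at h1
  have h2 : f z ∈ (Ideal.ofList xs).map f := by
    have h3 : f x • (Submodule.Quotient.mk (f z) :
        S ⧸ (Ideal.ofList (xs.map f) • ⊤ : Submodule S S)) = 0 := by
      rw [← Submodule.Quotient.mk_smul, Submodule.Quotient.mk_eq_zero, smul_eq_mul, smul_eq_mul,
        ← map_mul, Ideal.mul_top, ← Ideal.map_ofList]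
      exact Ideal.mem_map_of_mem f hz
    have h4 := h1.2 (h3.trans (smul_zero _).symm)
    rwa [Submodule.Quotient.mk_eq_zero, smul_eq_mul, Ideal.mul_top, ← Ideal.map_ofList] at h4
  rw [IsLocalization.algebraMap_mem_map_algebraMap_iff P.primeCompl] at h2
  exact h2
end

section
open scoped nonZeroDivisors

variable {R : Type u} [CommRing R] (I : Ideal R)

/-- The projection of the Rees algebra onto its degree zero part. -/
noncomputable def reesCoeffZero : reesAlgebra I →+* R :=
  (constantCoeff (R := R)).comp (reesAlgebra I).subtype

/-- The element `x t` of the Rees algebra. -/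
noncomputable def reesMonomial (x : I) : reesAlgebra I :=
  ⟨monomial 1 (x : R), reesAlgebra.monomial_mem.mpr (by simp)⟩

variable {I}

@[simp] lemma reesCoeffZero_algebraMap (r : R) : reesCoeffZero I (algebraMap R _ r) = r := by
  simp [reesCoeffZero]

@[simp] lemma reesCoeffZero_reesMonomial (x : I) : reesCoeffZero I (reesMonomial I x) = 0 := by
  simp [reesCoeffZero, reesMonomial]

lemma reesCoeffZero_surjective : Function.Surjective (reesCoeffZero I) :=
  fun r ↦ ⟨_, reesCoeffZero_algebraMap r⟩

lemma reesMonomial_add (x y : I) :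
    reesMonomial I (x + y) = reesMonomial I x + reesMonomial I y :=
  Subtype.ext (by simp [reesMonomial])

lemma reesMonomial_smul (r : R) (x : I) :
    reesMonomial I (r • x) = algebraMap R _ r * reesMonomial I x :=
  Subtype.ext (by simp [reesMonomial])

lemma algebraMap_mul_reesMonomial (x y : I) :
    algebraMap R (reesAlgebra I) x * reesMonomial I y =
      algebraMap R (reesAlgebra I) y * reesMonomial I x :=
  Subtype.ext (by simp [reesMonomial, mul_comm])

lemma algebraMap_mem_nonZeroDivisors_reesAlgebra {c : R} (hc : c ∈ R⁰) :
    algebraMap R (reesAlgebra I) c ∈ (reesAlgebra I)⁰ := by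
  rw [mem_nonZeroDivisors_iff_right]
  rintro ⟨x, hx⟩ h
  have h1 : x * C c = 0 := congrArg Subtype.val h
  ext n
  have h2 := congrArg (coeff · n) h1
  simp only [coeff_mul_C, coeff_zero] at h2
  exact (mem_nonZeroDivisors_iff_right.mp hc) _ h2

lemma reesMonomial_mem_nonZeroDivisors {c : I} (hc : (c : R) ∈ R⁰) :
    reesMonomial I c ∈ (reesAlgebra I)⁰ := by
  rw [mem_nonZeroDivisors_iff_right]
  rintro ⟨x, hx⟩ h
  have h1 : x * monomial 1 (c : R) = 0 := congrArg Subtype.val h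
  ext n
  have h2 := congrArg (coeff · (n + 1)) h1
  simp only [coeff_mul_monomial, coeff_zero] at h2
  exact (mem_nonZeroDivisors_iff_right.mp hc) _ h2

/-- An ideal of the Rees algebra containing all elements `x t` contains every
element whose degree zero part it contains. -/
lemma mem_of_reesCoeffZero_mem {P : Ideal (reesAlgebra I)} (hP : ∀ x, reesMonomial I x ∈ P)
    (f : reesAlgebra I) (hf : algebraMap R _ (reesCoeffZero I f) ∈ P) : f ∈ P := by
  suffices h : f - algebraMap R _ (reesCoeffZero I f) ∈ P by
    simpa using P.add_mem h hf
  clear hf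
  obtain ⟨f, hf⟩ := f
  have hf' := hf
  rw [← adjoin_monomial_eq_reesAlgebra] at hf'
  have hle : ∀ x, x ∈ Algebra.adjoin R (Submodule.map (monomial 1 : R →ₗ[R] R[X]) I : Set R[X]) →
      x ∈ reesAlgebra I := fun x hx ↦ adjoin_monomial_eq_reesAlgebra I ▸ hx
  induction hf' using Algebra.adjoin_induction with
  | mem x hx =>
    obtain ⟨y, hy, rfl⟩ := hx
    have : reesCoeffZero I ⟨monomial 1 y, hf⟩ = 0 := reesCoeffZero_reesMonomial ⟨y, hy⟩
    rw [this, map_zero, sub_zero]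
    exact hP ⟨y, hy⟩
  | algebraMap r =>
    have : reesCoeffZero I ⟨algebraMap R R[X] r, hf⟩ = r := reesCoeffZero_algebraMap r
    rw [this]
    convert P.zero_mem
    exact sub_self _
  | add x y hx hy h1 h2 =>
    have e : (⟨x + y, hf⟩ : reesAlgebra I) = ⟨x, hle x hx⟩ + ⟨y, hle y hy⟩ := rfl
    rw [e, map_add, map_add, add_sub_add_comm]
    exact P.add_mem (h1 _) (h2 _)
  | mul x y hx hy h1 h2 =>
    have e : (⟨x * y, hf⟩ : reesAlgebra I) = ⟨x, hle x hx⟩ * ⟨y, hle y hy⟩ := rfl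
    rw [e, map_mul, map_mul]
    have := P.add_mem (P.mul_mem_left ⟨x, hle x hx⟩ (h2 (hle y hy)))
      (P.mul_mem_right (algebraMap R _ (reesCoeffZero I ⟨y, hle y hy⟩)) (h1 (hle x hx)))
    convert this using 1
    ring

lemma ringKrullDim_reesAlgebra_le [IsNoetherianRing R] {n : ℕ} (hn : ringKrullDim R ≤ n) {c : R}
    (hc : c ∈ R⁰) (hcI : c ∈ I) : ringKrullDim (reesAlgebra I) ≤ (n + 1 : ℕ) := by
  obtain ⟨s, hs⟩ := IsNoetherian.noetherian I
  have key := ringKrullDim_adjoin_le hn hc s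
  have : Algebra.adjoin R
      (insert (monomial 1 c) ((fun r ↦ monomial 1 r) '' (s : Set R)) : Set R[X]) =
      reesAlgebra I := by
    apply le_antisymm
    · refine Algebra.adjoin_le ?_
      rintro _ (rfl | ⟨x, hx, rfl⟩)
      · exact reesAlgebra.monomial_mem.mpr (by simpa)
      · exact reesAlgebra.monomial_mem.mpr (by
          rw [pow_one, ← hs]; exact Submodule.subset_span hx)
    · rw [← adjoin_monomial_eq_reesAlgebra]
      refine Algebra.adjoin_le ?_
      rw [← hs, Submodule.map_span]
      exact Submodule.span_le (p := Subalgebra.toSubmodule (Algebra.adjoin R _)).mpr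
        ((Set.subset_insert _ _).trans Algebra.subset_adjoin)
  rwa [this] at key

lemma ringKrullDim_succ_le_localization_reesAlgebra [IsLocalRing R]
    {c : I} (hc : (c : R) ∈ R⁰)
    (M : Ideal (reesAlgebra I)) [M.IsPrime]
    (hM : M = (IsLocalRing.maximalIdeal R).comap (reesCoeffZero I)) :
    ringKrullDim R + 1 ≤ ringKrullDim (Localization.AtPrime M) := by
  let f : Localization.AtPrime M →+* R := IsLocalization.lift (M := M.primeCompl)
    (g := reesCoeffZero I) fun y ↦ by
      have hy : (y : reesAlgebra I) ∉ M := y.2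
      simpa [show ∀ z, z ∈ M ↔ z ∈ (IsLocalRing.maximalIdeal R).comap (reesCoeffZero I) from
        fun z ↦ by rw [← hM]] using hy
  have hf : Function.Surjective f := fun r ↦
    ⟨algebraMap _ _ (algebraMap R (reesAlgebra I) r), by simp [f]⟩
  refine ringKrullDim_succ_le_of_surjective f hf
    (r := algebraMap _ (Localization.AtPrime M) (reesMonomial I c)) ?_ (by simp [f])
  exact IsLocalization.map_nonZeroDivisors_le M.primeCompl _
    (Submonoid.mem_map_of_mem _ (reesMonomial_mem_nonZeroDivisors hc))

/-- An ideal that is primary to the maximal ideal contains a regular element. -/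
lemma exists_mem_nonZeroDivisors_of_isRegular [IsLocalRing R]
    (hI : I.radical = IsLocalRing.maximalIdeal R)
    {n : ℕ} (h : DepthGE R (n + 1) R) : ∃ c ∈ I, c ∈ R⁰ := by
  obtain ⟨rs, hlen, hmem, hrs⟩ := h
  obtain ⟨x, rs, rfl⟩ := List.exists_cons_of_length_eq_add_one hlen
  have hx : x ∈ I.radical := hI ▸ hmem x (by simp)
  obtain ⟨n, hn⟩ := hx
  refine ⟨x ^ n, hn, pow_mem ?_ n⟩
  have := ((RingTheory.Sequence.isRegular_cons_iff _ _ _).mp hrs).1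
  rw [mem_nonZeroDivisors_iff_right]
  intro y hy
  apply this
  simpa [mul_comm] using hy
end

section Generic
variable {N N' : Type*} [CommRing N] [CommRing N'] {k : ℕ}

lemma mem_map_C_map_C_iff {p : Ideal N} {f : N[X][X]} :
    f ∈ (p.map (C : N →+* N[X])).map (C : N[X] →+* N[X][X]) ↔ ∀ i j, (f.coeff i).coeff j ∈ p := by
  simp [Ideal.mem_map_C_iff]

instance isPrime_map_C_map_C (p : Ideal N) [p.IsPrime] :
    ((p.map (C : N →+* N[X])).map (C : N[X] →+* N[X][X])).IsPrime :=
  have := Ideal.isPrime_map_C_of_isPrime (P := p)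
  Ideal.isPrime_map_C_of_isPrime

/-- The generic linear combination of the `c i` using the inner variable. -/
noncomputable def innerGeneric (c : Fin k → N) : N[X][X] := C (genericElt c)

/-- The generic linear combination of the `c i` using the outer variable. -/
noncomputable def outerGeneric (c : Fin k → N) : N[X][X] := genericElt fun i ↦ C (c i)

variable (c d e : Fin k → N)

lemma map_innerGeneric (f : N →+* N') :
    mapRingHom (mapRingHom f) (innerGeneric c) = innerGeneric (f ∘ c) := by
  simp [innerGeneric, genericElt]

lemma map_outerGeneric (f : N →+* N') :
    mapRingHom (mapRingHom f) (outerGeneric c) = outerGeneric (f ∘ c) := by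
  simp [outerGeneric, genericElt]

variable {c} in
lemma innerGeneric_mem {Q : Ideal N[X][X]} (h : ∀ i, C (C (c i)) ∈ Q) : innerGeneric c ∈ Q :=
  genericElt_mem (I := Q.comap C) c h

variable {c} in
lemma outerGeneric_mem {Q : Ideal N[X][X]} (h : ∀ i, C (C (c i)) ∈ Q) : outerGeneric c ∈ Q :=
  genericElt_mem _ h

variable {d e}

lemma outerGeneric_mul_innerGeneric (h : ∀ i j, d i * e j = d j * e i) :
    outerGeneric d * innerGeneric e = innerGeneric d * outerGeneric e := by
  simp only [outerGeneric, innerGeneric, genericElt, map_sum, Finset.sum_mul_sum]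
  rw [Finset.sum_comm]
  refine Finset.sum_congr rfl fun i _ ↦ Finset.sum_congr rfl fun j _ ↦ ?_
  have : (C (C (d j)) * C (C (e i)) : N[X][X]) = C (C (d i)) * C (C (e j)) := by
    rw [← C_mul, ← C_mul, ← C_mul, ← C_mul, h]
  simp only [map_mul]
  linear_combination (X ^ (j : ℕ) * C (X ^ (i : ℕ))) * this

lemma innerGeneric_mul_C {z w : N} (h : ∀ i, e i * z = d i * w) :
    innerGeneric e * C (C z) = innerGeneric d * C (C w) := by
  simp only [innerGeneric, genericElt, map_sum, Finset.sum_mul]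
  refine Finset.sum_congr rfl fun i _ ↦ ?_
  have : (C (C (e i)) * C (C z) : N[X][X]) = C (C (d i)) * C (C w) := by
    rw [← C_mul, ← C_mul, ← C_mul, ← C_mul, h]
  simp only [map_mul]
  linear_combination (C (X ^ (i : ℕ))) * this

lemma outerGeneric_mul_C {z w : N} (h : ∀ i, e i * z = d i * w) :
    outerGeneric e * C (C z) = outerGeneric d * C (C w) := by
  simp only [outerGeneric, genericElt, Finset.sum_mul]
  refine Finset.sum_congr rfl fun i _ ↦ ?_
  have : (C (C (e i)) * C (C z) : N[X][X]) = C (C (d i)) * C (C w) := by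
    rw [← C_mul, ← C_mul, ← C_mul, ← C_mul, h]
  linear_combination (X ^ (i : ℕ)) * this

/-- In height two, generic linear combinations of parameters are parameters. -/
lemma eq_map_C_map_C_of_generic_mem [IsNoetherianRing N] {m : Ideal N} [m.IsPrime]
    (hm : m.height ≤ 2) (hc : m ≤ (Ideal.span (Set.range c)).radical) {Q : Ideal N[X][X]}
    [Q.IsPrime] (hQ : Q ≤ (m.map C).map C) (ha : innerGeneric c ∈ Q) (hb : outerGeneric c ∈ Q) :
    Q = (m.map C).map C := by
  by_cases h : ∀ i, C (C (c i)) ∈ Q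
  · refine le_antisymm hQ ?_
    rw [Ideal.map_le_iff_le_comap, Ideal.map_le_iff_le_comap]
    refine hc.trans (Ideal.IsPrime.radical_le_iff inferInstance |>.mpr ?_)
    rw [Ideal.span_le]
    rintro _ ⟨i, rfl⟩
    exact h i
  · push Not at h
    obtain ⟨i, hi⟩ := h
    by_contra hne
    have h1 := (height_comap_add_three_le c m Q (lt_of_le_of_ne hQ hne) ha hb hi).trans hm
    have h2 : (3 : ℕ∞) ≤ 2 := le_trans le_add_self h1
    exact absurd h2 (by decide)

end Generic

section
open scoped nonZeroDivisors
variable {R : Type u} [CommRing R] {I J : Ideal R}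

lemma reesMonomial_mem_of_isReductionOf (hJ : J.IsReductionOf I) {P : Ideal (reesAlgebra I)}
    [P.IsPrime] (h : ∀ x : I, (x : R) ∈ J → reesMonomial I x ∈ P) (x : I) :
    reesMonomial I x ∈ P := by
  obtain ⟨hJI, r, hr⟩ := hJ
  have key : ∀ y ∈ J * I ^ r, ∀ hy' : monomial (r + 1) y ∈ reesAlgebra I,
      (⟨_, hy'⟩ : reesAlgebra I) ∈ P := by
    intro y hy
    induction hy using Submodule.mul_induction_on' with
    | mem_mul_mem a ha b hb =>
      intro hy'
      have e : (⟨_, hy'⟩ : reesAlgebra I) =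
          ⟨monomial r b, reesAlgebra.monomial_mem.mpr hb⟩ * reesMonomial I ⟨a, hJI ha⟩ :=
        Subtype.ext (by simp [reesMonomial, monomial_mul_monomial, mul_comm])
      rw [e]
      exact P.mul_mem_left _ (h ⟨a, hJI ha⟩ ha)
    | add a ha b hb h1 h2 =>
      intro hy'
      rw [← hr] at ha hb
      have ha' := reesAlgebra.monomial_mem.mpr ha
      have hb' := reesAlgebra.monomial_mem.mpr hb
      have e : (⟨_, hy'⟩ : reesAlgebra I) = ⟨_, ha'⟩ + ⟨_, hb'⟩ :=
        Subtype.ext (by simp)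
      rw [e]
      exact P.add_mem (h1 ha') (h2 hb')
  refine Ideal.IsPrime.mem_of_pow_mem ‹_› (r + 1) ?_
  have hx : (x : R) ^ (r + 1) ∈ I ^ (r + 1) := Ideal.pow_mem_pow x.2 _
  have e : reesMonomial I x ^ (r + 1) =
      ⟨monomial (r + 1) ((x : R) ^ (r + 1)), reesAlgebra.monomial_mem.mpr hx⟩ :=
    Subtype.ext (by simp [reesMonomial, monomial_pow])
  rw [e]
  exact key _ (hr ▸ hx) _

lemma Ideal.IsReductionOf.le_radical (hJ : J.IsReductionOf I) : I ≤ J.radical := by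
  obtain ⟨-, r, hr⟩ := hJ
  intro x hx
  refine ⟨r + 1, (Ideal.mul_le_left : J * I ^ r ≤ J) ?_⟩
  rw [← hr]
  exact Ideal.pow_mem_pow hx _

/-- If the Rees algebra has dimension three, the generic linear combinations of the elements of a
reduction in degrees zero and one generate a primary ideal. -/
lemma eq_map_C_map_C_of_generic_mem_reesAlgebra [IsLocalRing R] [IsNoetherianRing R]
    (hI : I.radical = IsLocalRing.maximalIdeal R) (hJ : J.IsReductionOf I)
    (hdim : (IsLocalRing.maximalIdeal R).height ≤ 2) {z : R} (hz : z ∈ R⁰)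
    (hzm : z ∈ IsLocalRing.maximalIdeal R)
    {k : ℕ} {c : Fin k → I} (hc : Ideal.span (Set.range fun i ↦ (c i : R)) = J)
    {M : Ideal (reesAlgebra I)} [M.IsPrime]
    (hM : M = (IsLocalRing.maximalIdeal R).comap (reesCoeffZero I)) (hMdim : M.height ≤ 3)
    {Q : Ideal (reesAlgebra I)[X][X]} [Q.IsPrime] (hQ : Q ≤ (M.map C).map C)
    (h1 : innerGeneric (fun i ↦ algebraMap R (reesAlgebra I) (c i)) ∈ Q)
    (h2 : outerGeneric (fun i ↦ algebraMap R (reesAlgebra I) (c i)) ∈ Q)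
    (h3 : innerGeneric (fun i ↦ reesMonomial I (c i)) ∈ Q)
    (h4 : outerGeneric (fun i ↦ reesMonomial I (c i)) ∈ Q) :
    Q = (M.map C).map C := by
  have : IsNoetherianRing (reesAlgebra I) := inferInstance
  have hMalg : ∀ r, algebraMap R (reesAlgebra I) r ∈ M ↔ r ∈ IsLocalRing.maximalIdeal R := by
    intro r
    rw [hM, Ideal.mem_comap, reesCoeffZero_algebraMap]
  let φ : R[X][X] →+* (reesAlgebra I)[X][X] :=
    mapRingHom (mapRingHom (algebraMap R (reesAlgebra I)))
  have hq := eq_map_C_map_C_of_generic_mem (fun i ↦ (c i : R)) hdim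
    (Q := Q.comap φ)
    (by
      rw [hc, ← hI]
      exact Ideal.radical_le_radical_iff.mpr hJ.le_radical)
    (by
      intro f hf
      rw [mem_map_C_map_C_iff]
      intro i j
      have := mem_map_C_map_C_iff.mp (hQ hf) i j
      simpa [φ, hMalg] using this)
    (by rw [Ideal.mem_comap, map_innerGeneric]; exact h1)
    (by rw [Ideal.mem_comap, map_outerGeneric]; exact h2)
  let P := (Q.comap C).comap C
  have hmP : ∀ r ∈ IsLocalRing.maximalIdeal R, algebraMap R (reesAlgebra I) r ∈ P := by
    intro r hr
    have : C (C r) ∈ Q.comap φ := by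
      rw [hq]
      exact Ideal.mem_map_of_mem _ (Ideal.mem_map_of_mem _ hr)
    have h5 : C (C (algebraMap R (reesAlgebra I) r)) ∈ Q := by simpa [φ] using this
    exact h5
  by_cases h : ∀ i, C (C (reesMonomial I (c i))) ∈ Q
  · have hJP : ∀ x ∈ Ideal.span (Set.range fun i ↦ (c i : R)), ∀ hx : x ∈ I,
        reesMonomial I ⟨x, hx⟩ ∈ P := by
      intro x hxJ
      induction hxJ using Submodule.span_induction with
      | mem x hx =>
        intro _
        obtain ⟨i, rfl⟩ := hx
        exact h i
      | zero =>
        intro _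
        convert P.zero_mem
        exact Subtype.ext (by simp [reesMonomial])
      | add x y hx hy h1 h2 =>
        intro _
        have hx' := hJ.1 (hc.le hx)
        have hy' := hJ.1 (hc.le hy)
        have := P.add_mem (h1 hx') (h2 hy')
        rwa [← reesMonomial_add] at this
      | smul a x hx h1 =>
        intro _
        have := P.mul_mem_left (algebraMap R _ a) (h1 (hJ.1 (hc.le hx)))
        rwa [← reesMonomial_smul] at this
    have hIP := reesMonomial_mem_of_isReductionOf hJ fun x hx ↦ hJP x (hc.ge hx) x.2
    refine le_antisymm hQ ?_
    rw [Ideal.map_le_iff_le_comap, Ideal.map_le_iff_le_comap]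
    intro f hf
    refine mem_of_reesCoeffZero_mem hIP f (hmP _ ?_)
    rwa [hM] at hf
  · push Not at h
    obtain ⟨i, hi⟩ := h
    by_contra hne
    have h5 := (height_comap_add_three_le _ M Q (lt_of_le_of_ne hQ hne) h3 h4 hi).trans hMdim
    have h6 : P.height = 0 := by
      have : P.height + 3 ≤ 0 + 3 := by simpa using h5
      simpa using (ENat.add_le_add_iff_right (by decide)).mp this
    have : P.IsPrime := inferInstance
    rw [Ideal.height_eq_zero_iff] at h6
    exact Set.disjoint_left.mp (Ideal.disjoint_nonZeroDivisors_of_mem_minimalPrimes h6)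
      (hmP z hzm) (algebraMap_mem_nonZeroDivisors_reesAlgebra hz)
end

section
variable {R : Type u} [CommRing R] (I : Ideal R)

/-- The inclusion of the Rees algebra in the polynomial ring, extended to two more variables. -/
noncomputable def reesExtension : (reesAlgebra I)[X][X] →+* R[X][X][X] :=
  let f : reesAlgebra I →+* R[X][X][X] :=
    (mapRingHom ((C : R[X] →+* R[X][X]).comp C)).comp (reesAlgebra I).subtype
  let g : (reesAlgebra I)[X] →+* R[X][X][X] := eval₂RingHom f (C (C X) : R[X][X][X])
  eval₂RingHom g (C X : R[X][X][X])

variable {I}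

lemma reesExtension_C_C (f : reesAlgebra I) :
    reesExtension I (C (C f)) = (f : R[X]).map ((C : R[X] →+* R[X][X]).comp C) := by
  simp [reesExtension]

lemma reesExtension_C_X : reesExtension I (C X) = C (C X) := by
  simp [reesExtension]

lemma reesExtension_C_C_algebraMap (r : R) :
    reesExtension I (C (C (algebraMap R _ r))) = C (C (C r)) := by
  simp [reesExtension]

lemma reesExtension_C_C_reesMonomial (x : I) :
    reesExtension I (C (C (reesMonomial I x))) = C (C (C (x : R))) * X := by
  rw [reesExtension_C_C, reesMonomial, Polynomial.map_monomial, C_mul_X_eq_monomial]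
  rfl

lemma reesExtension_innerGeneric_algebraMap {k : ℕ} (c : Fin k → R) :
    reesExtension I (innerGeneric fun i ↦ algebraMap R _ (c i)) = C (innerGeneric c) := by
  simp only [innerGeneric, genericElt, map_sum, map_mul, map_pow, reesExtension_C_X,
    reesExtension_C_C_algebraMap]

lemma reesExtension_outerGeneric_algebraMap {k : ℕ} (c : Fin k → R) :
    reesExtension I (outerGeneric fun i ↦ algebraMap R _ (c i)) = C (outerGeneric c) := by
  simp only [outerGeneric, genericElt, map_sum, map_mul, reesExtension_C_C_algebraMap]
  simp [reesExtension]

lemma reesExtension_innerGeneric_reesMonomial {k : ℕ} (c : Fin k → I) :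
    reesExtension I (innerGeneric fun i ↦ reesMonomial I (c i)) =
      C (innerGeneric fun i ↦ (c i : R)) * X := by
  simp only [innerGeneric, genericElt, map_sum, map_mul, map_pow, reesExtension_C_X,
    reesExtension_C_C_reesMonomial,
    Finset.sum_mul]
  refine Finset.sum_congr rfl fun i _ ↦ ?_
  ring

lemma reesExtension_outerGeneric_reesMonomial {k : ℕ} (c : Fin k → I) :
    reesExtension I (outerGeneric fun i ↦ reesMonomial I (c i)) =
      C (outerGeneric fun i ↦ (c i : R)) * X := by
  simp only [outerGeneric, genericElt, map_sum, map_mul, reesExtension_C_C_reesMonomial,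
    Finset.sum_mul]
  refine Finset.sum_congr rfl fun i _ ↦ ?_
  simp [reesExtension]
  ring

lemma coeff_zero_reesExtension (f : (reesAlgebra I)[X][X]) :
    (reesExtension I f).coeff 0 = mapRingHom (mapRingHom (reesCoeffZero I)) f := by
  rw [← constantCoeff_apply, ← RingHom.comp_apply]
  congr 1
  refine Polynomial.ringHom_ext' (Polynomial.ringHom_ext' ?_ ?_) ?_
  · ext f : 1
    simp [reesExtension, reesCoeffZero]
  · simp [reesExtension]
  · simp [reesExtension]

lemma reesExtension_mem (f : (reesAlgebra I)[X][X]) :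
    reesExtension I f ∈ reesAlgebra (I.map ((C : R[X] →+* R[X][X]).comp C)) := by
  have hX (p : R[X][X]) :
      (C p : R[X][X][X]) ∈ reesAlgebra (I.map ((C : R[X] →+* R[X][X]).comp C)) :=
    Subalgebra.algebraMap_mem _ p
  induction f using Polynomial.induction_on' with
  | add p q hp hq => rw [map_add]; exact add_mem hp hq
  | monomial n p =>
    rw [← C_mul_X_pow_eq_monomial, map_mul, map_pow]
    refine mul_mem ?_ (pow_mem (by simpa [reesExtension] using hX X) n)
    induction p using Polynomial.induction_on' with
    | add p q hp hq => rw [C_add, map_add]; exact add_mem hp hq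
    | monomial n f =>
      rw [← C_mul_X_pow_eq_monomial, C_mul, C_pow, map_mul, map_pow]
      refine mul_mem ?_ (pow_mem (by simpa [reesExtension] using hX (C X)) n)
      rw [reesExtension_C_C]
      intro i
      rw [coeff_map, ← Ideal.map_pow]
      exact Ideal.mem_map_of_mem _ (f.2 i)

lemma exists_coeff_of_reesAlgebra_relation [IsLocalRing R] {u p q d e : (reesAlgebra I)[X][X]}
    (hu : u ∉ (((IsLocalRing.maximalIdeal R).comap (reesCoeffZero I)).map C).map C)
    {d₀ e₀ : R[X][X]} (hd : reesExtension I d = C d₀) (he : reesExtension I e = C e₀ * X) (x : I)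
    (h : p * d + q * e = u * C (C (reesMonomial I x))) :
    ∃ u₀ ∉ ((IsLocalRing.maximalIdeal R).map C).map C, ∃ y ∈ (I.map C).map C, ∃ z,
      u₀ * C (C (x : R)) = d₀ * y + e₀ * z := by
  refine ⟨(reesExtension I u).coeff 0, ?_, (reesExtension I p).coeff 1, ?_,
    (reesExtension I q).coeff 0, ?_⟩
  · contrapose! hu
    rw [coeff_zero_reesExtension, mem_map_C_map_C_iff] at hu
    rw [mem_map_C_map_C_iff]
    intro i j
    simpa using hu i j
  · have := reesExtension_mem p 1
    rwa [pow_one, ← Ideal.map_map] at this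
  · have h1 := congrArg (fun f ↦ (reesExtension I f).coeff 1) h
    simp only [map_add, map_mul, hd, he, reesExtension_C_C_reesMonomial, ← mul_assoc,
      coeff_add, coeff_mul_X, coeff_mul_C] at h1
    rw [← h1]
    ring
end

section
open scoped nonZeroDivisors

lemma Ideal.mem_ofList_pair {B : Type*} [CommRing B] {x y z : B} :
    z ∈ Ideal.ofList [x, y] ↔ ∃ p q, p * x + q * y = z := by
  rw [Ideal.ofList_cons, Ideal.ofList_singleton, ← Ideal.span_insert, Ideal.mem_span_pair]

lemma innerGeneric_mem_map {N : Type*} [CommRing N] {k : ℕ} {c : Fin k → N} {J : Ideal N}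
    (h : ∀ i, c i ∈ J) : innerGeneric c ∈ (J.map C).map C :=
  innerGeneric_mem fun i ↦ Ideal.mem_map_of_mem _ (Ideal.mem_map_of_mem _ (h i))

lemma outerGeneric_mem_map {N : Type*} [CommRing N] {k : ℕ} {c : Fin k → N} {J : Ideal N}
    (h : ∀ i, c i ∈ J) : outerGeneric c ∈ (J.map C).map C :=
  outerGeneric_mem fun i ↦ Ideal.mem_map_of_mem _ (Ideal.mem_map_of_mem _ (h i))

lemma mem_of_mul_C_C_mem {R : Type*} [CommRing R] [IsLocalRing R] {L : Ideal R} {s : R[X][X]}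
    (hs : s ∉ ((IsLocalRing.maximalIdeal R).map C).map C) {x : R}
    (h : s * C (C x) ∈ (L.map C).map C) : x ∈ L := by
  rw [mem_map_C_map_C_iff] at hs h
  push Not at hs
  obtain ⟨i, j, hij⟩ := hs
  have h1 := h i j
  rw [coeff_mul_C, coeff_mul_C] at h1
  rw [IsLocalRing.notMem_maximalIdeal] at hij
  exact (Ideal.unit_mul_mem_iff_mem L hij).mp h1

lemma DepthGE.localization_map_C_map_C {N : Type u} [CommRing N] (p : Ideal N) [p.IsPrime] {n : ℕ}
    (h : DepthGE (Localization.AtPrime p) n (Localization.AtPrime p)) :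
    DepthGE (Localization.AtPrime ((p.map C).map (C : N[X] →+* N[X][X]))) n
      (Localization.AtPrime ((p.map C).map (C : N[X] →+* N[X][X]))) :=
  have := Ideal.isPrime_map_C_of_isPrime (P := p)
  (h.localization_map_C p).localization_map_C _

/-- If the `2 × 2` matrix with rows `(a, a')` and `(b, b')` is singular and its entries generate,
up to radical, a prime at which the depth is at least three, then `a, b', b - a'` is a regular
sequence there. -/
lemma exists_mul_eq_of_depthGE_three {B : Type u} [CommRing B] [IsNoetherianRing B] {P : Ideal B}
    [P.IsPrime] (h : DepthGE (Localization.AtPrime P) 3 (Localization.AtPrime P))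
    {a b a' b' : B} (ha : a ∈ P) (hb : b ∈ P) (ha' : a' ∈ P) (hb' : b' ∈ P)
    (hrel : b * a' = a * b')
    (hrad : ∀ Q : Ideal B, Q.IsPrime → Q ≤ P → a ∈ Q → b ∈ Q → a' ∈ Q → b' ∈ Q → Q = P)
    {w s t : B} (hs : b * w = b' * s) (ht : a' * w = a * t) :
    ∃ u ∉ P, ∃ p q, p * a + q * b' = u * w := by
  have hsq : ∀ Q : Ideal B, Q.IsPrime → a ∈ Q → b - a' ∈ Q → b ∈ Q ∧ a' ∈ Q := by
    intro Q _ hQa hQ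
    have h1 : b * b ∈ Q := by
      have : b * b = b * (b - a') + a * b' := by linear_combination hrel
      rw [this]
      exact add_mem (Ideal.mul_mem_left _ _ hQ) (Ideal.mul_mem_right _ _ hQa)
    have h2 : b ∈ Q := (Ideal.IsPrime.mem_or_mem ‹_› h1).elim id id
    exact ⟨h2, by simpa using sub_mem h2 hQ⟩
  obtain ⟨u, hu, huw⟩ := exists_mul_mem_ofList_of_depthGE P [a, b'] (b - a') h
    (by simp [ha, hb']) (sub_mem hb ha')
    (fun Q hQ hQP h1 h2 ↦
      have hQa := h1 a (by simp)
      have h3 := hsq Q hQ hQa h2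
      hrad Q hQ hQP hQa h3.1 h3.2 (h1 b' (by simp)))
    (z := w) (Ideal.mem_ofList_pair.mpr ⟨-t, s, by linear_combination ht - hs⟩)
  exact ⟨u, hu, Ideal.mem_ofList_pair.mp huw⟩

variable {R : Type u} [CommRing R] [IsLocalRing R] [IsNoetherianRing R] {I J : Ideal R}

lemma mem_mul_of_generic_relations
    (hdepth : DepthGE (Localization.AtPrime (((IsLocalRing.maximalIdeal R).map C).map
      (C : R[X] →+* R[X][X]))) 2 (Localization.AtPrime (((IsLocalRing.maximalIdeal R).map C).map
      (C : R[X] →+* R[X][X]))))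
    (hdim : (IsLocalRing.maximalIdeal R).height ≤ 2)
    (hJI : J ≤ I) (hJm : J.radical = IsLocalRing.maximalIdeal R)
    {k : ℕ} {c : Fin k → R} (hc : Ideal.span (Set.range c) = J) {x : R}
    (h₁ : ∃ u ∉ ((IsLocalRing.maximalIdeal R).map C).map C, ∃ y ∈ (I.map C).map C, ∃ z,
      u * C (C x) = innerGeneric c * y + outerGeneric c * z)
    (h₂ : ∃ u ∉ ((IsLocalRing.maximalIdeal R).map C).map C, ∃ y ∈ (I.map C).map C, ∃ z,
      u * C (C x) = outerGeneric c * y + innerGeneric c * z) :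
    x ∈ J * I := by
  have hcJ : ∀ i, c i ∈ J := fun i ↦ hc ▸ Ideal.subset_span ⟨i, rfl⟩
  have hcm : ∀ i, c i ∈ IsLocalRing.maximalIdeal R := fun i ↦ hJm ▸ Ideal.le_radical (hcJ i)
  have haJ := innerGeneric_mem_map hcJ
  have hbJ := outerGeneric_mem_map hcJ
  obtain ⟨u, hu, y, hy, z, h⟩ := h₁
  obtain ⟨u', hu', z', hz', y', h'⟩ := h₂
  obtain ⟨w, hw, hwa⟩ := exists_mul_mem_ofList_of_depthGE
    (((IsLocalRing.maximalIdeal R).map C).map C) [innerGeneric c] (outerGeneric c) hdepth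
    (by simpa using innerGeneric_mem_map hcm) (outerGeneric_mem_map hcm)
    (fun Q hQ hQm ha hb ↦ eq_map_C_map_C_of_generic_mem c hdim
      (by rw [hc, hJm]) hQm (ha _ (by simp)) hb)
    (z := u' * z - u * z') (by
      rw [Ideal.ofList_singleton, Ideal.mem_span_singleton']
      exact ⟨u * y' - u' * y, by linear_combination u' * h - u * h'⟩)
  rw [Ideal.ofList_singleton, Ideal.mem_span_singleton'] at hwa
  obtain ⟨v, hv⟩ := hwa
  have hs : w * (u * u') ∉ ((IsLocalRing.maximalIdeal R).map C).map
      (C : R[X] →+* R[X][X]) :=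
    Ideal.IsPrime.mul_notMem inferInstance hw (Ideal.IsPrime.mul_notMem inferInstance hu hu')
  refine mem_of_mul_C_C_mem hs ?_
  rw [Ideal.map_mul, Ideal.map_mul]
  have e : w * (u * u') * C (C x) =
      innerGeneric c * (w * u' * y) + outerGeneric c * (w * u * z' + v * innerGeneric c) := by
    linear_combination w * u' * h - outerGeneric c * hv
  rw [e]
  have haI : innerGeneric c ∈ (I.map C).map (C : R[X] →+* R[X][X]) :=
    Ideal.map_mono (Ideal.map_mono hJI) haJ
  exact add_mem (Ideal.mul_mem_mul haJ (Ideal.mul_mem_left _ _ hy))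
    (Ideal.mul_mem_mul hbJ (add_mem (Ideal.mul_mem_left _ _ hz') (Ideal.mul_mem_left _ _ haI)))

lemma sq_le_mul_of_depthGE_reesAlgebra
    (hI : I.radical = IsLocalRing.maximalIdeal R) (hJ : J.IsReductionOf I)
    (hdim : (IsLocalRing.maximalIdeal R).height ≤ 2) {z : R} (hz : z ∈ R⁰)
    (hzm : z ∈ IsLocalRing.maximalIdeal R)
    (hdepth : DepthGE (Localization.AtPrime (((IsLocalRing.maximalIdeal R).map C).map
      (C : R[X] →+* R[X][X]))) 2 (Localization.AtPrime (((IsLocalRing.maximalIdeal R).map C).map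
      (C : R[X] →+* R[X][X]))))
    {M : Ideal (reesAlgebra I)} [M.IsPrime]
    (hM : M = (IsLocalRing.maximalIdeal R).comap (reesCoeffZero I)) (hMdim : M.height ≤ 3)
    (hMdepth : DepthGE (Localization.AtPrime M) 3 (Localization.AtPrime M)) :
    I ^ 2 ≤ J * I := by
  have hJm : J.radical = IsLocalRing.maximalIdeal R := by
    rw [← hI]
    exact le_antisymm (Ideal.radical_mono hJ.1) (Ideal.radical_le_radical_iff.mpr hJ.le_radical)
  obtain ⟨k, c₀, hc₀⟩ := Submodule.fg_iff_exists_fin_generating_family.mp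
    (IsNoetherian.noetherian J)
  let c : Fin k → I := fun i ↦ ⟨c₀ i, hJ.1 (hc₀ ▸ Submodule.subset_span ⟨i, rfl⟩)⟩
  have hc : Ideal.span (Set.range fun i ↦ (c i : R)) = J := hc₀
  have hcm : ∀ i, algebraMap R (reesAlgebra I) (c i) ∈ M := fun i ↦ by
    rw [hM, Ideal.mem_comap, reesCoeffZero_algebraMap, ← hJm, ← hc]
    exact Ideal.le_radical (Ideal.subset_span ⟨i, rfl⟩)
  have hcM : ∀ i, reesMonomial I (c i) ∈ M := fun i ↦ by
    rw [hM, Ideal.mem_comap, reesCoeffZero_reesMonomial]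
    exact zero_mem _
  have haM := innerGeneric_mem_map hcm
  have hbM := outerGeneric_mem_map hcm
  have haM' := innerGeneric_mem_map hcM
  have hbM' := outerGeneric_mem_map hcM
  have hrel := outerGeneric_mul_innerGeneric
    (d := fun i ↦ algebraMap R (reesAlgebra I) (c i)) (e := fun i ↦ reesMonomial I (c i))
    fun i j ↦ algebraMap_mul_reesMonomial (c i) (c j)
  have heq := fun (Q : Ideal (reesAlgebra I)[X][X]) (hQ : Q.IsPrime) hQM ↦
    eq_map_C_map_C_of_generic_mem_reesAlgebra (Q := Q) hI hJ hdim hz hzm hc hM hMdim hQM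
  have hra := reesExtension_innerGeneric_algebraMap (I := I) fun i ↦ (c i : R)
  have hrb := reesExtension_outerGeneric_algebraMap (I := I) fun i ↦ (c i : R)
  have hra' := reesExtension_innerGeneric_reesMonomial c
  have hrb' := reesExtension_outerGeneric_reesMonomial c
  intro x hx
  let x₁ : I := ⟨x, Ideal.pow_le_self two_ne_zero hx⟩
  let x₂ : reesAlgebra I := ⟨monomial 2 x, reesAlgebra.monomial_mem.mpr hx⟩
  have hx₂ : ∀ i, reesMonomial I (c i) * reesMonomial I x₁ =
      algebraMap R (reesAlgebra I) (c i) * x₂ := fun i ↦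
    Subtype.ext (by simp [reesMonomial, x₁, x₂, monomial_mul_monomial])
  have hx₁ : ∀ i, algebraMap R (reesAlgebra I) (c i) * reesMonomial I x₁ =
      reesMonomial I (c i) * algebraMap R (reesAlgebra I) x := fun i ↦ by
    rw [algebraMap_mul_reesMonomial, mul_comm]
  have e1 := innerGeneric_mul_C hx₂
  have e2 := outerGeneric_mul_C hx₂
  have e3 := innerGeneric_mul_C hx₁
  have e4 := outerGeneric_mul_C hx₁
  have hP := hMdepth.localization_map_C_map_C M
  obtain ⟨u, hu, p, q, hpq⟩ := exists_mul_eq_of_depthGE_three hP haM hbM haM' hbM' hrel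
    (fun Q hQ hQM h1 h2 h3 h4 ↦ heq Q hQ hQM h1 h2 h3 h4) e4 e1
  obtain ⟨v, hv, p', q', hpq'⟩ := exists_mul_eq_of_depthGE_three hP hbM haM hbM' haM' hrel.symm
    (fun Q hQ hQM h1 h2 h3 h4 ↦ heq Q hQ hQM h2 h1 h4 h3) e3 e2
  rw [hM] at hu hv
  exact mem_mul_of_generic_relations hdepth hdim hJ.1 hJm hc
    (exists_coeff_of_reesAlgebra_relation hu hra hrb' x₁ hpq)
    (exists_coeff_of_reesAlgebra_relation hv hrb hra' x₁ hpq')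
end

/-- Let `(R,m)` be a Cohen–Macaulay Noetherian local ring of dimension `2`
and let `I` be an `m`-primary ideal admitting a minimal reduction `J`. If the Rees algebra
`R[It]` is Cohen–Macaulay, then `I² = J·I`, i.e. the reduction number of `I` with respect
to `J` is at most `1`. -/
theorem reduction_number_le_one_of_rees_isCohenMacaulay
    {R : Type*} [CommRing R] [IsLocalRing R] [IsNoetherianRing R]
    (hCM : IsCohenMacaulayLocalRing R) (hdim : ringKrullDim R = 2)
    (I J : Ideal R) (hI : I.radical = IsLocalRing.maximalIdeal R)
    (hJ : J.IsMinimalReductionOf I)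
    (hrees : IsCohenMacaulayRing (reesAlgebra I)) :
    I ^ 2 = J * I := by
  obtain ⟨rs, hmem, hrs, hlen⟩ := hCM
  have hlen' : rs.length = 2 := by
    rw [hdim] at hlen
    exact_mod_cast hlen
  have hdepth : DepthGE R 2 R := ⟨rs, hlen', hmem, hrs⟩
  obtain ⟨z, hzI, hz⟩ := exists_mem_nonZeroDivisors_of_isRegular hI hdepth
  have hzm : z ∈ IsLocalRing.maximalIdeal R := hI ▸ Ideal.le_radical hzI
  have hht : (IsLocalRing.maximalIdeal R).height ≤ 2 := by
    have := IsLocalRing.maximalIdeal_height_eq_ringKrullDim (R := R)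
    rw [hdim] at this
    exact WithBot.coe_le_coe.mp
      (this.le : ((IsLocalRing.maximalIdeal R).height : WithBot ℕ∞) ≤ ((2 : ℕ∞) : WithBot ℕ∞))
  obtain ⟨M, hM⟩ : ∃ M, M = (IsLocalRing.maximalIdeal R).comap (reesCoeffZero I) := ⟨_, rfl⟩
  have hMmax : M.IsMaximal := by
    rw [hM]
    exact Ideal.comap_isMaximal_of_surjective _ reesCoeffZero_surjective
  have hMprime := hMmax.isPrime
  have hMdim : M.height ≤ 3 := by
    have h1 := (Ideal.height_le_ringKrullDim_of_isPrime (I := M)).trans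
      (ringKrullDim_reesAlgebra_le (n := 2) hdim.le hz hzI)
    exact WithBot.coe_le_coe.mp
      (h1 : (M.height : WithBot ℕ∞) ≤ ((3 : ℕ∞) : WithBot ℕ∞))
  obtain ⟨ts, htmem, hts, htlen⟩ := hrees M hMmax
  have hMdepth : DepthGE (Localization.AtPrime M) 3 (Localization.AtPrime M) := by
    refine DepthGE.of_isRegular_of_le htmem hts ?_
    have h1 := ringKrullDim_succ_le_localization_reesAlgebra (c := ⟨z, hzI⟩) hz M hM
    rw [← htlen, hdim] at h1
    have h2 : ((2 + 1 : ℕ) : WithBot ℕ∞) ≤ (ts.length : ℕ) := by exact_mod_cast h1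
    exact_mod_cast h2
  have hRm : DepthGE (Localization.AtPrime (IsLocalRing.maximalIdeal R)) 2
      (Localization.AtPrime (IsLocalRing.maximalIdeal R)) :=
    ⟨rs.map (algebraMap R _), by simpa using hlen', fun x hx ↦ by
      obtain ⟨y, hy, rfl⟩ := List.mem_map.mp hx
      exact (IsLocalization.AtPrime.to_map_mem_maximal_iff _ _ _).mpr (hmem y hy),
      hrs.toIsWeaklyRegular.isRegular_of_isLocalization_of_mem _ _ hmem⟩
  refine le_antisymm ?_ ?_
  · exact sq_le_mul_of_depthGE_reesAlgebra hI hJ.1 hht hz hzm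
      (hRm.localization_map_C_map_C _) hM hMdim hMdepth
  · rw [sq]
    exact Ideal.mul_mono_left hJ.1.1
end

section
/- Let R be a Noetherian ring, B = R[x_1,…,x_r] a polynomial ring over R, and let a_1,…,a_n ∈ R form a regular sequence in B. Let f_1,…,f_n ∈ B satisfy f_i ∈ (a_1,…,a_n)B for all i, and suppose [f_1 … f_n] = [a_1 … a_n]·A = [a_1 … a_n]·A' for two n×n matrices A, A' with entries in B. Then det(A) ≡ det(A') modulo the ideal (f_1,…,f_n)B; that is, the Sylvester form det(f)_{(a)} = det(A) is well-defined modulo (f_1,…,f_n). -/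
open Matrix in
/-- The `j`-th row of the adjugate is given by replacing the `j`-th column by unit vectors. -/
theorem adjugate_apply_eq_det_updateCol {B ι : Type*} [CommRing B] [Fintype ι] [DecidableEq ι]
    (A : Matrix ι ι B) (j q : ι) :
    A.adjugate j q = (A.updateCol j (Pi.single q 1)).det := by
  rw [← cramer_apply, cramer_eq_adjugate_mulVec, mulVec_single_one]
  rfl

open Matrix in
/-- If all entries of `a ᵥ* A` lie in `I`, then modulo `I` every row of the adjugate of `A` is
proportional to `a`. -/
theorem mul_adjugate_sub_mul_adjugate_mem {B ι : Type*} [CommRing B] [Fintype ι] [DecidableEq ι]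
    {I : Ideal B} {a : ι → B} {A : Matrix ι ι B} (h : ∀ k, (a ᵥ* A) k ∈ I) (j p q : ι) :
    a p * A.adjugate j q - a q * A.adjugate j p ∈ I := by
  set M := A.updateCol j (Pi.single q 1) with hM
  have hrow : a p * M.det = ∑ k, (a ᵥ* M) k * M.adjugate k p := by
    have key : (a ᵥ* M) ᵥ* M.adjugate = M.det • a := by
      rw [vecMul_vecMul, mul_adjugate, vecMul_smul, vecMul_one]
    have := congrFun key p
    rw [Pi.smul_apply, smul_eq_mul] at this
    rw [mul_comm, ← this]
    rfl
  have hadj : M.adjugate j p = A.adjugate j p := by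
    rw [adjugate_apply_eq_det_updateCol, adjugate_apply_eq_det_updateCol A, hM,
      updateCol_idem]
  have hj : (a ᵥ* M) j = a q := by
    simp [hM, vecMul, dotProduct, Pi.single_apply]
  have hk : ∀ k, k ≠ j → (a ᵥ* M) k = (a ᵥ* A) k := by
    intro k hk
    simp [hM, vecMul, dotProduct, hk]
  rw [adjugate_apply_eq_det_updateCol A j q, ← hM, hrow,
    ← Finset.add_sum_erase _ _ (Finset.mem_univ j), hj, hadj, add_sub_cancel_left]
  refine I.sum_mem fun k hmem => I.mul_mem_right _ ?_
  rw [hk k (Finset.ne_of_mem_erase hmem)]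
  exact h k

open RingTheory.Sequence in
/-- A vector proportional to a weakly regular sequence `a` modulo `I` pairs every syzygy of `a`
into `I`: the syzygies of `a` are generated by the Koszul ones. -/
theorem sum_mul_mem_of_isWeaklyRegular {B : Type*} [CommRing B] {I : Ideal B} {n : ℕ}
    {a c φ : Fin n → B} (ha : IsWeaklyRegular B (List.ofFn a))
    (hφ : ∀ p q, a p * φ q - a q * φ p ∈ I) (hc : ∑ i, a i * c i = 0) :
    ∑ i, c i * φ i ∈ I := by
  induction n with
  | zero => simp
  | succ n ih =>
    rw [List.ofFn_succ', List.concat_eq_append, isWeaklyRegular_append_iff,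
      isWeaklyRegular_singleton_iff] at ha
    obtain ⟨hinit, hlast⟩ := ha
    have hspan : Ideal.ofList (List.ofFn fun i : Fin n => a i.castSucc) • (⊤ : Submodule B B) =
        Ideal.span (Set.range fun i : Fin n => a i.castSucc) := by
      rw [smul_eq_mul, Ideal.mul_top, Ideal.ofList]
      congr 1
      ext x
      simp [List.mem_ofFn]
    rw [hspan] at hlast
    rw [Fin.sum_univ_castSucc] at hc
    have hmem : c (Fin.last n) ∈ Ideal.span (Set.range fun i : Fin n => a i.castSucc) := by
      refine (isSMulRegular_quotient_iff_mem_of_smul_mem _ _).1 hlast _ ?_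
      rw [smul_eq_mul, eq_neg_of_add_eq_zero_right hc]
      exact neg_mem (Ideal.sum_mem _ fun i _ =>
        Ideal.mul_mem_right _ _ (Ideal.subset_span ⟨i, rfl⟩))
    obtain ⟨b, hb⟩ := Ideal.mem_span_range_iff_exists_fun.1 hmem
    have hsyz : ∑ i : Fin n, a i.castSucc * (c i.castSucc + b i * a (Fin.last n)) = 0 := by
      rw [← hc, ← hb, Finset.mul_sum, ← Finset.sum_add_distrib]
      exact Finset.sum_congr rfl fun i _ => by ring
    have hrec := ih (φ := fun i => φ i.castSucc) hinit (fun p q => hφ _ _) hsyz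
    have hkoszul : ∑ i : Fin n,
        b i * (a i.castSucc * φ (Fin.last n) - a (Fin.last n) * φ i.castSucc) ∈ I :=
      I.sum_mem fun i _ => I.mul_mem_left _ (hφ _ _)
    convert I.add_mem hrec hkoszul using 1
    rw [Fin.sum_univ_castSucc, ← hb, Finset.sum_mul, ← Finset.sum_add_distrib,
      ← Finset.sum_add_distrib]
    exact Finset.sum_congr rfl fun i _ => by ring

open Matrix RingTheory.Sequence in
/-- Two matrices `A`, `A'` with `a ᵥ* A = a ᵥ* A'` for a weakly regular sequence `a` have the same
determinant modulo any ideal containing the entries of `a ᵥ* A`. -/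
theorem det_sub_det_mem_of_isWeaklyRegular {B : Type*} [CommRing B] {I : Ideal B} {n : ℕ}
    {a : Fin n → B} (ha : IsWeaklyRegular B (List.ofFn a)) {A A' : Matrix (Fin n) (Fin n) B}
    (hAA' : a ᵥ* A = a ᵥ* A') (hA : ∀ k, (a ᵥ* A) k ∈ I) :
    A.det - A'.det ∈ I := by
  let M (s : Finset (Fin n)) : Matrix (Fin n) (Fin n) B :=
    Matrix.of fun i j => if j ∈ s then A' i j else A i j
  have hM : ∀ s, a ᵥ* M s = a ᵥ* A := by
    intro s
    ext k
    by_cases hk : k ∈ s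
    · rw [hAA']
      simp [M, vecMul, dotProduct, hk]
    · simp [M, vecMul, dotProduct, hk]
  suffices h : ∀ s, A.det - (M s).det ∈ I by
    have huniv : M Finset.univ = A' := by
      ext i k
      simp [M]
    exact huniv ▸ h Finset.univ
  intro s
  induction s using Finset.induction_on with
  | empty =>
    have hempty : M ∅ = A := by
      ext i k
      simp [M]
    simp [hempty]
  | insert j s hj ih =>
    have hinsert : M (insert j s) = (M s).updateCol j (A'.col j) := by
      ext i k
      by_cases hk : k = j
      · subst hk
        simp [M]
      · simp [M, hk]
    have hself : M s = (M s).updateCol j (A.col j) := by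
      ext i k
      by_cases hk : k = j
      · subst hk
        simp [M, hj]
      · simp [hk]
    have hdet : (M s).det - (M (insert j s)).det =
        ∑ i, (A i j - A' i j) * (M s).adjugate j i := by
      have hcol (v : Fin n → B) :
          ((M s).updateCol j v).det = ∑ i, v i * (M s).adjugate j i := by
        rw [← cramer_apply, cramer_eq_adjugate_mulVec]
        simp only [mulVec, dotProduct, mul_comm]
      rw [hinsert, hcol, congrArg Matrix.det hself, hcol, ← Finset.sum_sub_distrib]
      exact Finset.sum_congr rfl fun i _ => (sub_mul _ _ _).symm
    have hstep : (M s).det - (M (insert j s)).det ∈ I := by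
      rw [hdet]
      refine sum_mul_mem_of_isWeaklyRegular (c := fun i => A i j - A' i j) ha
        (mul_adjugate_sub_mul_adjugate_mem (fun k => hM s ▸ hA k) j) ?_
      simp only [mul_sub, Finset.sum_sub_distrib]
      exact sub_eq_zero.2 (congrFun hAA' j)
    simpa using I.add_mem ih hstep


/-- Let `R` be a Noetherian ring, `B = R[x_1,…,x_r]` a polynomial ring over
`R`, and let `a_1,…,a_n ∈ R` form a regular sequence in `B`. Let `f_1,…,f_n ∈ B` satisfy
`f_i ∈ (a_1,…,a_n)B` for all `i`, and suppose `[f_1 … f_n] = [a_1 … a_n]·A = [a_1 … a_n]·A'`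
for two `n×n` matrices `A`, `A'` with entries in `B`. Then `det A ≡ det A'` modulo the ideal
`(f_1,…,f_n)B`; that is, the Sylvester form `det(f)_(a) = det A` is well defined modulo
`(f_1,…,f_n)`. -/
theorem sylvester_form_well_defined
    {R : Type*} [CommRing R] [IsNoetherianRing R] (r n : ℕ)
    (a : Fin n → R) (f : Fin n → MvPolynomial (Fin r) R)
    (hreg : RingTheory.Sequence.IsRegular (MvPolynomial (Fin r) R)
      ((List.ofFn a).map (algebraMap R (MvPolynomial (Fin r) R))))
    (hf : ∀ i, f i ∈ Ideal.span
      (algebraMap R (MvPolynomial (Fin r) R) '' Set.range a))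
    (A A' : Matrix (Fin n) (Fin n) (MvPolynomial (Fin r) R))
    (hA : ∀ j, f j = ∑ i, algebraMap R (MvPolynomial (Fin r) R) (a i) * A i j)
    (hA' : ∀ j, f j = ∑ i, algebraMap R (MvPolynomial (Fin r) R) (a i) * A' i j) :
    A.det - A'.det ∈ Ideal.span (Set.range f) := by
  have ha := hreg.toIsWeaklyRegular
  rw [List.map_ofFn] at ha
  refine det_sub_det_mem_of_isWeaklyRegular ha
    (funext fun j => (hA j).symm.trans (hA' j)) fun k => ?_
  exact Ideal.subset_span ⟨k, hA k⟩
end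

section
/- Let k be an infinite field, R = k[x_1,…,x_n], m = (x_1,…,x_n), and let f_1,…,f_{n+1} be forms of degree d generating an m-primary ideal I. Let F = k[f_1,…,f_{n+1}] ⊆ F' = k[m^d] (the d-th Veronese subring of R), graded so that elements of degree d in R have degree 1. Then the field extension degree [Frac(F') : Frac(F)] equals 1 (equivalently, the rational map Ψ: P^{n−1} ⇢ P^n defined by f_1,…,f_{n+1} is birational onto its image) if and only if the multiplicity deg(F) of the standard graded k-algebra F equals d^{n−1}. -/
open MvPolynomial

/-- A sequence that agrees with a rational polynomial from some index on. -/
def EventuallyPolynomial (g : ℕ → ℚ) : Prop :=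
  ∃ P : Polynomial ℚ, ∃ N : ℕ, ∀ m ≥ N, g m = P.eval (m : ℚ)

theorem exists_polynomial_sum_range (P : Polynomial ℚ) :
    ∃ Q : Polynomial ℚ, ∀ n : ℕ, ∑ i ∈ Finset.range n, P.eval (i : ℚ) = Q.eval (n : ℚ) := by
  induction P using Polynomial.induction_on' with
  | add p q hp hq =>
    obtain ⟨P, hP⟩ := hp
    obtain ⟨Q, hQ⟩ := hq
    exact ⟨P + Q, fun n ↦ by simp [Finset.sum_add_distrib, hP, hQ]⟩
  | monomial e a =>
    refine ⟨Polynomial.C (a / (e + 1)) *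
      (Polynomial.bernoulli e.succ - Polynomial.C (_root_.bernoulli e.succ)), fun n ↦ ?_⟩
    have he : (e + 1 : ℚ) ≠ 0 := by positivity
    simp only [Polynomial.eval_mul, Polynomial.eval_C, Polynomial.eval_sub,
      ← Polynomial.sum_range_pow_eq_bernoulli_sub, Polynomial.eval_monomial, ← Finset.mul_sum]
    field_simp

namespace EventuallyPolynomial

theorem add {g h : ℕ → ℚ} (hg : EventuallyPolynomial g) (hh : EventuallyPolynomial h) :
    EventuallyPolynomial (fun m ↦ g m + h m) := by
  obtain ⟨P, N, hP⟩ := hg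
  obtain ⟨Q, M, hQ⟩ := hh
  exact ⟨P + Q, max N M, fun m hm ↦ by
    simp [hP m (le_trans (le_max_left _ _) hm), hQ m (le_trans (le_max_right _ _) hm)]⟩

theorem of_succ {g : ℕ → ℚ} (hg : EventuallyPolynomial (fun m ↦ g (m + 1))) :
    EventuallyPolynomial g := by
  obtain ⟨P, N, hP⟩ := hg
  refine ⟨P.comp (Polynomial.X - 1), N + 1, fun m hm ↦ ?_⟩
  obtain ⟨m, rfl⟩ : ∃ l, m = l + 1 := ⟨m - 1, by omega⟩
  simpa using hP m (by omega)

theorem succ {g : ℕ → ℚ} (hg : EventuallyPolynomial g) :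
    EventuallyPolynomial (fun m ↦ g (m + 1)) := by
  obtain ⟨P, N, hP⟩ := hg
  exact ⟨P.comp (Polynomial.X + 1), N, fun m hm ↦ by simpa using hP (m + 1) (by omega)⟩

theorem of_sub_succ {g h : ℕ → ℚ} (hh : EventuallyPolynomial h)
    (hgh : ∀ m, g (m + 1) = h m + g m) : EventuallyPolynomial g := by
  obtain ⟨P, N, hP⟩ := hh
  obtain ⟨Q, hQ⟩ := exists_polynomial_sum_range P
  refine ⟨Q + Polynomial.C (g N - Q.eval (N : ℚ)), N, fun m hm ↦ ?_⟩
  induction m, hm using Nat.le_induction with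
  | base => simp
  | succ m hm ih =>
    have h1 := hQ (m + 1)
    rw [Finset.sum_range_succ, hQ m] at h1
    rw [hgh, ih, hP m hm, Polynomial.eval_add, Polynomial.eval_add, ← h1]
    simp only [Polynomial.eval_C]
    ring

end EventuallyPolynomial

theorem Polynomial.coeff_nonneg_of_eventually_eval_nonneg {A : Polynomial ℚ} {D N : ℕ}
    (hD : A.natDegree ≤ D) (hA : ∀ m ≥ N, 0 ≤ A.eval (m : ℚ)) : 0 ≤ A.coeff D := by
  by_contra! hneg
  have hdeg : A.natDegree = D := le_antisymm hD (Polynomial.le_natDegree_of_ne_zero hneg.ne)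
  have hlead : A.leadingCoeff < 0 := by rwa [Polynomial.leadingCoeff, hdeg]
  rcases Nat.eq_zero_or_pos D with h0 | h0
  · have h1 := hA N le_rfl
    rw [Polynomial.eq_C_of_natDegree_eq_zero (hdeg.trans h0), Polynomial.eval_C, ← h0] at h1
    linarith
  · have hlim := (A.tendsto_atBot_of_leadingCoeff_nonpos
      (Polynomial.natDegree_pos_iff_degree_pos.mp (hdeg ▸ h0)) hlead.le).comp
      (tendsto_natCast_atTop_atTop (R := ℚ))
    obtain ⟨m, hm, hmN⟩ := ((hlim.eventually_lt_atBot 0).and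
      (Filter.eventually_ge_atTop N)).exists
    exact absurd (hA m hmN) (not_le.mpr hm)

theorem Polynomial.coeff_comp_X_add_C_of_natDegree_le {P : Polynomial ℚ} {D : ℕ} (a : ℚ)
    (hD : P.natDegree ≤ D) : (P.comp (Polynomial.X + Polynomial.C a)).coeff D = P.coeff D := by
  have hdeg : (P.comp (Polynomial.X + Polynomial.C a)).natDegree = P.natDegree := by
    rw [Polynomial.natDegree_comp, Polynomial.natDegree_X_add_C, mul_one]
  rcases hD.eq_or_lt with rfl | hlt
  · have := Polynomial.leadingCoeff_comp (p := P) (q := Polynomial.X + Polynomial.C a) (by simp)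
    rw [Polynomial.leadingCoeff, hdeg] at this
    simpa using this
  · rw [Polynomial.coeff_eq_zero_of_natDegree_lt hlt,
      Polynomial.coeff_eq_zero_of_natDegree_lt (hdeg ▸ hlt)]

theorem Polynomial.coeff_eq_of_eventually_squeeze {P Q : Polynomial ℚ} {D N : ℕ} (e : ℕ)
    (hP : P.natDegree ≤ D) (hQ : Q.natDegree ≤ D)
    (hPQ : ∀ m ≥ N, P.eval (m : ℚ) ≤ Q.eval (m : ℚ))
    (hQP : ∀ m ≥ N, Q.eval (m : ℚ) ≤ P.eval ((m + e : ℕ) : ℚ)) :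
    P.coeff D = Q.coeff D := by
  have h1 : 0 ≤ (Q - P).coeff D :=
    Polynomial.coeff_nonneg_of_eventually_eval_nonneg (N := N)
      ((Polynomial.natDegree_sub_le _ _).trans (max_le hQ hP))
      (fun m hm ↦ by simpa using hPQ m hm)
  have h2 : 0 ≤ (P.comp (Polynomial.X + Polynomial.C (e : ℚ)) - Q).coeff D :=
    Polynomial.coeff_nonneg_of_eventually_eval_nonneg (N := N)
      ((Polynomial.natDegree_sub_le _ _).trans (max_le (by
        rwa [Polynomial.natDegree_comp, Polynomial.natDegree_X_add_C, mul_one]) hQ))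
      (fun m hm ↦ by simpa using hQP m hm)
  rw [Polynomial.coeff_sub] at h1 h2
  rw [Polynomial.coeff_comp_X_add_C_of_natDegree_le _ hP] at h2
  linarith

/-- Two polynomials squeezing each other up to a shift have the same degree and the same
leading coefficient. -/
theorem Polynomial.degree_and_leadingCoeff_eq_of_eventually_squeeze {P Q : Polynomial ℚ} {N : ℕ}
    (e : ℕ) (hQ0 : Q ≠ 0)
    (hPQ : ∀ m ≥ N, P.eval (m : ℚ) ≤ Q.eval (m : ℚ))
    (hQP : ∀ m ≥ N, Q.eval (m : ℚ) ≤ P.eval ((m + e : ℕ) : ℚ)) :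
    P.degree = Q.degree ∧ P.leadingCoeff = Q.leadingCoeff := by
  have hcoeff {D : ℕ} (hP : P.natDegree ≤ D) (hQ : Q.natDegree ≤ D) : P.coeff D = Q.coeff D :=
    Polynomial.coeff_eq_of_eventually_squeeze e hP hQ hPQ hQP
  have hdeg : P.natDegree = Q.natDegree := by
    rcases le_total P.natDegree Q.natDegree with h | h
    · refine le_antisymm h (Polynomial.le_natDegree_of_ne_zero ?_)
      rw [hcoeff h le_rfl]
      simpa using hQ0
    · by_contra hne
      have hlt : Q.natDegree < P.natDegree := lt_of_le_of_ne h (Ne.symm hne)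
      have h0 := hcoeff le_rfl h
      rw [Polynomial.coeff_eq_zero_of_natDegree_lt hlt, Polynomial.coeff_natDegree,
        Polynomial.leadingCoeff_eq_zero] at h0
      simp [h0] at hlt
  have hlead : P.leadingCoeff = Q.leadingCoeff := by
    have := hcoeff hdeg.le le_rfl
    rwa [← hdeg, Polynomial.coeff_natDegree, hdeg, Polynomial.coeff_natDegree] at this
  have hP0 : P ≠ 0 := fun h ↦ hQ0 (Polynomial.leadingCoeff_eq_zero.mp (by simpa [h] using hlead.symm))
  exact ⟨by rw [Polynomial.degree_eq_natDegree hP0, Polynomial.degree_eq_natDegree hQ0, hdeg],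
    hlead⟩

theorem Submodule.finrank_map_of_injective {K V W : Type*} [Field K] [AddCommGroup V]
    [Module K V] [AddCommGroup W] [Module K W] {g : V →ₗ[K] W} (hg : Function.Injective g)
    (U : Submodule K V) : Module.finrank K (U.map g) = Module.finrank K U :=
  (Submodule.equivMapOfInjective g hg U).finrank_eq.symm

theorem Submodule.finrank_map_add_finrank_inf_ker {K V W : Type*} [Field K] [AddCommGroup V]
    [Module K V] [AddCommGroup W] [Module K W] (g : V →ₗ[K] W) (U : Submodule K V)
    [FiniteDimensional K U] :
    Module.finrank K (U.map g) + Module.finrank K ↥(LinearMap.ker g ⊓ U) =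
      Module.finrank K U := by
  rw [← (g.domRestrict U).finrank_range_add_finrank_ker, LinearMap.range_domRestrict,
    LinearMap.ker_domRestrict, inf_comm, ← Submodule.map_comap_subtype,
    Submodule.finrank_map_subtype_eq]

namespace MvPolynomial

variable {σ k : Type*}

instance finiteDimensional_homogeneousSubmodule [Finite σ] [Field k] (m : ℕ) :
    FiniteDimensional k (homogeneousSubmodule σ k m) :=
  Module.Finite.of_fg (homogeneousSubmodule_fg σ k m)

theorem finrank_homogeneousSubmodule [Field k] (r m : ℕ) :
    Module.finrank k (homogeneousSubmodule (Fin (r + 1)) k m) = (m + r).choose r := by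
  rw [homogeneousSubmodule_eq_finsupp_supported,
    (AddMonoidAlgebra.supportedEquivFinsupp (R := k) (S := k)
      {d : Fin (r + 1) →₀ ℕ | d.degree = m}).finrank_eq]
  rw [Module.finrank, rank_finsupp_self, Cardinal.toNat_lift, ← Nat.card]
  have hset : {d : Fin (r + 1) →₀ ℕ | d.degree = m} =
      (Finset.finsuppAntidiag (Finset.univ : Finset (Fin (r + 1))) m : Set _) := by
    ext d
    simp [Finsupp.degree_eq_sum]
  rw [hset]
  simp only [Nat.card_eq_fintype_card, Fintype.card_coe, Finset.coe_sort_coe,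
    Finset.card_finsuppAntidiag_nat_eq_choose, Finset.card_univ, Fintype.card_fin]
  rw [show r + 1 + m - 1 = m + r by omega, Nat.choose_symm_add]

theorem homogeneousComponent_mul_of_isHomogeneous_left [CommRing k] {a : MvPolynomial σ k} {i : ℕ}
    (ha : a.IsHomogeneous i) (b : MvPolynomial σ k) (j : ℕ) :
    homogeneousComponent (i + j) (a * b) = a * homogeneousComponent j b := by
  let : GradedAlgebra (homogeneousSubmodule σ k) := gradedAlgebra
  have h := DirectSum.coe_decompose_mul_add_of_left_mem (homogeneousSubmodule σ k) (j := j)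
    (b := b) ((mem_homogeneousSubmodule i a).mpr ha)
  have hd : ∀ (p : MvPolynomial σ k) (l : ℕ),
      (DirectSum.decompose (homogeneousSubmodule σ k) p l : MvPolynomial σ k) =
        homogeneousComponent l p := fun p l ↦ decomposition.decompose'_apply p l
  rwa [hd, hd] at h

/-- The degree-`m` part of an ideal of a polynomial ring. -/
noncomputable def idealComponent [Field k] (J : Ideal (MvPolynomial σ k)) (m : ℕ) :
    Submodule k (MvPolynomial σ k) :=
  J.restrictScalars k ⊓ homogeneousSubmodule σ k m

instance [Finite σ] [Field k] (J : Ideal (MvPolynomial σ k)) (m : ℕ) :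
    FiniteDimensional k (idealComponent J m) :=
  Submodule.finiteDimensional_of_le (S₂ := homogeneousSubmodule σ k m) inf_le_right

/-- The codimension of an ideal in each degree, i.e. the Hilbert function of the quotient. -/
noncomputable def hilbertFunction [Field k] (J : Ideal (MvPolynomial σ k)) (m : ℕ) : ℚ :=
  (Module.finrank k (homogeneousSubmodule σ k m) : ℚ) - Module.finrank k (idealComponent J m)

/-- Stability of an ideal under taking homogeneous components. -/
def IsComponentStable [Field k] (J : Ideal (MvPolynomial σ k)) : Prop :=
  ∀ p ∈ J, ∀ m, homogeneousComponent m p ∈ J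

theorem IsComponentStable.sup_span_X [Field k] {J : Ideal (MvPolynomial σ k)}
    (hJ : IsComponentStable J) (i : σ) : IsComponentStable (J ⊔ Ideal.span {X i}) := by
  intro p hp m
  obtain ⟨a, ha, b, hb, rfl⟩ := Submodule.mem_sup.mp hp
  obtain ⟨c, rfl⟩ := Ideal.mem_span_singleton'.mp hb
  rw [map_add]
  refine add_mem (Ideal.mem_sup_left (hJ a ha m)) (Ideal.mem_sup_right ?_)
  rw [mul_comm]
  rcases m with _ | m
  · classical
    rw [homogeneousComponent_zero, coeff_X_mul', if_neg (by simp), map_zero]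
    exact zero_mem _
  · rw [add_comm m 1, homogeneousComponent_mul_of_isHomogeneous_left (isHomogeneous_X k i)]
    exact Ideal.mul_mem_right _ _ (Ideal.mem_span_singleton_self _)

/-- The colon ideal of `J` by a polynomial. -/
noncomputable def colonPolynomial [Field k] (J : Ideal (MvPolynomial σ k)) (y : MvPolynomial σ k) :
    Ideal (MvPolynomial σ k) :=
  Submodule.comap (LinearMap.mulLeft (MvPolynomial σ k) y) J

theorem mem_colonPolynomial [Field k] {J : Ideal (MvPolynomial σ k)} {y p : MvPolynomial σ k} :
    p ∈ colonPolynomial J y ↔ y * p ∈ J := Iff.rfl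

theorem le_colonPolynomial [Field k] (J : Ideal (MvPolynomial σ k)) (y : MvPolynomial σ k) :
    J ≤ colonPolynomial J y := fun _ hp ↦ J.mul_mem_left y hp

theorem IsComponentStable.colonPolynomial_X [Field k] {J : Ideal (MvPolynomial σ k)}
    (hJ : IsComponentStable J) (i : σ) : IsComponentStable (colonPolynomial J (X i)) := by
  intro p hp m
  have h := hJ _ (mem_colonPolynomial.mp hp) (1 + m)
  rwa [homogeneousComponent_mul_of_isHomogeneous_left (isHomogeneous_X k i)] at h

theorem hilbertFunction_succ [Finite σ] [Field k] {J : Ideal (MvPolynomial σ k)}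
    (hJ : IsComponentStable J) (i : σ) (m : ℕ) :
    hilbertFunction J (m + 1) = hilbertFunction (J ⊔ Ideal.span {X i}) (m + 1) +
      hilbertFunction (colonPolynomial J (X i)) m := by
  let μ : MvPolynomial σ k →ₗ[k] MvPolynomial σ k := LinearMap.mulLeft k (X i)
  have hμ : Function.Injective μ := mul_right_injective₀ (X_ne_zero i)
  have hsup : idealComponent J (m + 1) ⊔ (homogeneousSubmodule σ k m).map μ =
      idealComponent (J ⊔ Ideal.span {X i}) (m + 1) := by
    apply le_antisymm
    · refine sup_le (fun p hp ↦ ⟨Ideal.mem_sup_left hp.1, hp.2⟩) ?_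
      rintro _ ⟨s, hs, rfl⟩
      refine ⟨Ideal.mem_sup_right
        (Ideal.mul_mem_right _ _ (Ideal.mem_span_singleton_self _)), ?_⟩
      rw [add_comm]
      exact (isHomogeneous_X k i).mul hs
    · rintro p ⟨hp, hph⟩
      obtain ⟨a, ha, b, hb, rfl⟩ := Submodule.mem_sup.mp hp
      obtain ⟨c, rfl⟩ := Ideal.mem_span_singleton'.mp hb
      rw [← homogeneousComponent_eq_self hph, map_add, mul_comm c, add_comm m 1,
        homogeneousComponent_mul_of_isHomogeneous_left (isHomogeneous_X k i)]
      exact add_mem (Submodule.mem_sup_left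
          ⟨hJ a ha _, homogeneousComponent_isHomogeneous _ _⟩)
        (Submodule.mem_sup_right ⟨_, homogeneousComponent_isHomogeneous m c, rfl⟩)
  have hinf : idealComponent J (m + 1) ⊓ (homogeneousSubmodule σ k m).map μ =
      (idealComponent (colonPolynomial J (X i)) m).map μ := by
    apply le_antisymm
    · rintro _ ⟨hp, s, hs, rfl⟩
      exact ⟨s, ⟨hp.1, hs⟩, rfl⟩
    · rintro _ ⟨s, ⟨hs, hsh⟩, rfl⟩
      refine ⟨⟨hs, ?_⟩, s, hsh, rfl⟩
      rw [add_comm]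
      exact (isHomogeneous_X k i).mul hsh
  have h := Submodule.finrank_sup_add_finrank_inf_eq (idealComponent J (m + 1))
    ((homogeneousSubmodule σ k m).map μ)
  rw [hsup, hinf, Submodule.finrank_map_of_injective hμ, Submodule.finrank_map_of_injective hμ] at h
  have h' : (Module.finrank k (idealComponent (J ⊔ Ideal.span {X i}) (m + 1)) : ℚ) +
      Module.finrank k (idealComponent (colonPolynomial J (X i)) m) =
      Module.finrank k (idealComponent J (m + 1)) +
        Module.finrank k (homogeneousSubmodule σ k m) := by exact_mod_cast h
  simp only [hilbertFunction]
  linarith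

theorem homogeneousSubmodule_le_of_X_mem [Field k] {J : Ideal (MvPolynomial σ k)}
    (hJ : ∀ i, X i ∈ J) (m : ℕ) : homogeneousSubmodule σ k (m + 1) ≤ J.restrictScalars k := by
  intro p hp
  have hle : idealOfVars σ k ≤ J := Ideal.span_le.mpr (by rintro _ ⟨i, rfl⟩; exact hJ i)
  refine hle ?_
  rw [← pow_one (idealOfVars σ k), mem_pow_idealOfVars_iff]
  intro x hx
  by_contra h
  exact (mem_support_iff.mp hx) (IsHomogeneous.coeff_eq_zero hp (by omega))

theorem eventuallyPolynomial_hilbertFunction [Finite σ] [Field k] (J : Ideal (MvPolynomial σ k))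
    (hJ : IsComponentStable J) : EventuallyPolynomial (hilbertFunction J) := by
  induction J using IsNoetherian.induction with
  | hgt J ih =>
    by_cases hX : ∀ i, X i ∈ J
    · refine ⟨0, 1, fun m hm ↦ ?_⟩
      obtain ⟨m, rfl⟩ : ∃ l, m = l + 1 := ⟨m - 1, by omega⟩
      have : idealComponent J (m + 1) = homogeneousSubmodule σ k (m + 1) :=
        inf_eq_right.mpr (homogeneousSubmodule_le_of_X_mem hX m)
      rw [hilbertFunction, this, sub_self, Polynomial.eval_zero]
    · push Not at hX
      obtain ⟨i, hi⟩ := hX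
      have h1 := ih (J ⊔ Ideal.span {X i})
        (lt_of_le_of_ne le_sup_left fun h ↦ hi (by
          rw [h]; exact Ideal.mem_sup_right (Ideal.mem_span_singleton_self _)))
        (hJ.sup_span_X i)
      rcases (le_colonPolynomial J (X i)).eq_or_lt with heq | hlt
      · exact h1.succ.of_sub_succ fun m ↦ by
          simpa only [← heq] using hilbertFunction_succ hJ i m
      · have h2 := h1.succ.add (ih _ hlt (hJ.colonPolynomial_X i))
        exact EventuallyPolynomial.of_succ (by simpa only [hilbertFunction_succ hJ i] using h2)

end MvPolynomial

namespace MvPolynomial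

variable {σ τ k : Type*} [Field k] {d : ℕ} {f : τ → MvPolynomial σ k}

theorem homogeneousComponent_aeval (hd : 1 ≤ d) (hf : ∀ i, (f i).IsHomogeneous d)
    (p : MvPolynomial τ k) (m : ℕ) :
    homogeneousComponent (m * d) (aeval f p) = aeval f (homogeneousComponent m p) := by
  have hcomp (j : ℕ) : aeval f (homogeneousComponent j p) ∈ homogeneousSubmodule σ k (d * j) :=
    (homogeneousComponent_isHomogeneous j p).aeval f hf
  have hinj (j : ℕ) : m * d = d * j ↔ m = j := by
    rw [mul_comm, Nat.mul_right_inj (by omega)]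
  conv_lhs => rw [← sum_homogeneousComponent p]
  simp only [map_sum, homogeneousComponent_of_mem (hcomp _), hinj]
  rw [Finset.sum_ite_eq]
  split_ifs with h
  · rfl
  · rw [homogeneousComponent_eq_zero _ _ (by simpa using h), map_zero]

theorem isComponentStable_ker_aeval (hd : 1 ≤ d) (hf : ∀ i, (f i).IsHomogeneous d) :
    IsComponentStable (RingHom.ker (aeval f : MvPolynomial τ k →ₐ[k] MvPolynomial σ k)) := by
  intro p hp m
  rw [RingHom.mem_ker] at hp ⊢
  rw [← homogeneousComponent_aeval hd hf, hp, map_zero]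

theorem toSubmodule_adjoin_inf_homogeneousSubmodule (hd : 1 ≤ d)
    (hf : ∀ i, (f i).IsHomogeneous d) (m : ℕ) :
    Subalgebra.toSubmodule (Algebra.adjoin k (Set.range f)) ⊓ homogeneousSubmodule σ k (m * d) =
      (homogeneousSubmodule τ k m).map (aeval f).toLinearMap := by
  rw [Algebra.adjoin_range_eq_range_aeval]
  apply le_antisymm
  · rintro _ ⟨⟨p, rfl⟩, hx⟩
    refine ⟨homogeneousComponent m p, homogeneousComponent_isHomogeneous m p, ?_⟩
    exact (homogeneousComponent_aeval hd hf p m).symm.trans (homogeneousComponent_eq_self hx)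
  · rintro _ ⟨p, hp, rfl⟩
    refine ⟨⟨p, rfl⟩, ?_⟩
    rw [mul_comm]
    exact IsHomogeneous.aeval hp f hf

theorem eventuallyPolynomial_finrank_adjoin [Finite τ] (hd : 1 ≤ d)
    (hf : ∀ i, (f i).IsHomogeneous d) :
    EventuallyPolynomial fun m ↦ (Module.finrank k ↥(Subalgebra.toSubmodule
      (Algebra.adjoin k (Set.range f)) ⊓ homogeneousSubmodule σ k (m * d)) : ℚ) := by
  convert eventuallyPolynomial_hilbertFunction _ (isComponentStable_ker_aeval hd hf) using 2 with m
  rw [toSubmodule_adjoin_inf_homogeneousSubmodule hd hf, hilbertFunction, eq_sub_iff_add_eq]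
  exact_mod_cast Submodule.finrank_map_add_finrank_inf_ker
    (aeval f : MvPolynomial τ k →ₐ[k] MvPolynomial σ k).toLinearMap (homogeneousSubmodule τ k m)

theorem exists_hilbertPolynomial_veronese (k : Type*) [Field k] (r : ℕ) {d : ℕ} (hd : 1 ≤ d) :
    ∃ Q : Polynomial ℚ, Q.degree = (r : WithBot ℕ) ∧
      (Nat.factorial r : ℚ) * Q.leadingCoeff = (d : ℚ) ^ r ∧
      ∀ m : ℕ, (Module.finrank k (homogeneousSubmodule (Fin (r + 1)) k (m * d)) : ℚ) =
        Q.eval (m : ℚ) := by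
  have hd0 : (d : ℚ) ≠ 0 := by positivity
  have hr : (Nat.factorial r : ℚ) ≠ 0 := by positivity
  have hlead : ((Polynomial.preHilbertPoly ℚ r 0).comp
      (Polynomial.C (d : ℚ) * Polynomial.X)).leadingCoeff =
        (Nat.factorial r : ℚ)⁻¹ * (d : ℚ) ^ r := by
    rw [Polynomial.leadingCoeff_comp (by rw [Polynomial.natDegree_C_mul_X _ hd0]; simp),
      Polynomial.leadingCoeff_preHilbertPoly, Polynomial.natDegree_preHilbertPoly,
      Polynomial.leadingCoeff_C_mul_X]
  refine ⟨_, ?_, by rw [hlead]; field_simp, fun m ↦ ?_⟩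
  · rw [Polynomial.degree_eq_natDegree, Polynomial.natDegree_comp,
      Polynomial.natDegree_preHilbertPoly, Polynomial.natDegree_C_mul_X _ hd0, mul_one]
    rw [← Polynomial.leadingCoeff_ne_zero, hlead]
    positivity
  · have h := Polynomial.preHilbertPoly_eq_choose_sub_add ℚ r (Nat.zero_le (m * d))
    rw [Nat.sub_zero] at h
    rw [finrank_homogeneousSubmodule, ← h, Polynomial.eval_comp]
    simp [mul_comm]

/-- If the ideal of the forms `f i` contains a power of the irrelevant ideal, then large-degree
forms lie in the ideal with homogeneous coefficients. -/
theorem IsHomogeneous.exists_eq_sum_mul [Fintype τ] (hf : ∀ i, (f i).IsHomogeneous d) {N D : ℕ}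
    (hN : idealOfVars σ k ^ N ≤ Ideal.span (Set.range f)) (hND : N ≤ d + D)
    {p : MvPolynomial σ k} (hp : p.IsHomogeneous (d + D)) :
    ∃ c : τ → MvPolynomial σ k, (∀ i, (c i).IsHomogeneous D) ∧ p = ∑ i, f i * c i := by
  have hpI : p ∈ Ideal.span (Set.range f) := by
    refine hN ((mem_pow_idealOfVars_iff N p).mpr fun x hx ↦ ?_)
    by_contra h
    exact (mem_support_iff.mp hx) (hp.coeff_eq_zero (by omega))
  obtain ⟨c, hc⟩ := Ideal.mem_span_range_iff_exists_fun.mp hpI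
  refine ⟨fun i ↦ homogeneousComponent D (c i),
    fun i ↦ homogeneousComponent_isHomogeneous D (c i), ?_⟩
  rw [← homogeneousComponent_eq_self hp, ← hc, map_sum]
  exact Finset.sum_congr rfl fun i _ ↦ by
    rw [mul_comm, homogeneousComponent_mul_of_isHomogeneous_left (hf i)]

theorem homogeneousSubmodule_mul_le_adjoin (m : ℕ) :
    homogeneousSubmodule σ k (m * d) ≤
      Subalgebra.toSubmodule (Algebra.adjoin k {p : MvPolynomial σ k | p.IsHomogeneous d}) := by
  rw [← homogeneousSubmodule_one_pow, mul_comm, pow_mul, homogeneousSubmodule_one_pow]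
  have hle : homogeneousSubmodule σ k d ≤
      Subalgebra.toSubmodule (Algebra.adjoin k {p : MvPolynomial σ k | p.IsHomogeneous d}) :=
    fun p hp ↦ Algebra.subset_adjoin hp
  induction m with
  | zero =>
    rw [pow_zero, Submodule.one_le]
    exact one_mem (Algebra.adjoin k {p : MvPolynomial σ k | p.IsHomogeneous d})
  | succ m ih =>
    rw [pow_succ, Submodule.mul_le]
    exact fun a ha b hb ↦ Subalgebra.mul_mem _ (ih ha) (hle hb)

theorem exists_common_denominator {A : Type*} [CommRing A] [IsDomain A] [Algebra k A]
    (F : Subalgebra k A) {W : Submodule k A} (hW : W.FG)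
    (h : ∀ b ∈ W, ∃ q ∈ F, q ≠ 0 ∧ q * b ∈ F) :
    ∃ q ∈ F, q ≠ 0 ∧ ∀ b ∈ W, q * b ∈ F := by
  obtain ⟨s, rfl⟩ := hW
  have hs : ∀ t : Finset A, t ⊆ s → ∃ q ∈ F, q ≠ 0 ∧ ∀ b ∈ t, q * b ∈ F := by
    classical
    intro t
    induction t using Finset.induction with
    | empty => exact fun _ ↦ ⟨1, one_mem F, one_ne_zero, by simp⟩
    | insert a t _ ih =>
      intro hts
      rw [Finset.insert_subset_iff] at hts
      obtain ⟨q, hq, hq0, hqt⟩ := ih hts.2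
      obtain ⟨r, hr, hr0, hra⟩ := h a (Submodule.subset_span hts.1)
      refine ⟨q * r, mul_mem hq hr, mul_ne_zero hq0 hr0, fun b hb ↦ ?_⟩
      rcases Finset.mem_insert.mp hb with rfl | hb
      · rw [mul_assoc]
        exact mul_mem hq hra
      · rw [mul_comm q r, mul_assoc]
        exact mul_mem hr (hqt b hb)
  obtain ⟨q, hq, hq0, hqs⟩ := hs s subset_rfl
  refine ⟨q, hq, hq0, fun b hb ↦ ?_⟩
  have hle : Submodule.span k (s : Set A) ≤
      (Subalgebra.toSubmodule F).comap (LinearMap.mulLeft k q) :=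
    Submodule.span_le.mpr hqs
  exact hle hb

/-- If every form of degree divisible by `d` is a fraction of elements of the algebra generated
by forms of degree `d` whose ideal is primary to the irrelevant ideal, then some form of degree
divisible by `d` conducts all of them into that algebra. -/
theorem exists_conductor [Finite σ] [Fintype τ] (hd : 1 ≤ d) (hf : ∀ i, (f i).IsHomogeneous d)
    {N : ℕ} (hN : idealOfVars σ k ^ N ≤ Ideal.span (Set.range f))
    (hfrac : ∀ m, ∀ b ∈ homogeneousSubmodule σ k (m * d),
      ∃ q ∈ Algebra.adjoin k (Set.range f), q ≠ 0 ∧ q * b ∈ Algebra.adjoin k (Set.range f)) :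
    ∃ e, ∃ c : MvPolynomial σ k, c ≠ 0 ∧ ∀ m, ∀ b ∈ homogeneousSubmodule σ k (m * d),
      c * b ∈ Subalgebra.toSubmodule (Algebra.adjoin k (Set.range f)) ⊓
        homogeneousSubmodule σ k ((m + e) * d) := by
  choose! q hqF hq0 hq using fun m ↦ exists_common_denominator
    (Algebra.adjoin k (Set.range f)) (homogeneousSubmodule_fg σ k (m * d)) (hfrac m)
  obtain ⟨s, hsF, hs0, hs⟩ : ∃ s ∈ Algebra.adjoin k (Set.range f), s ≠ 0 ∧
      ∀ m ≤ N, ∀ b ∈ homogeneousSubmodule σ k (m * d), s * b ∈ Algebra.adjoin k (Set.range f) := by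
    refine ⟨∏ m ∈ Finset.range (N + 1), q m, prod_mem fun m _ ↦ hqF m,
      Finset.prod_ne_zero_iff.mpr fun m _ ↦ hq0 m, fun m hm b hb ↦ ?_⟩
    rw [← Finset.prod_erase_mul _ _ (Finset.mem_range.mpr (Nat.lt_succ_of_le hm)), mul_assoc]
    exact mul_mem (prod_mem fun m _ ↦ hqF m) (hq m b hb)
  have hall : ∀ m, ∀ b ∈ homogeneousSubmodule σ k (m * d),
      s * b ∈ Algebra.adjoin k (Set.range f) := by
    intro m
    induction m with
    | zero => exact hs 0 (Nat.zero_le N)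
    | succ m ih =>
      intro b hb
      rcases le_or_gt (m + 1) N with hm | hm
      · exact hs _ hm b hb
      · have hND : N ≤ d + m * d := by nlinarith
        obtain ⟨c, hc, rfl⟩ := IsHomogeneous.exists_eq_sum_mul hf hN hND
          (p := b) (by rwa [add_mul, one_mul, add_comm] at hb)
        rw [Finset.mul_sum]
        refine sum_mem fun i _ ↦ ?_
        rw [mul_left_comm]
        exact mul_mem (Algebra.subset_adjoin ⟨i, rfl⟩) (ih _ (hc i))
  obtain ⟨p, rfl⟩ : ∃ p, aeval f p = s := by
    rwa [Algebra.adjoin_range_eq_range_aeval] at hsF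
  obtain ⟨e, he⟩ : ∃ e, aeval f (homogeneousComponent e p) ≠ 0 := by
    by_contra! h
    rw [← sum_homogeneousComponent p, map_sum] at hs0
    exact hs0 (Finset.sum_eq_zero fun e _ ↦ h e)
  refine ⟨e, _, he, fun m b hb ↦ ?_⟩
  have hmem : b * aeval f p ∈ Algebra.adjoin k (Set.range f) := by
    rw [mul_comm]
    exact hall m b hb
  rw [Algebra.adjoin_range_eq_range_aeval] at hmem
  obtain ⟨r, hr⟩ := hmem
  rw [toSubmodule_adjoin_inf_homogeneousSubmodule hd hf]
  refine ⟨homogeneousComponent (m + e) r, homogeneousComponent_isHomogeneous _ _, ?_⟩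
  have hr' : aeval f r = b * aeval f p := hr
  rw [AlgHom.toLinearMap_apply, ← homogeneousComponent_aeval hd hf, hr', add_mul,
    homogeneousComponent_mul_of_isHomogeneous_left hb, homogeneousComponent_aeval hd hf, mul_comm]

theorem finrank_add_finrank_le_of_not_mul_mem [Finite σ] (F : Subalgebra k (MvPolynomial σ k))
    {b : MvPolynomial σ k} (hb : b.IsHomogeneous d)
    (hbF : ∀ q ∈ F, q ≠ 0 → b * q ∉ F) (m : ℕ) :
    Module.finrank k ↥(Subalgebra.toSubmodule F ⊓ homogeneousSubmodule σ k ((m + 1) * d)) +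
      Module.finrank k ↥(Subalgebra.toSubmodule F ⊓ homogeneousSubmodule σ k (m * d)) ≤
      Module.finrank k (homogeneousSubmodule σ k ((m + 1) * d)) := by
  have hb0 : b ≠ 0 := fun h ↦ hbF 1 (one_mem F) one_ne_zero (by simp [h])
  let μ : MvPolynomial σ k →ₗ[k] MvPolynomial σ k := LinearMap.mulLeft k b
  have hμ : Function.Injective μ := mul_right_injective₀ hb0
  let U := Subalgebra.toSubmodule F ⊓ homogeneousSubmodule σ k ((m + 1) * d)
  let V := Subalgebra.toSubmodule F ⊓ homogeneousSubmodule σ k (m * d)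
  have hU : FiniteDimensional k U :=
    Submodule.finiteDimensional_of_le (S₂ := homogeneousSubmodule σ k ((m + 1) * d)) inf_le_right
  have hV : FiniteDimensional k V :=
    Submodule.finiteDimensional_of_le (S₂ := homogeneousSubmodule σ k (m * d)) inf_le_right
  have hinf : U ⊓ V.map μ = ⊥ := by
    rw [eq_bot_iff]
    rintro _ ⟨hp, q, hq, rfl⟩
    by_contra hne
    refine hbF q hq.1 (fun h ↦ hne ?_) hp.1
    simp [h]
  have hsup : U ⊔ V.map μ ≤ homogeneousSubmodule σ k ((m + 1) * d) := by
    refine sup_le inf_le_right ?_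
    rintro _ ⟨q, hq, rfl⟩
    rw [add_mul, one_mul, add_comm]
    exact hb.mul hq.2
  have h := Submodule.finrank_sup_add_finrank_inf_eq U (V.map μ)
  rw [hinf, finrank_bot, add_zero, Submodule.finrank_map_of_injective hμ] at h
  exact h.symm.le.trans (Submodule.finrank_mono hsup)

theorem algebraMap_mem_adjoin_iff {A : Type*} [CommRing A] [IsDomain A] [Algebra k A]
    (F : Subalgebra k A) (b : A) :
    algebraMap A (FractionRing A) b ∈ IntermediateField.adjoin k
      (algebraMap A (FractionRing A) '' (F : Set A)) ↔ ∃ q ∈ F, q ≠ 0 ∧ b * q ∈ F := by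
  have hinj := IsFractionRing.injective A (FractionRing A)
  constructor
  · intro hb
    obtain ⟨_, hr, _, hs, h⟩ := IntermediateField.mem_adjoin_iff_div.mp hb
    have hmap : Algebra.adjoin k (algebraMap A (FractionRing A) '' (F : Set A)) =
        F.map (IsScalarTower.toAlgHom k A (FractionRing A)) := by
      have := AlgHom.map_adjoin (IsScalarTower.toAlgHom k A (FractionRing A)) (F : Set A)
      rw [Algebra.adjoin_eq] at this
      exact this.symm
    rw [hmap] at hr hs
    obtain ⟨r, hr, rfl⟩ := hr
    obtain ⟨s, hs, rfl⟩ := hs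
    change algebraMap A (FractionRing A) b =
      algebraMap A (FractionRing A) r / algebraMap A (FractionRing A) s at h
    rcases eq_or_ne s 0 with rfl | hs0
    · rw [map_zero, div_zero, map_eq_zero_iff _ hinj] at h
      exact ⟨1, one_mem F, one_ne_zero, by simp [h]⟩
    · have hs0' : algebraMap A (FractionRing A) s ≠ 0 := (map_ne_zero_iff _ hinj).mpr hs0
      rw [eq_div_iff hs0', ← map_mul] at h
      exact ⟨s, hs, hs0, by rwa [hinj h]⟩
  · rintro ⟨q, hq, hq0, hbq⟩
    have hq0' : algebraMap A (FractionRing A) q ≠ 0 := (map_ne_zero_iff _ hinj).mpr hq0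
    have h : algebraMap A (FractionRing A) b =
        algebraMap A (FractionRing A) (b * q) / algebraMap A (FractionRing A) q := by
      rw [map_mul, mul_div_cancel_right₀ _ hq0']
    rw [h]
    exact div_mem (IntermediateField.subset_adjoin _ _ ⟨_, hbq, rfl⟩)
      (IntermediateField.subset_adjoin _ _ ⟨_, hq, rfl⟩)

end MvPolynomial

/-- Let `k` be an infinite field, `R = k[x_1,…,x_n]`, `m = (x_1,…,x_n)`,
and let `f_1,…,f_{n+1}` be forms of degree `d` generating an `m`-primary ideal `I`.  Let
`F = k[f_1,…,f_{n+1}] ⊆ F' = k[m^d]` (the `d`-th Veronese subalgebra), graded so that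
elements of degree `d` in `R` have degree 1.  Then `[Frac(F') : Frac(F)] = 1`
(equivalently, the rational map `Ψ : P^{n−1} ⇢ P^n` defined by `f_1,…,f_{n+1}` is
birational onto its image) if and only if the multiplicity `deg(F)` of the standard graded
`k`-algebra `F` — `(n−1)!` times the leading coefficient of its Hilbert polynomial —
equals `d^{n−1}`. -/
theorem frac_degree_one_iff_multiplicity_eq
    (k : Type*) [Field k] [Infinite k] (n d : ℕ) (hn : 1 ≤ n) (hd : 1 ≤ d)
    (f : Fin (n + 1) → MvPolynomial (Fin n) k)
    (hfhom : ∀ i, (f i).IsHomogeneous d)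
    (hprim : (Ideal.span (Set.range f)).radical =
      Ideal.span (Set.range (X : Fin n → MvPolynomial (Fin n) k)))
    (F F' : Subalgebra k (MvPolynomial (Fin n) k))
    (hF : F = Algebra.adjoin k (Set.range f))
    (hF' : F' = Algebra.adjoin k {p : MvPolynomial (Fin n) k | p.IsHomogeneous d})
    (L L' : IntermediateField k (FractionRing (MvPolynomial (Fin n) k)))
    (hL : L = IntermediateField.adjoin k
      (algebraMap (MvPolynomial (Fin n) k) (FractionRing (MvPolynomial (Fin n) k)) ''
        (F : Set (MvPolynomial (Fin n) k))))
    (hL' : L' = IntermediateField.adjoin k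
      (algebraMap (MvPolynomial (Fin n) k) (FractionRing (MvPolynomial (Fin n) k)) ''
        (F' : Set (MvPolynomial (Fin n) k))))
    (hle : L ≤ L') :
    Module.finrank L (IntermediateField.extendScalars hle) = 1 ↔
      ∃ P : Polynomial ℚ, P.degree = ((n - 1 : ℕ) : WithBot ℕ) ∧
        (Nat.factorial (n - 1) : ℚ) * P.leadingCoeff = (d : ℚ) ^ (n - 1) ∧
        ∃ N : ℕ, ∀ m ≥ N,
          (Module.finrank k
              ↥(Subalgebra.toSubmodule F ⊓ homogeneousSubmodule (Fin n) k (m * d)) : ℚ) =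
            P.eval (m : ℚ) := by
  obtain ⟨r, rfl⟩ : ∃ r, n = r + 1 := ⟨n - 1, by omega⟩
  simp only [Nat.add_sub_cancel]
  have hfrac (b : MvPolynomial (Fin (r + 1)) k) :
      algebraMap _ (FractionRing (MvPolynomial (Fin (r + 1)) k)) b ∈ L ↔
        ∃ q ∈ F, q ≠ 0 ∧ b * q ∈ F := by
    rw [hL]
    exact algebraMap_mem_adjoin_iff F b
  have hL'L : Module.finrank L (IntermediateField.extendScalars hle) = 1 ↔ L' ≤ L := by
    rw [← IntermediateField.relfinrank_eq_finrank_of_le hle,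
      IntermediateField.relfinrank_eq_one_iff]
  obtain ⟨Q, hQdeg, hQlead, hQ⟩ := exists_hilbertPolynomial_veronese k r hd
  have hfin (m : ℕ) : FiniteDimensional k
      ↥(Subalgebra.toSubmodule F ⊓ homogeneousSubmodule (Fin (r + 1)) k (m * d)) :=
    Submodule.finiteDimensional_of_le
      (S₂ := homogeneousSubmodule (Fin (r + 1)) k (m * d)) inf_le_right
  rw [hL'L]
  constructor
  · intro hLL
    obtain ⟨P, N, hP⟩ : EventuallyPolynomial fun m ↦ (Module.finrank k
        ↥(Subalgebra.toSubmodule F ⊓ homogeneousSubmodule (Fin (r + 1)) k (m * d)) : ℚ) := by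
      rw [hF]
      exact eventuallyPolynomial_finrank_adjoin hd hfhom
    obtain ⟨M, hM⟩ := Ideal.exists_radical_pow_le_of_fg (Ideal.span (Set.range f))
      (IsNoetherian.noetherian _)
    rw [hprim] at hM
    obtain ⟨e, c, hc0, hc⟩ := exists_conductor hd hfhom hM (fun m b hb ↦ by
      rw [← hF]
      obtain ⟨q, hq, hq0, hbq⟩ := (hfrac b).mp (hLL (by
        rw [hL']
        refine IntermediateField.subset_adjoin _ _ ⟨b, ?_, rfl⟩
        rw [hF']
        exact homogeneousSubmodule_mul_le_adjoin m hb))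
      exact ⟨q, hq, hq0, by rwa [mul_comm]⟩)
    rw [← hF] at hc
    have hPQ : ∀ m ≥ N, P.eval (m : ℚ) ≤ Q.eval (m : ℚ) := fun m hm ↦ by
      rw [← hP m hm, ← hQ m]
      exact Nat.cast_le.mpr (Submodule.finrank_mono inf_le_right)
    have hQP : ∀ m ≥ N, Q.eval (m : ℚ) ≤ P.eval ((m + e : ℕ) : ℚ) := fun m hm ↦ by
      rw [← hP (m + e) (by omega), ← hQ m, ← Submodule.finrank_map_of_injective
        (g := LinearMap.mulLeft k c) (mul_right_injective₀ hc0)]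
      refine Nat.cast_le.mpr (Submodule.finrank_mono ?_)
      rintro _ ⟨b, hb, rfl⟩
      exact hc m b hb
    have hQ0 : Q ≠ 0 := by
      rintro rfl
      simp at hQdeg
    obtain ⟨h1, h2⟩ :=
      Polynomial.degree_and_leadingCoeff_eq_of_eventually_squeeze e hQ0 hPQ hQP
    exact ⟨P, h1.trans hQdeg, by rw [h2, hQlead], N, hP⟩
  · rintro ⟨P, hPdeg, hPlead, N, hP⟩
    rw [hL', IntermediateField.adjoin_le_iff]
    have hF'L : F' ≤ L.toSubalgebra.comap (IsScalarTower.toAlgHom k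
        (MvPolynomial (Fin (r + 1)) k) (FractionRing (MvPolynomial (Fin (r + 1)) k))) := by
      rw [hF']
      refine Algebra.adjoin_le fun b hb ↦ ?_
      change algebraMap _ _ b ∈ L
      rw [hfrac]
      by_contra! hbF
      have hPn : P.natDegree = r := Polynomial.natDegree_eq_of_degree_eq_some hPdeg
      have hQn : Q.natDegree = r := Polynomial.natDegree_eq_of_degree_eq_some hQdeg
      have hle' : ∀ m ≥ N, 0 ≤ ((Q - P).comp (Polynomial.X + Polynomial.C 1) - P).eval
          (m : ℚ) := fun m hm ↦ by
        have h1 := hQ (m + 1)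
        have h2 := hP (m + 1) (by omega)
        have h3 : (_ : ℚ) ≤ _ :=
          Nat.cast_le.mpr (finrank_add_finrank_le_of_not_mul_mem F hb hbF m)
        rw [Nat.cast_add, h1, h2, hP m hm] at h3
        simp only [Nat.cast_add, Nat.cast_one] at h3
        simp only [Polynomial.eval_sub, Polynomial.eval_comp, Polynomial.eval_add,
          Polynomial.eval_X, Polynomial.eval_C]
        linarith
      have hsub : (Q - P).natDegree ≤ r :=
        (Polynomial.natDegree_sub_le _ _).trans (max_le hQn.le hPn.le)
      have hcoeff := Polynomial.coeff_nonneg_of_eventually_eval_nonneg (D := r)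
        ((Polynomial.natDegree_sub_le _ _).trans (max_le (by
          rwa [Polynomial.natDegree_comp, Polynomial.natDegree_X_add_C, mul_one]) hPn.le)) hle'
      rw [Polynomial.coeff_sub, Polynomial.coeff_comp_X_add_C_of_natDegree_le _ hsub,
        Polynomial.coeff_sub] at hcoeff
      have hPc : P.coeff r = P.leadingCoeff := by rw [Polynomial.leadingCoeff, hPn]
      have hQc : Q.coeff r = Q.leadingCoeff := by rw [Polynomial.leadingCoeff, hQn]
      have hr : (0 : ℚ) < Nat.factorial r := by positivity
      have hPQ : P.leadingCoeff = Q.leadingCoeff :=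
        mul_left_cancel₀ hr.ne' (hPlead.trans hQlead.symm)
      have hpos : 0 < P.leadingCoeff := by
        refine pos_of_mul_pos_right ?_ hr.le
        rw [hPlead]
        positivity
      rw [hPc, hQc, hPQ] at hcoeff
      linarith
    rintro _ ⟨b, hb, rfl⟩
    exact hF'L hb
end

section
/- Let k be an infinite field, R = k[x_1,…,x_n], m = (x_1,…,x_n), and let f_1,…,f_{n+1} be forms of degree d generating an m-primary ideal I. Then the rational map Ψ: P^{n−1} ⇢ P^n defined by f_1,…,f_{n+1} is birational onto its image if and only if the first Hilbert coefficients satisfy e_1(m^d) = e_1(I). Moreover, the R[It]-module D = R[m^d t]/R[It] has dimension at most n, and Ψ is birational onto its image if and only if dim D ≤ n − 1. -/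
open MvPolynomial

/-- The length of an `R`-module `M`: the Krull dimension of its lattice of submodules. -/
noncomputable def moduleLength (R M : Type*) [CommRing R] [AddCommGroup M] [Module R M] :
    WithBot ℕ∞ :=
  Order.krullDim (Submodule R M)

/-- `J` has Hilbert coefficients `e0, e1` (in dimension `n`):
`λ(R/J^m) = e0·C(m+n−1, n) − e1·C(m+n−2, n−1) + (lower order terms)` for `m ≫ 0`. -/
def HasHilbertCoefficients {R : Type*} [CommRing R] (J : Ideal R) (n : ℕ) (e0 e1 : ℚ) :
    Prop :=
  ∃ (ℓ : ℕ → ℕ) (P : Polynomial ℚ) (N : ℕ),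
    (∀ m, moduleLength R (R ⧸ J ^ m) = (ℓ m : ℕ∞)) ∧
    P.degree < ((n - 1 : ℕ) : WithBot ℕ) ∧
    ∀ m ≥ N, (ℓ m : ℚ) =
      e0 * ((m + n - 1).choose n : ℚ) - e1 * ((m + n - 2).choose (n - 1) : ℚ) +
        P.eval (m : ℚ)

/-- The annihilator of the `F`-module `F'/F`, for subalgebras `F ≤ F'` of `R`: the ideal
of all `a ∈ F` with `a·F' ⊆ F` (the conductor of the extension `F ⊆ F'`). -/
def quotAnnihilator {k R : Type*} [CommRing k] [CommRing R] [Algebra k R]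
    (F F' : Subalgebra k R) : Ideal F where
  carrier := {a | ∀ b ∈ F', (a : R) * b ∈ F}
  add_mem' := fun {a b} ha hb x hx => by
    simpa [add_mul] using F.add_mem (ha x hx) (hb x hx)
  zero_mem' := fun x hx => by simpa using F.zero_mem
  smul_mem' := fun c {a} ha x hx => by
    simpa [smul_eq_mul, mul_assoc] using F.mul_mem c.2 (ha x hx)

namespace EquigeneratedIdeal

theorem finrank_mul_le {k S : Type*} [Field k] [CommRing S] [Algebra k S]
    (A B : Submodule k S) [FiniteDimensional k A] [FiniteDimensional k B] :
    Module.finrank k (A * B : Submodule k S) ≤ Module.finrank k A * Module.finrank k B := by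
  rw [← Submodule.mulMap_range, ← Module.finrank_tensorProduct]
  exact LinearMap.finrank_range_le _

section Graded

variable {k : Type*} [Field k] {n : ℕ}

instance (N : ℕ) : FiniteDimensional k (homogeneousSubmodule (Fin n) k N) :=
  Module.Finite.iff_fg.mpr (homogeneousSubmodule_fg _ _ N)

theorem finrank_homogeneousSubmodule (N : ℕ) :
    Module.finrank k (homogeneousSubmodule (Fin n) k N) = n.multichoose N := by
  classical
  rw [show homogeneousSubmodule (Fin n) k N = restrictSupport k {d | d.degree = N} from
      homogeneousSubmodule_eq_finsupp_supported _ _ N,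
    Module.finrank_eq_nat_card_basis (basisRestrictSupport k _),
    show ({d : Fin n →₀ ℕ | d.degree = N} : Set (Fin n →₀ ℕ)) =
      ((Finset.univ : Finset (Fin n)).finsuppAntidiag N : Finset (Fin n →₀ ℕ)) by
        ext d; simp [Finsupp.degree_eq_sum]]
  rw [Nat.card_coe_set_eq, Set.ncard_coe_finset, Finset.card_finsuppAntidiag_nat_eq_multichoose,
    Finset.card_univ, Fintype.card_fin]

theorem homogeneousComponent_mul_right {a b : MvPolynomial (Fin n) k} {N e : ℕ}
    (hb : b.IsHomogeneous e) :
    homogeneousComponent (N + e) (a * b) = homogeneousComponent N a * b := by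
  let _ := MvPolynomial.gradedAlgebra (σ := Fin n) (R := k)
  have h := DirectSum.coe_decompose_mul_add_of_right_mem (homogeneousSubmodule (Fin n) k)
    (a := a) (b := b) (i := N) (j := e) hb
  have key (p : MvPolynomial (Fin n) k) (i : ℕ) :
      (DirectSum.decompose (homogeneousSubmodule (Fin n) k) p i : MvPolynomial (Fin n) k) =
        homogeneousComponent i p :=
    MvPolynomial.decomposition.decompose'_apply p i
  rwa [key, key] at h

theorem homogeneousComponent_eq_zero_of_mem_pow {p : MvPolynomial (Fin n) k} {a i : ℕ}
    (hp : p ∈ idealOfVars (Fin n) k ^ a) (hi : i < a) : homogeneousComponent i p = 0 := by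
  ext x
  rw [coeff_homogeneousComponent, coeff_zero]
  split_ifs with h
  · exact (mem_pow_idealOfVars_iff' _ _).1 hp x (by omega)
  · rfl

theorem homogeneousComponent_mul {p q : MvPolynomial (Fin n) k} {a b : ℕ}
    (hp : p ∈ idealOfVars (Fin n) k ^ a) (hq : q ∈ idealOfVars (Fin n) k ^ b) :
    homogeneousComponent (a + b) (p * q) =
      homogeneousComponent a p * homogeneousComponent b q := by
  classical
  rw [← homogeneousComponent_mul_right (homogeneousComponent_isHomogeneous b q), ← sub_eq_zero,
    ← map_sub, ← mul_sub]
  refine homogeneousComponent_eq_zero_of_mem_pow (a := a + (b + 1)) ?_ (by omega)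
  rw [pow_add]
  refine Ideal.mul_mem_mul hp ((mem_pow_idealOfVars_iff' _ _).2 fun x hx => ?_)
  rw [coeff_sub, coeff_homogeneousComponent]
  split_ifs with h
  · simp
  · rw [(mem_pow_idealOfVars_iff' _ _).1 hq x (by omega), sub_zero]

theorem homogeneousSubmodule_le_pow (N : ℕ) {p : MvPolynomial (Fin n) k} (hp : p.IsHomogeneous N) :
    p ∈ idealOfVars (Fin n) k ^ N := by
  refine (mem_pow_idealOfVars_iff' _ _).2 fun x hx => hp.coeff_eq_zero (by omega)

theorem pow_idealOfVars_eq_span_homogeneousSubmodule (N : ℕ) :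
    idealOfVars (Fin n) k ^ N =
      Ideal.span (homogeneousSubmodule (Fin n) k N : Set (MvPolynomial (Fin n) k)) := by
  apply le_antisymm
  · rw [pow_idealOfVars_eq_span]
    refine Ideal.span_mono ?_
    rintro _ ⟨x, hx, rfl⟩
    exact isHomogeneous_monomial _ hx
  · exact Ideal.span_le.2 fun p hp => homogeneousSubmodule_le_pow N hp

theorem homogeneousSubmodule_pow_eq (a b : ℕ) :
    homogeneousSubmodule (Fin n) k a ^ b = homogeneousSubmodule (Fin n) k (a * b) := by
  rw [← homogeneousSubmodule_one_pow _ a, ← pow_mul, homogeneousSubmodule_one_pow]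

end Graded

section Forms

variable {k : Type*} [Field k] {n d : ℕ} {ι : Type*} {f : ι → MvPolynomial (Fin n) k}

theorem homogeneousComponent_mem_of_mem_span {W : Submodule k (MvPolynomial (Fin n) k)} {e : ℕ}
    (hW : W ≤ homogeneousSubmodule (Fin n) k e) {y : MvPolynomial (Fin n) k}
    (hy : y ∈ Ideal.span (W : Set (MvPolynomial (Fin n) k))) (N : ℕ) :
    homogeneousComponent (N + e) y ∈ homogeneousSubmodule (Fin n) k N * W := by
  induction hy using Submodule.span_induction with
  | mem x hx =>
    rw [← one_mul x, homogeneousComponent_mul_right (hW hx)]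
    exact Submodule.mul_mem_mul (homogeneousComponent_mem _ _) hx
  | zero => simp
  | add x y _ _ hx hy => rw [map_add]; exact add_mem hx hy
  | smul a x hx ih =>
    clear ih
    induction hx using Submodule.span_induction generalizing a with
    | mem x hx =>
      rw [smul_eq_mul, homogeneousComponent_mul_right (hW hx)]
      exact Submodule.mul_mem_mul (homogeneousComponent_mem _ _) hx
    | zero => simp
    | add x y _ _ hx hy => rw [smul_add, map_add]; exact add_mem (hx a) (hy a)
    | smul b x _ ih => rw [smul_smul]; exact ih _

theorem span_pow_le_homogeneousSubmodule (hf : ∀ i, (f i).IsHomogeneous d) (j : ℕ) :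
    Submodule.span k (Set.range f) ^ j ≤ homogeneousSubmodule (Fin n) k (d * j) := by
  rw [← homogeneousSubmodule_pow_eq]
  refine pow_le_pow_left' ?_ j
  rw [Submodule.span_le]
  rintro _ ⟨i, rfl⟩
  exact hf i

open Pointwise in
variable (f) in
theorem ideal_span_pow_eq (j : ℕ) :
    Ideal.span (Set.range f) ^ j =
      Ideal.span ((Submodule.span k (Set.range f) ^ j :
        Submodule k (MvPolynomial (Fin n) k)) : Set (MvPolynomial (Fin n) k)) := by
  have h : Ideal.span (Set.range f) ^ j = Submodule.span _ (Set.range f ^ j) :=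
    Submodule.span_pow _ _
  rw [h, Submodule.span_pow]
  exact (Submodule.span_span_of_tower k _ _).symm

theorem mem_pow_of_mem_span_pow {y : MvPolynomial (Fin n) k} {j : ℕ}
    (hy : y ∈ Submodule.span k (Set.range f) ^ j) : y ∈ Ideal.span (Set.range f) ^ j := by
  rw [ideal_span_pow_eq]
  exact Ideal.subset_span hy

theorem homogeneousComponent_mem_span_pow (hf : ∀ i, (f i).IsHomogeneous d)
    {y : MvPolynomial (Fin n) k} {j : ℕ} (hy : y ∈ Ideal.span (Set.range f) ^ j) :
    homogeneousComponent (d * j) y ∈ Submodule.span k (Set.range f) ^ j := by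
  rw [ideal_span_pow_eq] at hy
  simpa using homogeneousComponent_mem_of_mem_span (span_pow_le_homogeneousSubmodule hf j) hy 0

theorem ideal_span_pow_le_pow (hf : ∀ i, (f i).IsHomogeneous d) (j : ℕ) :
    Ideal.span (Set.range f) ^ j ≤ idealOfVars (Fin n) k ^ (d * j) := by
  rw [ideal_span_pow_eq, Ideal.span_le]
  exact fun y hy => homogeneousSubmodule_le_pow _ (span_pow_le_homogeneousSubmodule hf j hy)

theorem exists_pow_le_of_radical_eq {I : Ideal (MvPolynomial (Fin n) k)}
    (hI : I.radical = idealOfVars (Fin n) k) : ∃ s, idealOfVars (Fin n) k ^ s ≤ I :=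
  Ideal.exists_pow_le_of_le_radical_of_fg hI.ge (idealOfVars_fg _ _)

theorem homogeneousSubmodule_add_le (hf : ∀ i, (f i).IsHomogeneous d) {s : ℕ}
    (hs : idealOfVars (Fin n) k ^ s ≤ Ideal.span (Set.range f)) {N : ℕ} (hN : s ≤ N + d) :
    homogeneousSubmodule (Fin n) k (N + d) ≤
      homogeneousSubmodule (Fin n) k N * Submodule.span k (Set.range f) := by
  intro p hp
  have h1 : p ∈ Ideal.span (Set.range f) ^ 1 := by
    rw [pow_one]
    exact hs (Ideal.pow_le_pow_right hN (homogeneousSubmodule_le_pow _ hp))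
  rw [ideal_span_pow_eq] at h1
  have := homogeneousComponent_mem_of_mem_span (span_pow_le_homogeneousSubmodule hf 1) h1 N
  rw [mul_one, pow_one, homogeneousComponent_of_mem hp, if_pos rfl] at this
  exact this

theorem homogeneousSubmodule_add_mul_le (hf : ∀ i, (f i).IsHomogeneous d) {s : ℕ}
    (hs : idealOfVars (Fin n) k ^ s ≤ Ideal.span (Set.range f)) {N : ℕ} (hN : s ≤ N) (j : ℕ) :
    homogeneousSubmodule (Fin n) k (N + d * j) ≤
      homogeneousSubmodule (Fin n) k N * Submodule.span k (Set.range f) ^ j := by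
  induction j with
  | zero => simp
  | succ j ih =>
    calc homogeneousSubmodule (Fin n) k (N + d * (j + 1))
        = homogeneousSubmodule (Fin n) k (N + d * j + d) := by rw [mul_add, mul_one, add_assoc]
      _ ≤ homogeneousSubmodule (Fin n) k (N + d * j) * Submodule.span k (Set.range f) :=
        homogeneousSubmodule_add_le hf hs (by omega)
      _ ≤ _ := by
        rw [pow_succ, ← mul_assoc]
        exact mul_le_mul' ih le_rfl

theorem pow_idealOfVars_le (hf : ∀ i, (f i).IsHomogeneous d) {s : ℕ}
    (hs : idealOfVars (Fin n) k ^ s ≤ Ideal.span (Set.range f)) (j : ℕ) :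
    idealOfVars (Fin n) k ^ (s + d * j) ≤ Ideal.span (Set.range f) ^ j := by
  rw [pow_idealOfVars_eq_span_homogeneousSubmodule, Ideal.span_le]
  intro p hp
  refine Submodule.mul_induction_on (homogeneousSubmodule_add_mul_le hf hs le_rfl j hp) ?_ ?_
  · exact fun a _ b hb => Ideal.mul_mem_left _ _ (mem_pow_of_mem_span_pow hb)
  · exact fun a b ha hb => add_mem ha hb

variable (f) in
theorem map_aeval_homogeneousSubmodule (j : ℕ) :
    (homogeneousSubmodule ι k j).map (aeval f).toLinearMap =
      Submodule.span k (Set.range f) ^ j := by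
  rw [← homogeneousSubmodule_one_pow, homogeneousSubmodule_one_eq_span_X, Submodule.map_pow,
    Submodule.map_span, ← Set.range_comp]
  congr 3
  ext i
  simp

theorem aeval_mem_span_pow {G : MvPolynomial ι k} {j : ℕ} (hG : G.IsHomogeneous j) :
    aeval f G ∈ Submodule.span k (Set.range f) ^ j := by
  rw [← map_aeval_homogeneousSubmodule]
  exact Submodule.mem_map_of_mem (f := (aeval f).toLinearMap) hG

theorem homogeneousComponent_aeval (hd : 1 ≤ d) (hf : ∀ i, (f i).IsHomogeneous d)
    (G : MvPolynomial ι k) (j : ℕ) :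
    homogeneousComponent (d * j) (aeval f G) = aeval f (homogeneousComponent j G) := by
  conv_lhs => rw [← sum_homogeneousComponent G]
  rw [map_sum, map_sum]
  have h (i : ℕ) : homogeneousComponent (d * j) (aeval f (homogeneousComponent i G)) =
      if i = j then aeval f (homogeneousComponent j G) else 0 := by
    rw [homogeneousComponent_of_mem (span_pow_le_homogeneousSubmodule hf i
      (aeval_mem_span_pow (homogeneousComponent_isHomogeneous i G)))]
    by_cases hij : i = j
    · simp [hij]
    · have : d * j ≠ d * i := fun h => hij (Nat.eq_of_mul_eq_mul_left hd h).symm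
      simp [hij, this]
  simp_rw [h, Finset.sum_ite_eq', Finset.mem_range]
  split_ifs with hj
  · rfl
  · rw [homogeneousComponent_eq_zero _ _ (by omega), map_zero]

theorem mem_adjoin_of_mem_span_pow {y : MvPolynomial (Fin n) k} {j : ℕ}
    (hy : y ∈ Submodule.span k (Set.range f) ^ j) : y ∈ Algebra.adjoin k (Set.range f) := by
  have h : Submodule.span k (Set.range f) ≤
      Subalgebra.toSubmodule (Algebra.adjoin k (Set.range f)) :=
    Submodule.span_le.2 Algebra.subset_adjoin
  induction hy using Submodule.pow_induction_on_left' with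
  | algebraMap r => exact Subalgebra.algebraMap_mem _ r
  | add x y i _ _ hx hy => exact add_mem hx hy
  | mem_mul m hm i x _ ih => exact mul_mem (h hm) ih

theorem homogeneousComponent_mem_of_mem_adjoin (hd : 1 ≤ d) (hf : ∀ i, (f i).IsHomogeneous d)
    {y : MvPolynomial (Fin n) k} (hy : y ∈ Algebra.adjoin k (Set.range f)) (j : ℕ) :
    homogeneousComponent (d * j) y ∈ Submodule.span k (Set.range f) ^ j := by
  rw [Algebra.adjoin_range_eq_range_aeval] at hy
  obtain ⟨G, rfl⟩ := hy
  change homogeneousComponent (d * j) (aeval f G) ∈ _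
  rw [homogeneousComponent_aeval hd hf]
  exact aeval_mem_span_pow (homogeneousComponent_isHomogeneous j G)

theorem exists_homogeneousComponent_ne_zero (hd : 1 ≤ d) (hf : ∀ i, (f i).IsHomogeneous d)
    {y : MvPolynomial (Fin n) k} (hy : y ∈ Algebra.adjoin k (Set.range f)) (h0 : y ≠ 0) :
    ∃ j, homogeneousComponent (d * j) y ≠ 0 := by
  rw [Algebra.adjoin_range_eq_range_aeval] at hy
  obtain ⟨G, rfl⟩ := hy
  change aeval f G ≠ 0 at h0
  change ∃ j, homogeneousComponent (d * j) (aeval f G) ≠ 0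
  simp_rw [homogeneousComponent_aeval hd hf]
  by_contra! h
  apply h0
  rw [← sum_homogeneousComponent G, map_sum]
  exact Finset.sum_eq_zero fun i _ => h i

end Forms

section Conductor

variable {k : Type*} [Field k] {n d : ℕ} {ι : Type*} {f : ι → MvPolynomial (Fin n) k}

theorem algebraMap_mem_adjoin_image_iff {R K : Type*} [CommRing R] [IsDomain R] [Algebra k R]
    [Field K] [Algebra R K] [IsFractionRing R K] [Algebra k K] [IsScalarTower k R K]
    (A : Subalgebra k R) (u : R) :
    algebraMap R K u ∈ IntermediateField.adjoin k (algebraMap R K '' (A : Set R)) ↔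
      ∃ b ∈ A, b ≠ 0 ∧ b * u ∈ A := by
  have hA : Algebra.adjoin k (algebraMap R K '' (A : Set R)) =
      A.map (IsScalarTower.toAlgHom k R K) := by
    have := AlgHom.map_adjoin (IsScalarTower.toAlgHom k R K) (A : Set R)
    rw [Algebra.adjoin_eq] at this
    exact this.symm
  have hinj := IsFractionRing.injective R K
  rw [IntermediateField.mem_adjoin_iff_div, hA]
  constructor
  · rintro ⟨_, ⟨a, ha, rfl⟩, _, ⟨b, hb, rfl⟩, h⟩
    by_cases hb0 : b = 0
    · refine ⟨1, one_mem _, one_ne_zero, ?_⟩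
      have hu : u = 0 := by
        apply hinj
        simpa [hb0] using h
      simp [hu]
    · refine ⟨b, hb, hb0, ?_⟩
      have hb0' : algebraMap R K b ≠ 0 := by
        simpa using hinj.ne hb0
      have : b * u = a := by
        apply hinj
        rw [map_mul, h]
        change algebraMap R K b * (algebraMap R K a / algebraMap R K b) = _
        field_simp
      rwa [this]
  · rintro ⟨b, hb, hb0, h⟩
    have hb0' : algebraMap R K b ≠ 0 := by
      simpa using hinj.ne hb0
    refine ⟨_, ⟨_, h, rfl⟩, _, ⟨_, hb, rfl⟩, ?_⟩
    change _ = algebraMap R K (b * u) / algebraMap R K b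
    rw [map_mul]
    field_simp

theorem adjoin_eq_adjoin_iff (hd : 1 ≤ d) (hf : ∀ i, (f i).IsHomogeneous d) :
    IntermediateField.adjoin k
      (algebraMap (MvPolynomial (Fin n) k) (FractionRing (MvPolynomial (Fin n) k)) ''
        (Algebra.adjoin k (Set.range f) : Set (MvPolynomial (Fin n) k))) =
    IntermediateField.adjoin k
      (algebraMap (MvPolynomial (Fin n) k) (FractionRing (MvPolynomial (Fin n) k)) ''
        (Algebra.adjoin k {p : MvPolynomial (Fin n) k | p.IsHomogeneous d} :
          Set (MvPolynomial (Fin n) k))) ↔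
    ∀ u : MvPolynomial (Fin n) k, u.IsHomogeneous d →
      ∃ e, ∃ h ∈ Submodule.span k (Set.range f) ^ e, h ≠ 0 ∧
        h * u ∈ Submodule.span k (Set.range f) ^ (e + 1) := by
  constructor
  · intro hL u hu
    have h1 := IntermediateField.subset_adjoin k _ (Set.mem_image_of_mem
      (algebraMap (MvPolynomial (Fin n) k) (FractionRing (MvPolynomial (Fin n) k)))
      (Algebra.subset_adjoin (R := k)
        (s := {p : MvPolynomial (Fin n) k | p.IsHomogeneous d}) hu))
    rw [← hL, SetLike.mem_coe, algebraMap_mem_adjoin_image_iff] at h1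
    obtain ⟨b, hb, hb0, hbu⟩ := h1
    obtain ⟨e, he⟩ := exists_homogeneousComponent_ne_zero hd hf hb hb0
    refine ⟨e, _, homogeneousComponent_mem_of_mem_adjoin hd hf hb e, he, ?_⟩
    rw [← homogeneousComponent_mul_right hu]
    exact homogeneousComponent_mem_of_mem_adjoin hd hf hbu (e + 1)
  · intro H
    refine le_antisymm (IntermediateField.adjoin.mono k _ _ (Set.image_mono ?_)) ?_
    · refine Algebra.adjoin_mono ?_
      rintro _ ⟨i, rfl⟩
      exact hf i
    · set L := IntermediateField.adjoin k
        (algebraMap (MvPolynomial (Fin n) k) (FractionRing (MvPolynomial (Fin n) k)) ''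
          (Algebra.adjoin k (Set.range f) : Set (MvPolynomial (Fin n) k))) with hL
      rw [IntermediateField.adjoin_le_iff]
      rintro _ ⟨p, hp, rfl⟩
      have : Algebra.adjoin k {p : MvPolynomial (Fin n) k | p.IsHomogeneous d} ≤
          L.toSubalgebra.comap (IsScalarTower.toAlgHom k (MvPolynomial (Fin n) k)
            (FractionRing (MvPolynomial (Fin n) k))) := by
        rw [Algebra.adjoin_le_iff]
        intro u hu
        obtain ⟨e, h, he, h0, hu⟩ := H u hu
        change algebraMap (MvPolynomial (Fin n) k) (FractionRing (MvPolynomial (Fin n) k)) u ∈ L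
        rw [hL, algebraMap_mem_adjoin_image_iff]
        exact ⟨h, mem_adjoin_of_mem_span_pow he, h0, mem_adjoin_of_mem_span_pow hu⟩
      exact this hp

theorem exists_mul_homogeneousSubmodule_le
    (H : ∀ u : MvPolynomial (Fin n) k, u.IsHomogeneous d →
      ∃ e, ∃ h ∈ Submodule.span k (Set.range f) ^ e, h ≠ 0 ∧
        h * u ∈ Submodule.span k (Set.range f) ^ (e + 1)) :
    ∃ e, ∃ h ∈ Submodule.span k (Set.range f) ^ e, h ≠ 0 ∧
      ∀ u ∈ homogeneousSubmodule (Fin n) k d, h * u ∈ Submodule.span k (Set.range f) ^ (e + 1) := by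
  obtain ⟨S, hS⟩ := (Module.Finite.iff_fg (N := homogeneousSubmodule (Fin n) k d)).1 inferInstance
  suffices ∀ T : Finset (MvPolynomial (Fin n) k), (T : Set (MvPolynomial (Fin n) k)) ⊆
      (homogeneousSubmodule (Fin n) k d : Set (MvPolynomial (Fin n) k)) →
      ∃ e, ∃ h ∈ Submodule.span k (Set.range f) ^ e, h ≠ 0 ∧
        ∀ u ∈ T, h * u ∈ Submodule.span k (Set.range f) ^ (e + 1) by
    obtain ⟨e, h, he, h0, hh⟩ := this S (hS ▸ Submodule.subset_span)
    refine ⟨e, h, he, h0, ?_⟩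
    change homogeneousSubmodule (Fin n) k d ≤
      (Submodule.span k (Set.range f) ^ (e + 1)).comap (LinearMap.mulLeft k h)
    rw [← hS, Submodule.span_le]
    exact hh
  intro T hT
  classical
  induction T using Finset.induction_on with
  | empty => exact ⟨0, 1, by simp [Submodule.one_le.1 le_rfl], one_ne_zero, by simp⟩
  | insert a T _ ih =>
    rw [Finset.coe_insert, Set.insert_subset_iff] at hT
    obtain ⟨e, h, he, h0, hh⟩ := ih hT.2
    obtain ⟨e', h', he', h0', hh'⟩ := H a hT.1
    refine ⟨e + e', h * h', ?_, mul_ne_zero h0 h0', fun u hu => ?_⟩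
    · rw [pow_add]
      exact Submodule.mul_mem_mul he he'
    · rcases Finset.mem_insert.1 hu with rfl | hu
      · rw [mul_assoc, add_assoc, pow_add]
        exact Submodule.mul_mem_mul he hh'
      · rw [mul_right_comm, add_right_comm, pow_add]
        exact Submodule.mul_mem_mul (hh u hu) he'

theorem exists_mul_homogeneousSubmodule_mul_le (hd : 1 ≤ d) (hf : ∀ i, (f i).IsHomogeneous d)
    {s : ℕ} (hs : idealOfVars (Fin n) k ^ s ≤ Ideal.span (Set.range f))
    (H : ∀ u : MvPolynomial (Fin n) k, u.IsHomogeneous d →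
      ∃ e, ∃ h ∈ Submodule.span k (Set.range f) ^ e, h ≠ 0 ∧
        h * u ∈ Submodule.span k (Set.range f) ^ (e + 1)) :
    ∃ e, ∃ h ∈ Submodule.span k (Set.range f) ^ e, h ≠ 0 ∧
      ∀ j, ∀ u ∈ homogeneousSubmodule (Fin n) k (d * j),
        h * u ∈ Submodule.span k (Set.range f) ^ (e + j) := by
  obtain ⟨e, h, he, h0, hh⟩ := exists_mul_homogeneousSubmodule_le H
  have key (j : ℕ) : ∀ u ∈ homogeneousSubmodule (Fin n) k (d * j),
      h ^ j * u ∈ Submodule.span k (Set.range f) ^ (e * j + j) := by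
    intro u hu
    rw [← homogeneousSubmodule_pow_eq] at hu
    induction hu using Submodule.pow_induction_on_left' with
    | algebraMap r => simp
    | add x y i _ _ hx hy => rw [mul_add]; exact add_mem hx hy
    | mem_mul m hm i x _ ih =>
      rw [pow_succ', mul_mul_mul_comm, show e * (i + 1) + (i + 1) = (e + 1) + (e * i + i) by ring,
        pow_add]
      exact Submodule.mul_mem_mul (hh m hm) ih
  have hpow (i : ℕ) : h ^ i ∈ Submodule.span k (Set.range f) ^ (e * i) := by
    rw [pow_mul]
    exact Submodule.pow_mem_pow _ he i
  refine ⟨e * s, h ^ s, hpow s, pow_ne_zero _ h0, fun j u hu => ?_⟩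
  rcases le_total j s with hj | hj
  · obtain ⟨i, rfl⟩ := Nat.exists_eq_add_of_le hj
    rw [show e * (j + i) + j = e * i + (e * j + j) by ring, pow_add _ (e * i), add_comm j i,
      pow_add h, mul_assoc]
    exact Submodule.mul_mem_mul (hpow i) (key j u hu)
  · obtain ⟨i, rfl⟩ := Nat.exists_eq_add_of_le hj
    rw [mul_add] at hu
    have := homogeneousSubmodule_add_mul_le hf hs (Nat.le_mul_of_pos_left s hd) i hu
    refine Submodule.mul_induction_on this ?_ ?_
    · intro a ha b hb
      rw [← mul_assoc, ← add_assoc, pow_add]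
      exact Submodule.mul_mem_mul (key s a ha) hb
    · intro a b ha hb
      rw [mul_add]
      exact add_mem ha hb

end Conductor

section Dimension

variable {k : Type*} [Field k] {n d : ℕ} {ι : Type*} {f : ι → MvPolynomial (Fin n) k}

theorem monomial_mem_reesAlgebra (i : ι) :
    Polynomial.monomial 1 (f i) ∈ reesAlgebra (Ideal.span (Set.range f)) :=
  reesAlgebra.monomial_mem.2 (by rw [pow_one]; exact Ideal.subset_span ⟨i, rfl⟩)

variable (f) in
/-- The map `k[T] → R[It]` sending `T_i` to `f_i t`, for `I` generated by the `f_i`. -/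
noncomputable def toRees :
    MvPolynomial ι k →ₐ[k] reesAlgebra (Ideal.span (Set.range f)) :=
  aeval fun i => ⟨Polynomial.monomial 1 (f i), monomial_mem_reesAlgebra i⟩

theorem coe_toRees (G : MvPolynomial ι k) :
    (toRees f G : Polynomial (MvPolynomial (Fin n) k)) =
      aeval (fun i => Polynomial.monomial 1 (f i)) G := by
  have : (((reesAlgebra (Ideal.span (Set.range f))).val.restrictScalars k).comp (toRees f)) =
      aeval (fun i => Polynomial.monomial 1 (f i)) := by
    ext i : 1
    simp [toRees]
  exact DFunLike.congr_fun this G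

theorem coeff_toRees (G : MvPolynomial ι k) (j : ℕ) :
    (toRees f G : Polynomial (MvPolynomial (Fin n) k)).coeff j =
      aeval f (homogeneousComponent j G) := by
  rw [coe_toRees]
  induction G using MvPolynomial.induction_on' with
  | add p q hp hq => simp only [map_add, Polynomial.coeff_add, hp, hq]
  | monomial u a =>
    have h1 : aeval (fun i => Polynomial.monomial 1 (f i)) (monomial u a) =
        Polynomial.monomial u.degree (aeval f (monomial u a)) := by
      simp only [aeval_monomial, Finsupp.prod, Polynomial.monomial_pow, one_mul]
      rw [IsScalarTower.algebraMap_apply k (MvPolynomial (Fin n) k)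
        (Polynomial (MvPolynomial (Fin n) k)), Polynomial.algebraMap_apply,
        Algebra.algebraMap_self_apply, Finsupp.degree_apply, ← Polynomial.C_mul_monomial]
      congr 1
      classical
      induction u.support using Finset.induction_on with
      | empty => simp
      | insert i t hi ih =>
        rw [Finset.prod_insert hi, Finset.sum_insert hi, Finset.prod_insert hi, ih,
          Polynomial.monomial_mul_monomial]
    rw [h1, Polynomial.coeff_monomial,
      homogeneousComponent_of_mem (isHomogeneous_monomial a rfl)]
    simp only [eq_comm]
    split_ifs <;> simp

theorem toRees_eq_zero (hd : 1 ≤ d) (hf : ∀ i, (f i).IsHomogeneous d) {G : MvPolynomial ι k}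
    (hG : aeval f G = 0) : toRees f G = 0 := by
  ext1
  ext1 j
  rw [coeff_toRees, ← homogeneousComponent_aeval hd hf, hG]
  simp

theorem mem_quotAnnihilator_of_monomial {I J : Ideal (MvPolynomial (Fin n) k)}
    (a : reesAlgebra I) {e : ℕ} {y : MvPolynomial (Fin n) k}
    (ha : (a : Polynomial (MvPolynomial (Fin n) k)) = Polynomial.monomial e y)
    (h : ∀ j, ∀ u ∈ J ^ j, y * u ∈ I ^ (e + j)) :
    a ∈ quotAnnihilator (reesAlgebra I) (reesAlgebra J) := by
  intro b hb
  rw [ha, mem_reesAlgebra_iff]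
  intro m
  rw [← Polynomial.C_mul_X_pow_eq_monomial, mul_assoc, Polynomial.coeff_C_mul,
    Polynomial.coeff_X_pow_mul']
  split_ifs with hm
  · obtain ⟨j, rfl⟩ := Nat.exists_eq_add_of_le hm
    rw [Nat.add_sub_cancel_left]
    exact h j _ (hb j)
  · simp

/-- The ideal of `R[It]` generated by the conductor into `R[m^d t]` and the variables. -/
noncomputable def conductorSup (I : Ideal (MvPolynomial (Fin n) k)) (d : ℕ) :
    Ideal (reesAlgebra I) :=
  quotAnnihilator (reesAlgebra I) (reesAlgebra (idealOfVars (Fin n) k ^ d)) ⊔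
    Ideal.span (Set.range fun i => algebraMap (MvPolynomial (Fin n) k) (reesAlgebra I) (X i))

theorem conductorSup_le_radical (hf : ∀ i, (f i).IsHomogeneous d) {s : ℕ}
    (hs : idealOfVars (Fin n) k ^ s ≤ Ideal.span (Set.range f)) :
    conductorSup (Ideal.span (Set.range f)) d ≤
      (quotAnnihilator (reesAlgebra (Ideal.span (Set.range f)))
        (reesAlgebra (idealOfVars (Fin n) k ^ d))).radical := by
  refine sup_le Ideal.le_radical ?_
  rw [Ideal.span_le]
  rintro _ ⟨i, rfl⟩
  refine ⟨s, ?_⟩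
  rw [← map_pow]
  refine mem_quotAnnihilator_of_monomial (e := 0) (y := X i ^ s) _ ?_ ?_
  · rw [Polynomial.monomial_zero_left]
    rfl
  · intro j u hu
    rw [zero_add]
    refine pow_idealOfVars_le hf hs j ?_
    rw [pow_add, pow_mul]
    exact Ideal.mul_mem_mul (Ideal.pow_mem_pow (Ideal.subset_span (Set.mem_range_self i)) s) hu

theorem ringKrullDim_quotient_conductorSup (hf : ∀ i, (f i).IsHomogeneous d) {s : ℕ}
    (hs : idealOfVars (Fin n) k ^ s ≤ Ideal.span (Set.range f)) :
    ringKrullDim (reesAlgebra (Ideal.span (Set.range f)) ⧸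
        quotAnnihilator (reesAlgebra (Ideal.span (Set.range f)))
          (reesAlgebra (idealOfVars (Fin n) k ^ d))) =
      ringKrullDim (reesAlgebra (Ideal.span (Set.range f)) ⧸
        conductorSup (Ideal.span (Set.range f)) d) := by
  rw [ringKrullDim_quotient, ringKrullDim_quotient]
  have h := le_antisymm (Ideal.radical_le_radical_iff.2 (conductorSup_le_radical hf hs))
    (Ideal.radical_mono (J := conductorSup (Ideal.span (Set.range f)) d) le_sup_left)
  rw [PrimeSpectrum.zeroLocus_eq_iff.2 h]

theorem mk_conductorSup_toRees_surjective :
    Function.Surjective ((Ideal.Quotient.mk (conductorSup (Ideal.span (Set.range f)) d)).comp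
      (toRees f : MvPolynomial ι k →+* reesAlgebra (Ideal.span (Set.range f)))) := by
  set I := Ideal.span (Set.range f) with hI
  set g := (Ideal.Quotient.mk (conductorSup I d)).comp
      (toRees f : MvPolynomial ι k →+* reesAlgebra I) with hg
  have hconst (r : MvPolynomial (Fin n) k) :
      ∃ G, g G = Ideal.Quotient.mk (conductorSup I d)
        (algebraMap (MvPolynomial (Fin n) k) (reesAlgebra I) r) := by
    induction r using MvPolynomial.induction_on with
    | C a =>
      refine ⟨C a, ?_⟩
      have : toRees f (C a) = algebraMap (MvPolynomial (Fin n) k) (reesAlgebra I) (C a) := by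
        rw [← algebraMap_eq, AlgHom.commutes]
        rfl
      simp [hg, this]
    | add p q hp hq =>
      obtain ⟨G, hG⟩ := hp
      obtain ⟨G', hG'⟩ := hq
      exact ⟨G + G', by rw [map_add, hG, hG', ← map_add, ← map_add]⟩
    | mul_X p i _ =>
      refine ⟨0, ?_⟩
      rw [map_zero, eq_comm, Ideal.Quotient.eq_zero_iff_mem, map_mul]
      exact Ideal.mul_mem_left _ _ (Ideal.mem_sup_right (Ideal.subset_span ⟨i, rfl⟩))
  have hmon (r : MvPolynomial (Fin n) k)
      (hr : r ∈ Submodule.span (MvPolynomial (Fin n) k) (Set.range f)) :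
      ∃ hr' : Polynomial.monomial 1 r ∈ reesAlgebra I,
        ∃ G, g G = Ideal.Quotient.mk (conductorSup I d) ⟨Polynomial.monomial 1 r, hr'⟩ := by
    refine ⟨reesAlgebra.monomial_mem.2 (by rwa [pow_one]), ?_⟩
    induction hr using Submodule.span_induction with
    | mem r hr =>
      obtain ⟨i, rfl⟩ := hr
      refine ⟨X i, ?_⟩
      rw [hg, RingHom.comp_apply]
      congr 1
      ext1
      simp [toRees]
    | zero =>
      refine ⟨0, ?_⟩
      rw [map_zero, eq_comm, Ideal.Quotient.eq_zero_iff_mem]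
      simp_rw [map_zero]
      exact zero_mem _
    | add x y hx hy ihx ihy =>
      obtain ⟨G, hG⟩ := ihx
      obtain ⟨G', hG'⟩ := ihy
      refine ⟨G + G', ?_⟩
      rw [map_add, hG, hG', ← map_add]
      congr 1
      ext1
      simp
    | smul a x hx ih =>
      obtain ⟨G, hG⟩ := ih
      obtain ⟨G', hG'⟩ := hconst a
      refine ⟨G' * G, ?_⟩
      rw [map_mul, hG, hG', ← map_mul]
      congr 1
      ext1
      change Polynomial.C a * Polynomial.monomial 1 x = Polynomial.monomial 1 (a • x)
      rw [Polynomial.C_mul_monomial, smul_eq_mul]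
  suffices ∀ y (hy : y ∈ Algebra.adjoin (MvPolynomial (Fin n) k) ((Submodule.map
      (Polynomial.monomial 1 : MvPolynomial (Fin n) k →ₗ[MvPolynomial (Fin n) k]
        Polynomial (MvPolynomial (Fin n) k)) I : Submodule _ _) : Set _)),
      ∃ hy' : y ∈ reesAlgebra I, ∃ G, g G = Ideal.Quotient.mk (conductorSup I d) ⟨y, hy'⟩ by
    intro q
    obtain ⟨⟨y, hy⟩, rfl⟩ := Ideal.Quotient.mk_surjective q
    obtain ⟨_, G, hG⟩ := this y (by rwa [adjoin_monomial_eq_reesAlgebra])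
    exact ⟨G, hG⟩
  intro y hy
  induction hy using Algebra.adjoin_induction with
  | mem y hy =>
    obtain ⟨r, hr, rfl⟩ := hy
    exact hmon r hr
  | algebraMap r => exact ⟨Subalgebra.algebraMap_mem _ r, hconst r⟩
  | add x y _ _ hx hy =>
    obtain ⟨hx, G, hG⟩ := hx
    obtain ⟨hy, G', hG'⟩ := hy
    refine ⟨add_mem hx hy, G + G', ?_⟩
    rw [map_add, hG, hG', ← map_add]
    rfl
  | mul x y _ _ hx hy =>
    obtain ⟨hx, G, hG⟩ := hx
    obtain ⟨hy, G', hG'⟩ := hy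
    refine ⟨mul_mem hx hy, G * G', ?_⟩
    rw [map_mul, hG, hG', ← map_mul]
    rfl

theorem exists_aeval_eq_zero (f : Fin (n + 1) → MvPolynomial (Fin n) k) :
    ∃ G : MvPolynomial (Fin (n + 1)) k, G ≠ 0 ∧ aeval f G = 0 := by
  by_contra! h
  have hf : AlgebraicIndependent k f :=
    algebraicIndependent_iff.2 fun p hp => by_contra fun h0 => h p h0 hp
  have := hf.lift_cardinalMk_le_trdeg
  rw [MvPolynomial.trdeg_of_isDomain] at this
  simp only [Cardinal.mk_fin, Cardinal.lift_natCast, Nat.cast_le] at this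
  omega

theorem ringKrullDim_mvPolynomial_fin (m : ℕ) :
    ringKrullDim (MvPolynomial (Fin m) k) = m := by
  rw [MvPolynomial.ringKrullDim_of_isNoetherianRing, ringKrullDim_eq_zero_of_field]
  simp

theorem ringKrullDim_quotient_quotAnnihilator_le {f : Fin (n + 1) → MvPolynomial (Fin n) k}
    (hd : 1 ≤ d) (hf : ∀ i, (f i).IsHomogeneous d) {s : ℕ}
    (hs : idealOfVars (Fin n) k ^ s ≤ Ideal.span (Set.range f)) :
    ringKrullDim (reesAlgebra (Ideal.span (Set.range f)) ⧸
        quotAnnihilator (reesAlgebra (Ideal.span (Set.range f)))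
          (reesAlgebra (idealOfVars (Fin n) k ^ d))) ≤ n := by
  rw [ringKrullDim_quotient_conductorSup hf hs]
  obtain ⟨G, h0, hG⟩ := exists_aeval_eq_zero f
  have hker : ((Ideal.Quotient.mk (conductorSup (Ideal.span (Set.range f)) d)).comp
      (toRees f : MvPolynomial (Fin (n + 1)) k →+* reesAlgebra (Ideal.span (Set.range f)))) G =
      0 := by
    rw [RingHom.comp_apply]
    erw [toRees_eq_zero hd hf hG]
    exact map_zero _
  have hnz : G ∈ nonZeroDivisors (MvPolynomial (Fin (n + 1)) k) :=
    mem_nonZeroDivisors_of_ne_zero h0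
  have := ringKrullDim_succ_le_of_surjective (R := MvPolynomial (Fin (n + 1)) k)
    (S := reesAlgebra (Ideal.span (Set.range f)) ⧸ conductorSup (Ideal.span (Set.range f)) d)
    ((Ideal.Quotient.mk (conductorSup (Ideal.span (Set.range f)) d)).comp
      (toRees f : MvPolynomial (Fin (n + 1)) k →+* reesAlgebra (Ideal.span (Set.range f))))
    mk_conductorSup_toRees_surjective hnz hker
  rw [ringKrullDim_mvPolynomial_fin, Nat.cast_add, Nat.cast_one] at this
  exact ENat.WithBot.add_le_add_one_right_iff.1 this

end Dimension

section Birational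

variable {k : Type*} [Field k] {n d : ℕ} {ι : Type*} {f : ι → MvPolynomial (Fin n) k}

theorem mul_mem_pow_of_forall_mul_mem {h : MvPolynomial (Fin n) k} {e : ℕ}
    (hh : ∀ j, ∀ u ∈ homogeneousSubmodule (Fin n) k (d * j),
      h * u ∈ Submodule.span k (Set.range f) ^ (e + j)) (j : ℕ) {u : MvPolynomial (Fin n) k}
    (hu : u ∈ (idealOfVars (Fin n) k ^ d) ^ j) :
    h * u ∈ Ideal.span (Set.range f) ^ (e + j) := by
  rw [← pow_mul, pow_idealOfVars_eq_span_homogeneousSubmodule] at hu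
  induction hu using Submodule.span_induction with
  | mem u hu => exact mem_pow_of_mem_span_pow (hh j u hu)
  | zero => simp
  | add x y _ _ hx hy => rw [mul_add]; exact add_mem hx hy
  | smul a x _ ih => rw [mul_smul_comm]; exact Submodule.smul_mem _ a ih

theorem ringKrullDim_quotient_add_one_le {f : Fin (n + 1) → MvPolynomial (Fin n) k}
    (hd : 1 ≤ d) (hf : ∀ i, (f i).IsHomogeneous d) {s : ℕ}
    (hs : idealOfVars (Fin n) k ^ s ≤ Ideal.span (Set.range f))
    {e : ℕ} {h : MvPolynomial (Fin n) k} (he : h ∈ Submodule.span k (Set.range f) ^ e)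
    (h0 : h ≠ 0) (hh : ∀ j, ∀ u ∈ homogeneousSubmodule (Fin n) k (d * j),
      h * u ∈ Submodule.span k (Set.range f) ^ (e + j)) :
    ringKrullDim (reesAlgebra (Ideal.span (Set.range f)) ⧸
        quotAnnihilator (reesAlgebra (Ideal.span (Set.range f)))
          (reesAlgebra (idealOfVars (Fin n) k ^ d))) + 1 ≤ n := by
  rw [ringKrullDim_quotient_conductorSup hf hs]
  obtain ⟨G, hG0, hG⟩ := exists_aeval_eq_zero f
  rw [← map_aeval_homogeneousSubmodule] at he
  obtain ⟨h', hh', rfl⟩ := he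
  set J := conductorSup (Ideal.span (Set.range f)) d with hJ
  set P := RingHom.ker (aeval f : MvPolynomial (Fin (n + 1)) k →ₐ[k] MvPolynomial (Fin n) k)
    with hP
  set g : MvPolynomial (Fin (n + 1)) k →+* reesAlgebra (Ideal.span (Set.range f)) ⧸ J :=
    (Ideal.Quotient.mk J).comp
      (toRees f : MvPolynomial (Fin (n + 1)) k →+* reesAlgebra (Ideal.span (Set.range f))) with hg
  have hgP : ∀ a ∈ P, g a = 0 := by
    intro a ha
    have : toRees f a = 0 := toRees_eq_zero hd hf ha
    change Ideal.Quotient.mk J (toRees f a) = 0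
    rw [this, map_zero]
  have hmem : toRees f h' ∈ J := by
    refine Ideal.mem_sup_left (mem_quotAnnihilator_of_monomial (e := e) (y := aeval f h') _ ?_
      fun j u hu => mul_mem_pow_of_forall_mul_mem hh j hu)
    ext1 j
    rw [coeff_toRees, Polynomial.coeff_monomial, homogeneousComponent_of_mem hh']
    simp only [eq_comm]
    split_ifs <;> simp
  have h1 : ringKrullDim (MvPolynomial (Fin (n + 1)) k ⧸ P) ≤ n := by
    have hnz : G ∈ nonZeroDivisors (MvPolynomial (Fin (n + 1)) k) :=
      mem_nonZeroDivisors_of_ne_zero hG0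
    have := ringKrullDim_succ_le_of_surjective (R := MvPolynomial (Fin (n + 1)) k)
      (S := MvPolynomial (Fin (n + 1)) k ⧸ P) (Ideal.Quotient.mk P) Ideal.Quotient.mk_surjective
      hnz (Ideal.Quotient.eq_zero_iff_mem.2 hG)
    rw [ringKrullDim_mvPolynomial_fin, Nat.cast_add, Nat.cast_one] at this
    exact ENat.WithBot.add_le_add_one_right_iff.1 this
  refine le_trans ?_ h1
  have hprime : P.IsPrime := RingHom.ker_isPrime _
  have hnz : Ideal.Quotient.mk P h' ∈ nonZeroDivisors (MvPolynomial (Fin (n + 1)) k ⧸ P) := by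
    refine mem_nonZeroDivisors_of_ne_zero fun h => h0 ?_
    exact Ideal.Quotient.eq_zero_iff_mem.1 h
  refine ringKrullDim_succ_le_of_surjective (R := MvPolynomial (Fin (n + 1)) k ⧸ P)
    (S := reesAlgebra (Ideal.span (Set.range f)) ⧸ J) (Ideal.Quotient.lift P g hgP)
    (Ideal.Quotient.lift_surjective_of_surjective P hgP mk_conductorSup_toRees_surjective)
    hnz ?_
  rw [Ideal.Quotient.lift_mk]
  exact Ideal.Quotient.eq_zero_iff_mem.2 hmem

theorem ringKrullDim_le_of_isIntegral {A B : Type*} [CommRing A] [CommRing B] (g : A →+* B)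
    (hg : g.IsIntegral) : ringKrullDim B ≤ ringKrullDim A := by
  let _ := g.toAlgebra
  have : Algebra.IsIntegral A B := ⟨hg⟩
  refine Order.krullDim_le_of_strictMono (PrimeSpectrum.comap g) fun p q hpq => ?_
  have := p.2
  exact Ideal.IsIntegral.comap_lt_comap (R := A) (I := p.asIdeal) (J := q.asIdeal) hpq

theorem aeval_isIntegral [Finite ι] (hd : 1 ≤ d) (hf : ∀ i, (f i).IsHomogeneous d) {s : ℕ}
    (hs : idealOfVars (Fin n) k ^ s ≤ Ideal.span (Set.range f)) :
    (aeval f : MvPolynomial ι k →ₐ[k] MvPolynomial (Fin n) k).toRingHom.IsIntegral := by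
  set A := (aeval f : MvPolynomial ι k →ₐ[k] MvPolynomial (Fin n) k).range with hA
  set U : Submodule k (MvPolynomial (Fin n) k) :=
    ⨆ m : Fin (s + d), homogeneousSubmodule (Fin n) k m with hU
  have hfg : U.FG := Submodule.fg_iSup _ fun m => Module.Finite.iff_fg.1 inferInstance
  set W : Submodule A (MvPolynomial (Fin n) k) := Submodule.span A (U : Set _) with hW
  have hmem (m : ℕ) : ∀ p ∈ homogeneousSubmodule (Fin n) k m, p ∈ W := by
    induction m using Nat.strong_induction_on with
    | _ m ih =>
      intro p hp
      by_cases hm : m < s + d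
      · exact Submodule.subset_span (Submodule.mem_iSup_of_mem (⟨m, hm⟩ : Fin (s + d)) hp)
      · obtain ⟨N, rfl⟩ := Nat.exists_eq_add_of_le' (show d ≤ m by omega)
        refine Submodule.mul_induction_on (homogeneousSubmodule_add_le hf hs (by omega) hp) ?_
          fun a b ha hb => add_mem ha hb
        intro a ha b hb
        rw [mul_comm]
        have hbA : b ∈ A := by
          rw [hA, ← Algebra.adjoin_range_eq_range_aeval]
          exact mem_adjoin_of_mem_span_pow (j := 1) (by rwa [pow_one])
        exact W.smul_mem ⟨b, hbA⟩ (ih N (by omega) a ha)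
  have htop : W = ⊤ := by
    rw [eq_top_iff]
    intro p _
    rw [← sum_homogeneousComponent p]
    exact sum_mem fun m _ => hmem m _ (homogeneousComponent_mem m p)
  have : Module.Finite A (MvPolynomial (Fin n) k) := by
    obtain ⟨S, hS⟩ := hfg
    refine ⟨⟨S, ?_⟩⟩
    rw [← htop, hW, ← hS, Submodule.span_span_of_tower]
  have h1 : A.val.toRingHom.IsIntegral := fun x => Algebra.IsIntegral.isIntegral (R := A) x
  exact RingHom.IsIntegral.trans _ _ (RingHom.isIntegral_of_surjective _
    (aeval f : MvPolynomial ι k →ₐ[k] MvPolynomial (Fin n) k).rangeRestrict_surjective) h1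

/-- The additive map `R[t] → R` sending `y t^j` to the component of `y` of degree `d * j`. -/
noncomputable def leadingForm (k : Type*) [Field k] (n d : ℕ) :
    Polynomial (MvPolynomial (Fin n) k) →+ MvPolynomial (Fin n) k where
  toFun y := y.sum fun j c => homogeneousComponent (d * j) c
  map_zero' := by simp
  map_add' y z := Polynomial.sum_add_index _ _ _ (by simp) (by simp)

theorem leadingForm_monomial (j : ℕ) (c : MvPolynomial (Fin n) k) :
    leadingForm k n d (Polynomial.monomial j c) = homogeneousComponent (d * j) c :=
  Polynomial.sum_monomial_index _ _ (by simp)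

theorem leadingForm_mul (hf : ∀ i, (f i).IsHomogeneous d)
    {y z : Polynomial (MvPolynomial (Fin n) k)} (hy : y ∈ reesAlgebra (Ideal.span (Set.range f)))
    (hz : z ∈ reesAlgebra (Ideal.span (Set.range f))) :
    leadingForm k n d (y * z) = leadingForm k n d y * leadingForm k n d z := by
  rw [Polynomial.mul_eq_sum_sum, map_sum]
  simp_rw [Polynomial.sum_def, map_sum, leadingForm_monomial]
  change _ = (y.sum _) * (z.sum _)
  rw [Polynomial.sum_def, Polynomial.sum_def, Finset.sum_mul_sum]
  refine Finset.sum_congr rfl fun i _ => Finset.sum_congr rfl fun j _ => ?_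
  rw [mul_add]
  exact homogeneousComponent_mul (ideal_span_pow_le_pow hf i (hy i))
    (ideal_span_pow_le_pow hf j (hz j))

/-- The restriction of `leadingForm` to the Rees algebra, as a ring homomorphism. -/
noncomputable def reesLeadingForm (hf : ∀ i, (f i).IsHomogeneous d) :
    reesAlgebra (Ideal.span (Set.range f)) →+* MvPolynomial (Fin n) k where
  toFun y := leadingForm k n d y
  map_zero' := map_zero _
  map_add' y z := map_add (leadingForm k n d) y.1 z.1
  map_one' := by
    change leadingForm k n d (Polynomial.monomial 0 1) = 1
    rw [leadingForm_monomial, homogeneousComponent_of_mem (isHomogeneous_one _ _)]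
    simp
  map_mul' y z := leadingForm_mul hf y.2 z.2

theorem reesLeadingForm_comp_toRees (hf : ∀ i, (f i).IsHomogeneous d) :
    (reesLeadingForm hf).comp
      (toRees f : MvPolynomial ι k →+* reesAlgebra (Ideal.span (Set.range f))) =
      (aeval f : MvPolynomial ι k →ₐ[k] MvPolynomial (Fin n) k).toRingHom := by
  refine MvPolynomial.ringHom_ext (fun a => ?_) fun i => ?_
  · change leadingForm k n d (toRees f (C a)) = aeval f (C a)
    have : (toRees f (C a) : Polynomial (MvPolynomial (Fin n) k)) =
        Polynomial.monomial 0 (C a) := by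
      rw [coe_toRees, ← algebraMap_eq, AlgHom.commutes]
      rfl
    rw [this, leadingForm_monomial, aeval_C, homogeneousComponent_of_mem (isHomogeneous_C _ a)]
    simp
  · change leadingForm k n d (toRees f (X i)) = aeval f (X i)
    rw [coe_toRees, aeval_X, aeval_X, leadingForm_monomial,
      homogeneousComponent_of_mem (hf i), mul_one, if_pos rfl]

theorem exists_mul_mem_of_ringKrullDim_lt [Finite ι] (hd : 1 ≤ d)
    (hf : ∀ i, (f i).IsHomogeneous d) {s : ℕ}
    (hs : idealOfVars (Fin n) k ^ s ≤ Ideal.span (Set.range f))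
    (hdim : ringKrullDim (reesAlgebra (Ideal.span (Set.range f)) ⧸
        quotAnnihilator (reesAlgebra (Ideal.span (Set.range f)))
          (reesAlgebra (idealOfVars (Fin n) k ^ d))) < n)
    (u : MvPolynomial (Fin n) k) (hu : u.IsHomogeneous d) :
    ∃ e, ∃ h ∈ Submodule.span k (Set.range f) ^ e, h ≠ 0 ∧
      h * u ∈ Submodule.span k (Set.range f) ^ (e + 1) := by
  set I := Ideal.span (Set.range f) with hI
  have hint : (reesLeadingForm hf).IsIntegral := by
    refine RingHom.IsIntegral.tower_top (toRees f : MvPolynomial ι k →+* reesAlgebra I) _ ?_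
    rw [reesLeadingForm_comp_toRees]
    exact aeval_isIntegral hd hf hs
  have hex : ∃ c ∈ quotAnnihilator (reesAlgebra I) (reesAlgebra (idealOfVars (Fin n) k ^ d)),
      reesLeadingForm hf c ≠ 0 := by
    by_contra! hc
    have := ringKrullDim_le_of_isIntegral (Ideal.Quotient.lift _ (reesLeadingForm hf) hc)
      (RingHom.IsIntegral.tower_top (Ideal.Quotient.mk _) _ (by rwa [Ideal.Quotient.lift_comp_mk]))
    rw [ringKrullDim_mvPolynomial_fin] at this
    exact absurd hdim (not_lt.2 this)
  obtain ⟨c, hc, hc0⟩ := hex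
  obtain ⟨e, _, he⟩ := Finset.exists_ne_zero_of_sum_ne_zero hc0
  refine ⟨e, _, homogeneousComponent_mem_span_pow hf (c.2 e), he, ?_⟩
  rw [← homogeneousComponent_mul_right hu]
  refine homogeneousComponent_mem_span_pow (j := e + 1) hf ?_
  have h1 := hc (Polynomial.monomial 1 u) (reesAlgebra.monomial_mem.2
    (by rw [pow_one]; exact homogeneousSubmodule_le_pow d hu)) (e + 1)
  rwa [← Polynomial.C_mul_X_eq_monomial, ← mul_assoc, Polynomial.coeff_mul_X,
    Polynomial.coeff_mul_C] at h1

end Birational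

section Growth

open Filter in
theorem degree_le_of_abs_eval_le {T : Polynomial ℚ} {m N : ℕ} {C : ℚ}
    (h : ∀ j : ℕ, N ≤ j → |T.eval (j : ℚ)| ≤ C * ((j : ℚ) + 1) ^ m) : T.degree ≤ m := by
  by_contra! hT
  have hmonic : ((Polynomial.X + Polynomial.C 1 : Polynomial ℚ) ^ m).Monic :=
    (Polynomial.monic_X_add_C 1).pow m
  have hdeg : ((Polynomial.X + Polynomial.C 1 : Polynomial ℚ) ^ m).degree = m := by
    rw [Polynomial.degree_pow, Polynomial.degree_X_add_C]
    simp
  have h1 := (Polynomial.abs_div_tendsto_atTop_atTop_of_degree_gt T _ (hdeg ▸ hT)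
    hmonic.ne_zero).comp (tendsto_natCast_atTop_atTop (R := ℚ))
  obtain ⟨j, hj, hjN⟩ := ((h1.eventually_gt_atTop C).and (eventually_ge_atTop N)).exists
  have hpos : (0 : ℚ) < ((j : ℚ) + 1) ^ m := by positivity
  have h2 := h j hjN
  simp only [Function.comp_apply, Polynomial.eval_pow, Polynomial.eval_add, Polynomial.eval_X,
    Polynomial.eval_C, abs_div, abs_of_pos hpos] at hj
  rw [lt_div_iff₀ hpos] at hj
  exact absurd h2 (not_le.2 hj)

open Filter in
theorem not_degree_lt_of_pow_le_eval {T : Polynomial ℚ} {m N : ℕ} {C : ℚ}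
    (h : ∀ j : ℕ, N ≤ j → (j : ℚ) ^ m ≤ C * T.eval (j : ℚ)) : ¬ T.degree < m := by
  intro hT
  have hdeg : (Polynomial.X ^ m : Polynomial ℚ).degree = m := Polynomial.degree_X_pow m
  have h1 := ((Polynomial.div_tendsto_atTop_zero_of_degree_lt T _ (hdeg ▸ hT)).comp
    (tendsto_natCast_atTop_atTop (R := ℚ))).const_mul C
  rw [mul_zero] at h1
  obtain ⟨j, hj, hjN⟩ := ((h1.eventually_lt_const zero_lt_one).and
    (eventually_ge_atTop (N + 1))).exists
  have hj0 : (0 : ℚ) < j := by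
    exact_mod_cast (show 0 < j by omega)
  have hpos : (0 : ℚ) < (j : ℚ) ^ m := by positivity
  have h2 := h j (by omega)
  simp only [Function.comp_apply, Polynomial.eval_pow, Polynomial.eval_X] at hj
  rw [← mul_div_assoc, div_lt_one hpos] at hj
  exact absurd h2 (not_le.2 hj)

/-- The polynomial `t(t+1)⋯(t+m−1)/m!`. -/
noncomputable def risingBinomial (m : ℕ) : Polynomial ℚ :=
  Polynomial.C ((m.factorial : ℚ)⁻¹) * ascPochhammer ℚ m

theorem risingBinomial_eval (m j : ℕ) :
    (risingBinomial m).eval (j : ℚ) = ((j + m - 1).choose m : ℚ) := by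
  rw [risingBinomial, Polynomial.eval_C_mul, ← ascPochhammer_eval_cast,
    ascPochhammer_nat_eq_ascFactorial, Nat.ascFactorial_eq_factorial_mul_choose', Nat.cast_mul,
    inv_mul_cancel_left₀ (by positivity)]

theorem degree_risingBinomial (m : ℕ) : (risingBinomial m).degree = m := by
  rw [risingBinomial, Polynomial.degree_C_mul (by positivity),
    Polynomial.degree_eq_natDegree (monic_ascPochhammer ℚ m).ne_zero, ascPochhammer_natDegree]

theorem degree_add_C_mul_lt_iff {P Q : Polynomial ℚ} {m : ℕ} (hP : P.degree = m)
    (hQ : Q.degree < m) {b : ℚ} : (Polynomial.C b * P + Q).degree < m ↔ b = 0 := by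
  constructor
  · intro h
    by_contra hb
    have h1 : (Polynomial.C b * P).degree = m := by rw [Polynomial.degree_C_mul hb, hP]
    rw [Polynomial.degree_add_eq_left_of_degree_lt (h1 ▸ hQ), h1] at h
    exact lt_irrefl _ h
  · rintro rfl
    simpa using hQ

theorem exists_polynomial_of_hilbert {n N : ℕ} {a b : ℚ} {Q : Polynomial ℚ} (hQ : Q.degree < n)
    {δ : ℕ → ℕ} (h : ∀ m ≥ N, (δ m : ℚ) = a * ((m + n).choose (n + 1) : ℚ) -
      b * ((m + n - 1).choose n : ℚ) + Q.eval (m : ℚ)) :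
    ∃ T : Polynomial ℚ, (∀ m ≥ N, T.eval (m : ℚ) = δ m) ∧
      (T.degree ≤ n → (T.degree < n ↔ b = 0)) := by
  set S := Polynomial.C (-b) * risingBinomial n + Q with hS
  have hSdeg : S.degree < (n + 1 : ℕ) := by
    refine lt_of_le_of_lt (Polynomial.degree_add_le _ _) (max_lt ?_ (hQ.trans ?_))
    · rw [Polynomial.C_mul']
      refine lt_of_le_of_lt (Polynomial.degree_smul_le _ _) ?_
      rw [degree_risingBinomial]
      exact_mod_cast n.lt_succ_self
    · exact_mod_cast n.lt_succ_self
  refine ⟨Polynomial.C a * risingBinomial (n + 1) + S, fun m hm => ?_, fun hT => ?_⟩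
  · rw [h m hm, Polynomial.eval_add, Polynomial.eval_add, Polynomial.eval_C_mul,
      Polynomial.eval_C_mul, risingBinomial_eval, risingBinomial_eval]
    simp only [← add_assoc, Nat.add_sub_cancel]
    ring
  · have ha : a = 0 := (degree_add_C_mul_lt_iff (degree_risingBinomial (n + 1)) hSdeg).1
      (hT.trans_lt (by exact_mod_cast n.lt_succ_self))
    rw [ha, map_zero, zero_mul, zero_add, degree_add_C_mul_lt_iff (degree_risingBinomial n) hQ,
      neg_eq_zero]

theorem multichoose_succ_le_pow (m N : ℕ) : (m + 1).multichoose N ≤ (N + m) ^ m := by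
  rw [Nat.multichoose_eq, show m + 1 + N - 1 = N + m by omega,
    Nat.choose_symm_add (a := N) (b := m)]
  exact Nat.choose_le_pow _ _

theorem multichoose_mul_le_pow (m N : ℕ) : m.multichoose N * N ≤ (N + m) ^ m := by
  cases m with
  | zero => cases N <;> simp
  | succ m =>
    calc (m + 1).multichoose N * N ≤ (N + m) ^ m * (N + (m + 1)) :=
          Nat.mul_le_mul (multichoose_succ_le_pow m N) (by omega)
      _ ≤ (N + (m + 1)) ^ m * (N + (m + 1)) := by gcongr; omega
      _ = _ := (pow_succ _ _).symm

theorem multichoose_succ_add_mul_le {m N j : ℕ} (hj : j ≤ N) (t : ℕ) :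
    (m + 1).multichoose (N + t) * j ≤ (m + 1).multichoose N * j + t * (N + t + m) ^ m := by
  induction t with
  | zero => simp
  | succ t ih =>
    have h1 : m.multichoose (N + t + 1) * j ≤ (N + t + 1 + m) ^ m :=
      le_trans (Nat.mul_le_mul_left _ (by omega)) (multichoose_mul_le_pow m (N + t + 1))
    have h2 : (N + t + m) ^ m ≤ (N + t + 1 + m) ^ m := Nat.pow_le_pow_left (by omega) m
    calc (m + 1).multichoose (N + (t + 1)) * j
        = m.multichoose (N + t + 1) * j + (m + 1).multichoose (N + t) * j := by
          rw [← add_assoc, Nat.multichoose_succ_succ, add_mul]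
      _ ≤ (N + t + 1 + m) ^ m + ((m + 1).multichoose N * j + t * (N + t + m) ^ m) :=
          Nat.add_le_add h1 ih
      _ ≤ (N + t + 1 + m) ^ m + ((m + 1).multichoose N * j + t * (N + t + 1 + m) ^ m) :=
          Nat.add_le_add_left (Nat.add_le_add_left (Nat.mul_le_mul_left _ h2) _) _
      _ = _ := by ring

theorem pow_le_factorial_mul_multichoose (m N : ℕ) :
    (N + 1) ^ m ≤ m.factorial * (m + 1).multichoose N := by
  have := Nat.pow_succ_le_ascFactorial (N + 1) m
  rwa [Nat.ascFactorial_eq_factorial_mul_choose', show N + 1 + m - 1 = N + m by omega,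
    ← Nat.choose_symm_add, show N + m = m + 1 + N - 1 by omega, ← Nat.multichoose_eq] at this

theorem degree_le_of_le_sum {n d s N : ℕ} {δ : ℕ → ℕ} {T : Polynomial ℚ}
    (hT : ∀ m ≥ N, T.eval (m : ℚ) = δ m)
    (h : ∀ j, δ j ≤ ∑ i : Fin s, (n + 1).multichoose (d * j + i)) : T.degree ≤ n := by
  refine degree_le_of_abs_eval_le (N := N) (C := ((s * (d + s + n) ^ n : ℕ) : ℚ)) fun j hj => ?_
  rw [hT j hj, Nat.abs_cast]
  have : δ j ≤ s * (d + s + n) ^ n * (j + 1) ^ n := by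
    calc δ j ≤ ∑ i : Fin s, (n + 1).multichoose (d * j + i) := h j
      _ ≤ ∑ _i : Fin s, ((d + s + n) * (j + 1)) ^ n := by
        refine Finset.sum_le_sum fun i _ => (multichoose_succ_le_pow n _).trans ?_
        gcongr
        nlinarith [i.2, Nat.zero_le (s * j), Nat.zero_le (n * j)]
      _ = _ := by simp [mul_pow, mul_assoc]
  exact_mod_cast this

theorem degree_lt_of_add_sum_le {n d s e N : ℕ} {δ : ℕ → ℕ} {T : Polynomial ℚ} (hd : 1 ≤ d)
    (hT : ∀ m ≥ N, T.eval (m : ℚ) = δ m)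
    (h : ∀ j, δ (j + e) + ∑ i : Fin s, (n + 1).multichoose (d * j + i) ≤
      ∑ i : Fin s, (n + 1).multichoose (d * (j + e) + i)) : T.degree < n := by
  have key (j : ℕ) : j * δ (j + e) ≤ s * (d * e * (d + s + d * e + n) ^ n) * (j + 1) ^ n := by
    set K := d * e * (d + s + d * e + n) ^ n * (j + 1) ^ n with hK
    have hterm (i : Fin s) : (n + 1).multichoose (d * (j + e) + i) * j ≤
        (n + 1).multichoose (d * j + i) * j + K := by
      have h1 := multichoose_succ_add_mul_le (m := n)
        (show j ≤ d * j + i from le_add_right (Nat.le_mul_of_pos_left j hd)) (d * e)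
      rw [show d * (j + e) + i = d * j + i + d * e by ring]
      refine h1.trans (Nat.add_le_add_left ?_ _)
      rw [hK, mul_assoc (d * e), ← mul_pow]
      refine Nat.mul_le_mul_left _ (Nat.pow_le_pow_left ?_ _)
      nlinarith [i.2, Nat.zero_le (s * j), Nat.zero_le (n * j), Nat.zero_le (d * e * j)]
    have hsum := Nat.mul_le_mul_right j (h j)
    rw [add_mul, Finset.sum_mul, Finset.sum_mul] at hsum
    have hsum' := hsum.trans (Finset.sum_le_sum fun i _ => hterm i)
    rw [Finset.sum_add_distrib, Finset.sum_const, Finset.card_univ, Fintype.card_fin,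
      smul_eq_mul, hK, ← mul_assoc] at hsum'
    linarith
  have hdeg : ((Polynomial.X - Polynomial.C (e : ℚ)) * T).degree ≤ (n : WithBot ℕ) := by
    refine degree_le_of_abs_eval_le (N := N + e)
      (C := ((s * (d * e * (d + s + d * e + n) ^ n) : ℕ) : ℚ)) fun m hm => ?_
    obtain ⟨j, rfl⟩ := Nat.exists_eq_add_of_le' (show e ≤ m by omega)
    rw [Polynomial.eval_mul, hT _ (by omega), Polynomial.eval_sub, Polynomial.eval_X,
      Polynomial.eval_C, Nat.cast_add, add_sub_cancel_right, ← Nat.cast_mul, Nat.abs_cast]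
    have h2 := (key j).trans (Nat.mul_le_mul_left _ (Nat.pow_le_pow_left
      (show j + 1 ≤ j + e + 1 by omega) n))
    exact_mod_cast h2
  rw [Polynomial.degree_mul, Polynomial.degree_X_sub_C] at hdeg
  rcases eq_or_ne T 0 with rfl | hT0
  · rw [Polynomial.degree_zero]
    exact WithBot.bot_lt_coe n
  · rw [Polynomial.degree_eq_natDegree hT0] at hdeg ⊢
    have : 1 + T.natDegree ≤ n := by exact_mod_cast hdeg
    exact_mod_cast (show T.natDegree < n by omega)

theorem not_degree_lt_of_le_mul {n d s c N : ℕ} {δ : ℕ → ℕ} {T : Polynomial ℚ} (hd : 1 ≤ d)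
    (hT : ∀ m ≥ N, T.eval (m : ℚ) = δ m)
    (h : ∀ j, (n + 1).multichoose (s + d * j) ≤ δ (j + 1) * c) : ¬ T.degree < n := by
  refine not_degree_lt_of_pow_le_eval (N := N + 1) (C := ((n.factorial * c : ℕ) : ℚ))
    fun j hj => ?_
  rw [hT j (by omega)]
  obtain ⟨j, rfl⟩ := Nat.exists_eq_add_of_le' (show 1 ≤ j by omega)
  have : (j + 1) ^ n ≤ n.factorial * c * δ (j + 1) := by
    calc (j + 1) ^ n ≤ (s + d * j + 1) ^ n := by gcongr; nlinarith
      _ ≤ n.factorial * (n + 1).multichoose (s + d * j) := pow_le_factorial_mul_multichoose n _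
      _ ≤ n.factorial * (δ (j + 1) * c) := by gcongr; exact h j
      _ = _ := by ring
  exact_mod_cast this

end Growth

section Length

theorem length_quotient_eq_add {S : Type*} [CommRing S] {I J : Ideal S} (h : I ≤ J) :
    Module.length S (S ⧸ I) =
      Module.length S (Submodule.map I.mkQ J) + Module.length S (S ⧸ J) := by
  refine Module.length_eq_add_of_exact (Submodule.map I.mkQ J).subtype (Submodule.factor h)
    (Submodule.subtype_injective _) (Submodule.factor_surjective h) ?_
  rw [LinearMap.exact_iff, Submodule.range_subtype]
  ext x
  obtain ⟨p, rfl⟩ := I.mkQ_surjective x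
  have h1 : Submodule.factor h (I.mkQ p) = J.mkQ p := rfl
  rw [LinearMap.mem_ker, h1, Submodule.mkQ_apply, Submodule.Quotient.mk_eq_zero]
  constructor
  · exact fun hp => Submodule.mem_map_of_mem hp
  · rintro ⟨q, hq, hqp⟩
    have := h ((Submodule.Quotient.eq I).1 hqp)
    simpa using J.sub_mem hq this

theorem finrank_iSup_le {k E : Type*} [Field k] [AddCommGroup E] [Module k E] {s : ℕ}
    (A : Fin s → Submodule k E) [∀ i, FiniteDimensional k (A i)] :
    Module.finrank k (⨆ i, A i : Submodule k E) ≤ ∑ i, Module.finrank k (A i) := by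
  induction s with
  | zero => simp
  | succ s ih =>
    rw [Fin.sum_univ_succ]
    have h : (⨆ i, A i) = A 0 ⊔ ⨆ i : Fin s, A i.succ := by
      refine le_antisymm (iSup_le fun i => ?_) (sup_le (le_iSup A 0) (iSup_le fun i => le_iSup A _))
      refine Fin.cases le_sup_left (fun i => ?_) i
      exact (le_iSup (fun i : Fin s => A i.succ) i).trans le_sup_right
    rw [h]
    exact (Submodule.finrank_add_le_finrank_add_finrank _ _).trans
      (Nat.add_le_add_left (ih fun i => A i.succ) _)

theorem finrank_map_add_le {k E F : Type*} [Field k] [AddCommGroup E] [Module k E]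
    [AddCommGroup F] [Module k F] (φ : E →ₗ[k] F) (g : E →ₗ[k] E) (hg : Function.Injective g)
    (W W' : Submodule k E) [FiniteDimensional k W] (h : W'.map g ≤ W ⊓ LinearMap.ker φ) :
    Module.finrank k (W.map φ) + Module.finrank k W' ≤ Module.finrank k W := by
  rw [← LinearMap.finrank_range_add_finrank_ker (φ.domRestrict W), LinearMap.range_domRestrict]
  refine Nat.add_le_add_left ?_ _
  let ψ : W' →ₗ[k] LinearMap.ker (φ.domRestrict W) :=
    ((g.domRestrict W').codRestrict W fun x => (h ⟨x, x.2, rfl⟩).1).codRestrict _ fun x =>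
      (h ⟨x, x.2, rfl⟩).2
  refine LinearMap.finrank_le_finrank_of_injective (f := ψ) fun x y hxy => ?_
  have : g x = g y := congrArg (fun z : LinearMap.ker (φ.domRestrict W) => ((z : W) : E)) hxy
  exact Subtype.ext (hg this)

variable {k : Type*} [Field k] {n : ℕ}

theorem length_map_mkQ_le {J : Ideal (MvPolynomial (Fin n) k)} {a s : ℕ}
    (hJ : idealOfVars (Fin n) k ^ (s + a) ≤ J) :
    Module.length (MvPolynomial (Fin n) k)
        (Submodule.map J.mkQ (idealOfVars (Fin n) k ^ a)) ≤
      (∑ i : Fin s, Module.finrank k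
        ((homogeneousSubmodule (Fin n) k (a + i)).map (J.mkQ.restrictScalars k)) : ℕ) := by
  refine (Submodule.length_le_length_restrictScalars k _).trans ?_
  have hle : (Submodule.map J.mkQ (idealOfVars (Fin n) k ^ a)).restrictScalars k ≤
      ⨆ i : Fin s, (homogeneousSubmodule (Fin n) k (a + i)).map (J.mkQ.restrictScalars k) := by
    rintro _ ⟨p, hp, rfl⟩
    rw [← sum_homogeneousComponent p, map_sum]
    refine Submodule.sum_mem _ fun i _ => ?_
    rcases lt_or_ge i a with hi | hi
    · rw [homogeneousComponent_eq_zero_of_mem_pow hp hi, map_zero]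
      exact Submodule.zero_mem _
    obtain ⟨t, rfl⟩ := Nat.exists_eq_add_of_le hi
    rcases lt_or_ge t s with ht | ht
    · exact Submodule.mem_iSup_of_mem (⟨t, ht⟩ : Fin s)
        ⟨_, homogeneousComponent_isHomogeneous _ p, rfl⟩
    · have : homogeneousComponent (a + t) p ∈ J :=
        hJ (Ideal.pow_le_pow_right (by omega)
          (homogeneousSubmodule_le_pow _ (homogeneousComponent_isHomogeneous _ p)))
      rw [show J.mkQ _ = 0 from (Submodule.Quotient.mk_eq_zero J).2 this]
      exact Submodule.zero_mem _
  have hfin := Submodule.finiteDimensional_of_le hle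
  rw [Module.length_eq_finrank, Nat.cast_le]
  exact (Submodule.finrank_mono hle).trans (finrank_iSup_le _)

/-- The ideal of all `p ∈ 𝔪^N` whose component of degree `N` lies in `W`. -/
noncomputable def leadingIdeal (N : ℕ) (W : Submodule k (MvPolynomial (Fin n) k)) :
    Ideal (MvPolynomial (Fin n) k) where
  carrier := {p | p ∈ idealOfVars (Fin n) k ^ N ∧ homogeneousComponent N p ∈ W}
  add_mem' := fun {p q} hp hq =>
    ⟨Ideal.add_mem _ hp.1 hq.1, by rw [map_add]; exact W.add_mem hp.2 hq.2⟩
  zero_mem' := ⟨Ideal.zero_mem _, by rw [map_zero]; exact W.zero_mem⟩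
  smul_mem' := fun c {p} hp => by
    refine ⟨Ideal.mul_mem_left _ c hp.1, ?_⟩
    have h := homogeneousComponent_mul (p := c) (a := 0) (by simp) hp.1
    rw [zero_add, homogeneousComponent_zero, ← smul_eq_C_mul] at h
    rw [smul_eq_mul, h]
    exact W.smul_mem _ hp.2

theorem finrank_le_length_map_mkQ {J : Ideal (MvPolynomial (Fin n) k)} {N : ℕ}
    {A W : Submodule k (MvPolynomial (Fin n) k)} [FiniteDimensional k A]
    (hJ : ∀ p ∈ J, homogeneousComponent N p ∈ W) {u : MvPolynomial (Fin n) k}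
    (hu : ∀ h ∈ A, h * u ∈ homogeneousSubmodule (Fin n) k N)
    (huW : ∀ h ∈ A, h ≠ 0 → h * u ∉ W) :
    (Module.finrank k A : ℕ∞) ≤ Module.length (MvPolynomial (Fin n) k)
        (Submodule.map J.mkQ (idealOfVars (Fin n) k ^ N)) := by
  rw [← Module.length_eq_finrank, ← WithBot.coe_le_coe, Module.coe_length, Module.coe_length]
  let U (B : Submodule k A) : Submodule k (MvPolynomial (Fin n) k) :=
    B.map ((LinearMap.mulRight k u).comp A.subtype) ⊔ W
  have hU : Monotone U := fun B B' h => sup_le_sup_right (Submodule.map_mono h) _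
  let Φ (B : Submodule k A) : Submodule (MvPolynomial (Fin n) k)
      (Submodule.map J.mkQ (idealOfVars (Fin n) k ^ N)) :=
    Submodule.comap (Submodule.subtype _) (Submodule.map J.mkQ (leadingIdeal N (U B)))
  have hΦ : Monotone Φ := fun B B' h => Submodule.comap_mono
    (Submodule.map_mono fun p hp => ⟨hp.1, hU h hp.2⟩)
  refine Order.krullDim_le_of_strictMono Φ fun B B' hlt => lt_of_le_not_ge (hΦ hlt.le) fun hle => ?_
  obtain ⟨x, hx', hx⟩ := SetLike.exists_of_lt hlt
  have hxu := hu x x.2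
  have hxM := homogeneousSubmodule_le_pow N hxu
  have hxcomp : homogeneousComponent N ((x : MvPolynomial (Fin n) k) * u) = x * u := by
    rw [homogeneousComponent_of_mem hxu, if_pos rfl]
  have hmem : (⟨J.mkQ (x * u), Submodule.mem_map_of_mem hxM⟩ :
      Submodule.map J.mkQ (idealOfVars (Fin n) k ^ N)) ∈ Φ B' :=
    ⟨x * u, ⟨hxM, by rw [hxcomp]; exact Submodule.mem_sup_left ⟨x, hx', rfl⟩⟩, rfl⟩
  obtain ⟨p, ⟨hpM, hpU⟩, hp⟩ := hle hmem
  have hp2 := hJ _ ((Submodule.Quotient.eq J).1 hp)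
  rw [map_sub, hxcomp] at hp2
  have hxU : (x : MvPolynomial (Fin n) k) * u ∈ U B := by
    have := (U B).sub_mem hpU (Submodule.mem_sup_right (S := B.map _) hp2)
    simpa using this
  obtain ⟨_, ⟨y, hy, rfl⟩, w, hw, hyw⟩ := Submodule.mem_sup.1 hxU
  have hyw' : (x - y : A).1 * u ∈ W := by
    have : (x - y : A).1 * u = w := by
      rw [Submodule.coe_sub, sub_mul, ← hyw]
      simp
    rwa [this]
  have hxy : x - y = 0 := by
    by_contra h0
    exact huW _ (x - y).2 (fun h => h0 (Subtype.ext h)) hyw'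
  rw [sub_eq_zero.1 hxy] at hx
  exact hx hy

end Length

section Coefficients

variable {k : Type*} [Field k] {n d : ℕ} {ι : Type*} {f : ι → MvPolynomial (Fin n) k}

theorem exists_length_eq {S : Type*} [CommRing S] {I J : Ideal S} (h : I ≤ J) {a b : ℕ}
    (ha : moduleLength S (S ⧸ I) = (a : ℕ∞)) (hb : moduleLength S (S ⧸ J) = (b : ℕ∞)) :
    ∃ c : ℕ, Module.length S (Submodule.map I.mkQ J) = c ∧ a = c + b := by
  have ha' : Module.length S (S ⧸ I) = a := by
    rw [← WithBot.coe_inj, Module.coe_length]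
    exact ha
  have hb' : Module.length S (S ⧸ J) = b := by
    rw [← WithBot.coe_inj, Module.coe_length]
    exact hb
  have hadd := length_quotient_eq_add h
  rw [ha', hb'] at hadd
  have hne : Module.length S (Submodule.map I.mkQ J) ≠ ⊤ := by
    intro h
    rw [h, top_add] at hadd
    exact ENat.natCast_ne_top a hadd
  lift Module.length S (Submodule.map I.mkQ J) to ℕ using hne with c
  exact ⟨c, rfl, by exact_mod_cast hadd⟩

theorem exists_polynomial_length_map_mkQ {S : Type*} [CommRing S] {I J : Ideal S} (hIJ : I ≤ J)
    {e0 e1 e0' e1' : ℚ} (hJ : HasHilbertCoefficients J (n + 1) e0 e1)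
    (hI : HasHilbertCoefficients I (n + 1) e0' e1') :
    ∃ (δ : ℕ → ℕ) (T : Polynomial ℚ) (N : ℕ),
      (∀ j, Module.length S (Submodule.map (I ^ j).mkQ (J ^ j)) = δ j) ∧
      (∀ m ≥ N, T.eval (m : ℚ) = δ m) ∧ (T.degree ≤ n → (T.degree < n ↔ e1 = e1')) := by
  obtain ⟨l, P, N, hl, hP, hlP⟩ := hJ
  obtain ⟨l', P', N', hl', hP', hlP'⟩ := hI
  choose δ hδ hδl using fun j => exists_length_eq (Ideal.pow_right_mono hIJ j) (hl' j) (hl j)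
  obtain ⟨T, hT, hTdeg⟩ := exists_polynomial_of_hilbert (n := n) (N := max N N') (a := e0' - e0)
    (b := e1' - e1) (Q := P' - P) (δ := δ)
    ((Polynomial.degree_sub_le _ _).trans_lt (max_lt hP' hP)) fun m hm => by
      have h1 := hlP m (le_trans (le_max_left _ _) hm)
      have h2 := hlP' m (le_trans (le_max_right _ _) hm)
      rw [hδl, Nat.cast_add] at h2
      rw [Polynomial.eval_sub]
      simp only [Nat.add_sub_cancel, ← add_assoc,
        show m + n + 1 - 2 = m + n - 1 by omega] at h1 h2
      linear_combination h2 - h1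
  refine ⟨δ, T, max N N', hδ, hT, fun h => (hTdeg h).trans ?_⟩
  rw [sub_eq_zero, eq_comm]

theorem length_map_mkQ_le_sum (hf : ∀ i, (f i).IsHomogeneous d) {s : ℕ}
    (hs : idealOfVars (Fin n) k ^ s ≤ Ideal.span (Set.range f)) (j : ℕ) :
    Module.length (MvPolynomial (Fin n) k) (Submodule.map (Ideal.span (Set.range f) ^ j).mkQ
        ((idealOfVars (Fin n) k ^ d) ^ j)) ≤
      (∑ i : Fin s, n.multichoose (d * j + i) : ℕ) := by
  rw [← pow_mul]
  refine (length_map_mkQ_le (pow_idealOfVars_le hf hs j)).trans (Nat.cast_le.2 ?_)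
  refine Finset.sum_le_sum fun i _ => ?_
  rw [← finrank_homogeneousSubmodule (k := k)]
  exact Submodule.finrank_map_le _ _

theorem length_map_mkQ_add_sum_le (hf : ∀ i, (f i).IsHomogeneous d) {s : ℕ}
    (hs : idealOfVars (Fin n) k ^ s ≤ Ideal.span (Set.range f))
    {e : ℕ} {h : MvPolynomial (Fin n) k}
    (he : h ∈ Submodule.span k (Set.range f) ^ e) (h0 : h ≠ 0)
    (hh : ∀ j, ∀ u ∈ homogeneousSubmodule (Fin n) k (d * j),
      h * u ∈ Submodule.span k (Set.range f) ^ (e + j)) (j : ℕ) :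
    Module.length (MvPolynomial (Fin n) k)
        (Submodule.map (Ideal.span (Set.range f) ^ (j + e)).mkQ
          ((idealOfVars (Fin n) k ^ d) ^ (j + e))) +
        (∑ i : Fin s, n.multichoose (d * j + i) : ℕ) ≤
      (∑ i : Fin s, n.multichoose (d * (j + e) + i) : ℕ) := by
  rw [← pow_mul]
  refine (add_le_add_left (length_map_mkQ_le (pow_idealOfVars_le hf hs (j + e))) _).trans ?_
  rw [← Nat.cast_add, Nat.cast_le, ← Finset.sum_add_distrib]
  refine Finset.sum_le_sum fun i _ => ?_
  rw [← finrank_homogeneousSubmodule (k := k), ← finrank_homogeneousSubmodule (k := k)]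
  refine finrank_map_add_le _ (LinearMap.mulLeft k h) (fun x y hxy => mul_left_cancel₀ h0 hxy)
    _ _ ?_
  rintro _ ⟨u, hu, rfl⟩
  refine ⟨?_, (Submodule.Quotient.mk_eq_zero _).2 ?_⟩
  · have := IsHomogeneous.mul (span_pow_le_homogeneousSubmodule hf e he) hu
    rwa [show d * e + (d * j + i) = d * (j + e) + i by ring] at this
  · rw [add_comm j e]
    refine mul_mem_pow_of_forall_mul_mem hh j ?_
    rw [← pow_mul]
    exact Ideal.pow_le_pow_right (Nat.le_add_right _ _) (homogeneousSubmodule_le_pow _ hu)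

theorem multichoose_le_length_mul (hf : ∀ i, (f i).IsHomogeneous d) {s : ℕ}
    (hs : idealOfVars (Fin n) k ^ s ≤ Ideal.span (Set.range f))
    {u : MvPolynomial (Fin n) k} (hu : u.IsHomogeneous d)
    (hV : ∀ e, ∀ h ∈ Submodule.span k (Set.range f) ^ e, h ≠ 0 →
      h * u ∉ Submodule.span k (Set.range f) ^ (e + 1)) (j : ℕ) :
    (n.multichoose (s + d * j) : ℕ∞) ≤ Module.length (MvPolynomial (Fin n) k)
        (Submodule.map (Ideal.span (Set.range f) ^ (j + 1)).mkQ
          ((idealOfVars (Fin n) k ^ d) ^ (j + 1))) * (n.multichoose s : ℕ) := by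
  have hVH := span_pow_le_homogeneousSubmodule hf j
  have hfin := Submodule.finiteDimensional_of_le hVH
  have h1 : n.multichoose (s + d * j) ≤
      Module.finrank k (Submodule.span k (Set.range f) ^ j : Submodule k _) * n.multichoose s := by
    rw [← finrank_homogeneousSubmodule (k := k), ← finrank_homogeneousSubmodule (k := k),
      mul_comm (Module.finrank k _)]
    have : Module.Finite k (homogeneousSubmodule (Fin n) k s *
        Submodule.span k (Set.range f) ^ j : Submodule k (MvPolynomial (Fin n) k)) :=
      Module.Finite.iff_fg.2 ((Module.Finite.iff_fg.1 inferInstance).mul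
        (Module.Finite.iff_fg.1 hfin))
    refine le_trans (Submodule.finrank_mono (homogeneousSubmodule_add_mul_le hf hs le_rfl j)) ?_
    exact finrank_mul_le _ _
  have h2 := finrank_le_length_map_mkQ (J := Ideal.span (Set.range f) ^ (j + 1))
    (N := d * (j + 1)) (A := Submodule.span k (Set.range f) ^ j)
    (W := Submodule.span k (Set.range f) ^ (j + 1)) (u := u)
    (fun p hp => homogeneousComponent_mem_span_pow hf hp)
    (fun h hh => IsHomogeneous.mul (hVH hh) hu) (hV j)
  rw [← pow_mul]
  refine le_trans (Nat.cast_le.2 h1) ?_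
  rw [Nat.cast_mul]
  gcongr

theorem exists_mul_mem_iff_coefficients_eq {n : ℕ} {f : ι → MvPolynomial (Fin (n + 1)) k}
    (hd : 1 ≤ d) (hf : ∀ i, (f i).IsHomogeneous d) {s : ℕ}
    (hs : idealOfVars (Fin (n + 1)) k ^ s ≤ Ideal.span (Set.range f)) {e0 e1 e0' e1' : ℚ}
    (hM : HasHilbertCoefficients (idealOfVars (Fin (n + 1)) k ^ d) (n + 1) e0 e1)
    (hI : HasHilbertCoefficients (Ideal.span (Set.range f)) (n + 1) e0' e1') :
    (∀ u : MvPolynomial (Fin (n + 1)) k, u.IsHomogeneous d →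
      ∃ e, ∃ h ∈ Submodule.span k (Set.range f) ^ e, h ≠ 0 ∧
        h * u ∈ Submodule.span k (Set.range f) ^ (e + 1)) ↔ e1 = e1' := by
  have hle : Ideal.span (Set.range f) ≤ idealOfVars (Fin (n + 1)) k ^ d := by
    simpa using ideal_span_pow_le_pow hf 1
  obtain ⟨δ, T, N, hδ, hT, hdeg⟩ := exists_polynomial_length_map_mkQ hle hM hI
  rw [← hdeg (degree_le_of_le_sum hT fun j => by
    exact_mod_cast (hδ j).symm.le.trans (length_map_mkQ_le_sum hf hs j))]
  constructor
  · intro H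
    obtain ⟨e, h, he, h0, hh⟩ := exists_mul_homogeneousSubmodule_mul_le hd hf hs H
    refine degree_lt_of_add_sum_le (s := s) (e := e) hd hT fun j => ?_
    have := length_map_mkQ_add_sum_le hf hs he h0 hh j
    rw [hδ] at this
    exact_mod_cast this
  · intro hlt
    by_contra! H
    obtain ⟨u, hu, hV⟩ := H
    refine not_degree_lt_of_le_mul (s := s) (c := (n + 1).multichoose s) hd hT (fun j => ?_) hlt
    have := multichoose_le_length_mul hf hs hu hV j
    rw [hδ] at this
    exact_mod_cast this

end Coefficients

end EquigeneratedIdeal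

/-- Let `k` be an infinite field, `R = k[x_1,…,x_n]`, `m = (x_1,…,x_n)`,
and let `f_1,…,f_{n+1}` be forms of degree `d` generating an `m`-primary ideal `I`.  Then
the rational map `Ψ : P^{n−1} ⇢ P^n` defined by `f_1,…,f_{n+1}` is birational onto its
image (i.e. the fraction fields of `k[f_1,…,f_{n+1}]` and of the Veronese subring
`k[m^d]` coincide) if and only if the first Hilbert coefficients satisfy
`e_1(m^d) = e_1(I)`.  Moreover the `R[It]`-module `D = R[m^d t]/R[It]` has dimension at
most `n`, and `Ψ` is birational onto its image if and only if `dim D ≤ n − 1`. -/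
theorem birational_iff_chern_coefficients_eq
    (k : Type*) [Field k] [Infinite k] (n d : ℕ) (hn : 1 ≤ n) (hd : 1 ≤ d)
    (f : Fin (n + 1) → MvPolynomial (Fin n) k)
    (hfhom : ∀ i, (f i).IsHomogeneous d)
    (I : Ideal (MvPolynomial (Fin n) k)) (hI : I = Ideal.span (Set.range f))
    (hprim : I.radical = Ideal.span (Set.range (X : Fin n → MvPolynomial (Fin n) k)))
    (L L' : IntermediateField k (FractionRing (MvPolynomial (Fin n) k)))
    (hL : L = IntermediateField.adjoin k
      (algebraMap (MvPolynomial (Fin n) k) (FractionRing (MvPolynomial (Fin n) k)) ''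
        (Algebra.adjoin k (Set.range f) : Set (MvPolynomial (Fin n) k))))
    (hL' : L' = IntermediateField.adjoin k
      (algebraMap (MvPolynomial (Fin n) k) (FractionRing (MvPolynomial (Fin n) k)) ''
        (Algebra.adjoin k {p : MvPolynomial (Fin n) k | p.IsHomogeneous d} :
          Set (MvPolynomial (Fin n) k)))) :
    (∀ e0 e1 e0' e1' : ℚ,
      HasHilbertCoefficients
        ((Ideal.span (Set.range (X : Fin n → MvPolynomial (Fin n) k))) ^ d) n e0 e1 →
      HasHilbertCoefficients I n e0' e1' → (L = L' ↔ e1 = e1')) ∧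
    ringKrullDim
        ((reesAlgebra I) ⧸
          quotAnnihilator (reesAlgebra I)
            (reesAlgebra ((Ideal.span (Set.range (X : Fin n → MvPolynomial (Fin n) k))) ^ d))) ≤
      (n : WithBot ℕ∞) ∧
    (L = L' ↔
      ringKrullDim
          ((reesAlgebra I) ⧸
            quotAnnihilator (reesAlgebra I)
              (reesAlgebra
                ((Ideal.span (Set.range (X : Fin n → MvPolynomial (Fin n) k))) ^ d))) ≤
        ((n - 1 : ℕ) : WithBot ℕ∞)) := by
  subst hI hL hL'
  obtain ⟨s, hs⟩ := EquigeneratedIdeal.exists_pow_le_of_radical_eq hprim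
  rw [EquigeneratedIdeal.adjoin_eq_adjoin_iff hd hfhom]
  refine ⟨fun e0 e1 e0' e1' hM hJ => ?_,
    EquigeneratedIdeal.ringKrullDim_quotient_quotAnnihilator_le hd hfhom hs, fun H => ?_,
    fun hdim => EquigeneratedIdeal.exists_mul_mem_of_ringKrullDim_lt hd hfhom hs
      (hdim.trans_lt (by exact_mod_cast Nat.sub_lt hn one_pos))⟩
  · obtain ⟨n, rfl⟩ := Nat.exists_eq_add_of_le' hn
    exact EquigeneratedIdeal.exists_mul_mem_iff_coefficients_eq hd hfhom hs hM hJ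
  · obtain ⟨e, h, he, h0, hh⟩ :=
      EquigeneratedIdeal.exists_mul_homogeneousSubmodule_mul_le hd hfhom hs H
    have h1 := EquigeneratedIdeal.ringKrullDim_quotient_add_one_le hd hfhom hs he h0 hh
    rw [← ENat.WithBot.add_le_add_one_right_iff]
    refine h1.trans (le_of_eq ?_)
    exact_mod_cast (Nat.sub_add_cancel hn).symm
end
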